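/- arXiv:1509.03876 — 7 statements merged into one kernel-verified Lean document; each statement's English description precedes it below -/
import Mathlib

section
/- There exist an absolute constant c > 0 and a function m : ℝ → ℕ such that the following holds. Let K ≥ 1, let G be a residually nilpotent group, and let A be a K-approximate subgroup of G. Then there exist subgroups H and C of G with H normal in C such that: (1) H ⊆ A^{m(K)}; (2) the quotient C/H is nilpotent of nilpotency class at most K^6; (3) A can be covered by at most exp(K^c) left cosets of C. -/
open Pointwise

universe u

/-- A finite symmetric subset `A` (with `1 ∈ A`) of a group `G` is a `K`-approximate
subgroup if there is a set `X ⊆ G` with `|X| ≤ K` and `A·A ⊆ X·A`. -/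
def IsKApproximateSubgroup {G : Type*} [Group G] (K : ℝ) (A : Set G) : Prop :=
  A.Finite ∧ A⁻¹ = A ∧ (1 : G) ∈ A ∧
    ∃ X : Set G, X.Finite ∧ (X.ncard : ℝ) ≤ K ∧ A * A ⊆ X * A

/-- A group is residually nilpotent if every nontrivial element survives in some
nilpotent quotient. -/
def ResiduallyNilpotent (G : Type u) [Group G] : Prop :=
  ∀ g : G, g ≠ 1 → ∃ (N : Type u) (_ : Group N) (π : G →* N),
    Group.IsNilpotent N ∧ π g ≠ 1

section ProductSets

open scoped commutatorElement

variable {G : Type*} [Group G] {A : Set G}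

theorem mul_mem_pow_add {m n : ℕ} {x y : G} (hx : x ∈ A ^ m) (hy : y ∈ A ^ n) :
    x * y ∈ A ^ (m + n) := by
  rw [pow_add]; exact Set.mul_mem_mul hx hy

theorem inv_mem_pow_of_symm (hA : A⁻¹ = A) {n : ℕ} {x : G} (hx : x ∈ A ^ n) :
    x⁻¹ ∈ A ^ n := by
  rw [← hA, inv_pow]; exact Set.inv_mem_inv.2 hx

theorem conj_mem_pow (hA : A⁻¹ = A) {m n : ℕ} {x y : G} (hx : x ∈ A ^ m) (hy : y ∈ A ^ n) :
    x * y * x⁻¹ ∈ A ^ (m + n + m) :=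
  mul_mem_pow_add (mul_mem_pow_add hx hy) (inv_mem_pow_of_symm hA hx)

theorem comm_mem_pow (hA : A⁻¹ = A) {m n : ℕ} {x y : G} (hx : x ∈ A ^ m) (hy : y ∈ A ^ n) :
    ⁅x, y⁆ ∈ A ^ (m + n + m + n) :=
  mul_mem_pow_add (conj_mem_pow hA hx hy) (inv_mem_pow_of_symm hA hy)

theorem finite_pow (hA : A.Finite) (n : ℕ) : (A ^ n).Finite := by
  induction n with
  | zero => simp
  | succ n ih => rw [pow_succ]; exact ih.mul hA

theorem IsKApproximateSubgroup.exists_cover_pow {K : ℝ} (hA : IsKApproximateSubgroup K A)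
    (n : ℕ) : ∃ X : Set G, X.Finite ∧ (X.ncard : ℝ) ≤ K ^ n ∧ A ^ (n + 1) ⊆ X * A := by
  obtain ⟨-, -, -, X, hX, hXK, hXA⟩ := hA
  induction n with
  | zero => exact ⟨{1}, Set.finite_singleton _, by simp, by simp⟩
  | succ n ih =>
    obtain ⟨Y, hY, hYK, hYA⟩ := ih
    refine ⟨Y * X, hY.mul hX, ?_, ?_⟩
    · have h : (Y * X).ncard ≤ Y.ncard * X.ncard := Set.natCard_mul_le
      calc ((Y * X).ncard : ℝ) ≤ Y.ncard * X.ncard := by exact_mod_cast h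
        _ ≤ K ^ n * K := mul_le_mul hYK hXK (by positivity) ((Nat.cast_nonneg _).trans hYK)
        _ = _ := (pow_succ _ _).symm
    · rw [pow_succ, mul_assoc]
      exact (Set.mul_subset_mul_right hYA).trans
        (by rw [mul_assoc]; exact Set.mul_subset_mul_left hXA)

/-- The right translates of `A` by the elements of `S` are pairwise disjoint. -/
def Separated (A : Set G) (S : Finset G) : Prop :=
  ∀ s ∈ S, ∀ t ∈ S, s ≠ t → s * t⁻¹ ∉ A ^ 2

theorem IsKApproximateSubgroup.card_separated_le {K : ℝ} (hA : IsKApproximateSubgroup K A)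
    {p : ℕ} {S : Finset G} (hS : Separated A S) (hSA : (S : Set G) ⊆ A ^ p) :
    (S.card : ℝ) ≤ K ^ p := by
  obtain ⟨X, hX, hXK, hXA⟩ := hA.exists_cover_pow p
  obtain ⟨hfin, hsymm, hone, -⟩ := hA
  have hinj : Function.Injective (fun q : A × S => ((q.1 : G) * (q.2 : G))) := by
    rintro ⟨⟨a, ha⟩, ⟨s, hs⟩⟩ ⟨⟨b, hb⟩, ⟨t, ht⟩⟩ h
    have h' : a * s = b * t := h
    have hst : s = t := by
      by_contra hne
      apply hS s hs t ht hne
      have : s * t⁻¹ = a⁻¹ * b := by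
        rw [mul_inv_eq_iff_eq_mul, mul_assoc, ← h', inv_mul_cancel_left]
      rw [this, pow_two]
      exact Set.mul_mem_mul (by rw [← hsymm]; exact Set.inv_mem_inv.2 ha) hb
    subst hst
    simpa using h'
  have hXAfin : (X * A).Finite := hX.mul hfin
  have hle : Nat.card (A × S) ≤ (X * A).ncard := by
    have : Finite ↥(X * A) := hXAfin
    refine Nat.card_le_card_of_injective
      (fun q : A × S => (⟨(q.1 : G) * (q.2 : G), hXA ?_⟩ : ↥(X * A))) ?_
    · rw [pow_succ']
      exact Set.mul_mem_mul q.1.2 (hSA q.2.2)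
    · intro q r h
      exact hinj (congrArg Subtype.val h)
  have hmul : (X * A).ncard ≤ X.ncard * A.ncard := Set.natCard_mul_le
  have hApos : 0 < A.ncard := (Set.ncard_pos hfin).2 ⟨1, hone⟩
  have hcard : Nat.card (A × S) = A.ncard * S.card := by
    rw [Nat.card_prod]; simp [Set.ncard]
  have hfinal : S.card ≤ X.ncard := by
    rw [hcard] at hle
    exact Nat.le_of_mul_le_mul_left (by nlinarith [hle.trans hmul]) hApos
  exact (by exact_mod_cast hfinal : (S.card : ℝ) ≤ X.ncard).trans hXK

theorem Separated.insert [DecidableEq G] (hA : A⁻¹ = A) {S : Finset G} (hS : Separated A S)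
    {N : Subgroup G} (hSN : (S : Set G) ⊆ N) {x : G} (hx : x ∉ A ^ 2 * (N : Set G)) :
    Separated A (insert x S) := by
  have key : ∀ s ∈ S, x * s⁻¹ ∉ A ^ 2 := by
    intro s hs h
    exact hx ⟨x * s⁻¹, h, s, hSN hs, by simp⟩
  intro s hs t ht hst
  rw [Finset.mem_insert] at hs ht
  rcases hs with rfl | hs <;> rcases ht with rfl | ht
  · exact absurd rfl hst
  · exact key t ht
  · intro h
    apply key s hs
    simpa using inv_mem_pow_of_symm hA h
  · exact hS s hs t ht hst

theorem notMem_of_notMem_mul {S : Finset G} {N : Subgroup G} (hA : (1 : G) ∈ A)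
    (hSN : (S : Set G) ⊆ N) {x : G} (hx : x ∉ A ^ 2 * (N : Set G)) : x ∉ S := by
  intro h
  exact hx ⟨1, Set.one_mem_pow hA, x, hSN h, by simp⟩

end ProductSets

section CentralSeries

open scoped commutatorElement

variable {Q : Type*} [Group Q]

theorem commutatorElement_mem_iff {T : Subgroup Q} [T.Normal] {x y : Q} :
    ⁅x, y⁆ ∈ T ↔ (x : Q ⧸ T) * (y : Q ⧸ T) = (y : Q ⧸ T) * (x : Q ⧸ T) := by
  rw [← QuotientGroup.eq_one_iff, commutatorElement_def]
  simp only [QuotientGroup.mk_mul, QuotientGroup.mk_inv]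
  rw [mul_inv_eq_one, mul_inv_eq_iff_eq_mul]

theorem commutatorElement_mem_of_closure_eq_top {S : Set Q} (hS : Subgroup.closure S = ⊤)
    {T : Subgroup Q} [T.Normal] {x : Q} (h : ∀ s ∈ S, ⁅x, s⁆ ∈ T) (y : Q) : ⁅x, y⁆ ∈ T := by
  have hcl : Subgroup.closure S ≤
      (Subgroup.centralizer {(x : Q ⧸ T)}).comap (QuotientGroup.mk' T) := by
    rw [Subgroup.closure_le]
    intro s hs
    simp only [Subgroup.coe_comap, Set.mem_preimage, SetLike.mem_coe,
      Subgroup.mem_centralizer_singleton_iff]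
    exact (commutatorElement_mem_iff.1 (h s hs)).symm
  have hy : y ∈ Subgroup.closure S := hS ▸ Subgroup.mem_top y
  exact commutatorElement_mem_iff.2 (Subgroup.mem_centralizer_singleton_iff.1 (hcl hy)).symm

/-- The commutator series of `H` with the whole group is eventually trivial; if `T` absorbs every
normal subgroup inside `B' * T`, then the centre modulo `T` absorbs those inside `B * U`. -/
theorem le_center_mod_of_absorbing [Group.IsNilpotent Q] {S : Set Q}
    (hS : Subgroup.closure S = ⊤) {T U : Subgroup Q} [T.Normal]
    (hU : ∀ x, x ∈ U ↔ ∀ y, ⁅x, y⁆ ∈ T) {B B' : Set Q}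
    (hB : ∀ a ∈ B, ∀ s ∈ S, ⁅a, s⁆ ∈ B')
    (hT : ∀ H : Subgroup Q, H.Normal → (H : Set Q) ⊆ B' * (T : Set Q) → H ≤ T)
    {H : Subgroup Q} (hH : H.Normal) (hHB : (H : Set Q) ⊆ B * (U : Set Q)) : H ≤ U := by
  obtain ⟨R, hR0, hRs⟩ : ∃ R : ℕ → Subgroup Q, R 0 = H ∧
      ∀ j, R (j + 1) = ⁅R j, (⊤ : Subgroup Q)⁆ :=
    ⟨fun j => (fun L : Subgroup Q => ⁅L, (⊤ : Subgroup Q)⁆)^[j] H, rfl,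
      fun j => Function.iterate_succ_apply' _ _ _⟩
  have hRn : ∀ j, (R j).Normal := by
    intro j
    induction j with
    | zero => exact hR0 ▸ hH
    | succ j ih => rw [hRs]; exact Subgroup.commutator_normal (R j) ⊤
  have hRle : ∀ j, R j ≤ H := by
    intro j
    induction j with
    | zero => exact hR0.le
    | succ j ih =>
      refine le_trans ?_ ih
      rw [hRs]
      have hn := hRn j
      exact Subgroup.commutator_le_left (R j) ⊤
  have hRl : ∀ j, R j ≤ (⊤ : Subgroup Q).lowerCentralSeries j := by
    intro j
    induction j with
    | zero => exact le_top
    | succ j ih =>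
      rw [hRs, Subgroup.lowerCentralSeries_succ]
      exact Subgroup.commutator_mono ih le_rfl
  have step : ∀ j, R (j + 2) ≤ T → R (j + 1) ≤ T := by
    intro j hj
    have hcen : ∀ z ∈ R (j + 1), ∀ y : Q,
        (z : Q ⧸ T) * (y : Q ⧸ T) = (y : Q ⧸ T) * (z : Q ⧸ T) := by
      intro z hz y
      refine commutatorElement_mem_iff.1 (hj ?_)
      rw [hRs (j + 1)]; exact Subgroup.commutator_mem_commutator hz (Subgroup.mem_top y)
    have hcomm : ∀ r ∈ R j, ∀ y : Q, ⁅r, y⁆ ∈ R (j + 1) := by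
      intro r hr y
      rw [hRs j]; exact Subgroup.commutator_mem_commutator hr (Subgroup.mem_top y)
    have hrs : ∀ s ∈ S, ∀ r ∈ R j, ⁅r, s⁆ ∈ T := by
      intro s hs
      have hmul : ∀ a ∈ R j, ∀ b ∈ R j, ((⁅a * b, s⁆ : Q) : Q ⧸ T) =
          ((⁅a, s⁆ : Q) : Q ⧸ T) * ((⁅b, s⁆ : Q) : Q ⧸ T) := by
        intro a _ b hb
        have e : ⁅a * b, s⁆ = a * ⁅b, s⁆ * a⁻¹ * ⁅a, s⁆ := by
          simp only [commutatorElement_def]; group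
        have c1 := hcen _ (hcomm b hb s) a
        have c2 := hcen _ (hcomm b hb s) ⁅a, s⁆
        rw [e]
        simp only [QuotientGroup.mk_mul, QuotientGroup.mk_inv]
        rw [← c1, mul_inv_cancel_right, c2]
      let ψ : R j →* Q ⧸ T :=
        { toFun := fun r => ((⁅(r : Q), s⁆ : Q) : Q ⧸ T)
          map_one' := by simp
          map_mul' := fun a b => hmul a a.2 b b.2 }
      let V : Subgroup Q := ψ.range.comap (QuotientGroup.mk' T)
      have hVmem : ∀ x, x ∈ V ↔ ∃ r ∈ R j, ((⁅r, s⁆ : Q) : Q ⧸ T) = (x : Q ⧸ T) := by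
        intro x
        constructor
        · rintro ⟨r, hr⟩
          exact ⟨r, r.2, hr⟩
        · rintro ⟨r, hr, h⟩
          exact ⟨⟨r, hr⟩, h⟩
      have hVn : V.Normal := by
        constructor
        intro x hx g
        obtain ⟨r, hr, h⟩ := (hVmem x).1 hx
        refine (hVmem _).2 ⟨r, hr, ?_⟩
        have c := hcen _ (hcomm r hr s) g
        rw [h] at c
        simp only [QuotientGroup.mk_mul, QuotientGroup.mk_inv]
        rw [← c, mul_inv_cancel_right, h]
      have hVT : V ≤ T := by
        apply hT V hVn
        intro x hx
        obtain ⟨r, hr, h⟩ := (hVmem x).1 hx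
        obtain ⟨a, ha, u, hu, hau⟩ := hHB (hRle j hr)
        have hus : ⁅u, s⁆ ∈ T := (hU u).1 hu s
        have e : ⁅r, s⁆ = a * ⁅u, s⁆ * a⁻¹ * ⁅a, s⁆ := by
          simp only [← hau, commutatorElement_def]; group
        have h2 : ((⁅a, s⁆ : Q) : Q ⧸ T) = (x : Q ⧸ T) := by
          rw [← h, e]
          have : ((⁅u, s⁆ : Q) : Q ⧸ T) = 1 := (QuotientGroup.eq_one_iff _).2 hus
          rw [QuotientGroup.mk_mul, QuotientGroup.mk_mul, QuotientGroup.mk_mul, this]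
          simp
        exact ⟨⁅a, s⁆, hB a ha s hs, _, QuotientGroup.eq.1 h2, mul_inv_cancel_left _ _⟩
      intro r hr
      exact hVT ((hVmem _).2 ⟨r, hr, rfl⟩)
    rw [hRs j, Subgroup.commutator_le]
    intro r hr y _
    exact commutatorElement_mem_of_closure_eq_top hS (fun s hs => hrs s hs r hr) y
  have hR1 : R 1 ≤ T := by
    obtain ⟨n, hn⟩ := Subgroup.nilpotent_iff_lowerCentralSeries.1 ‹Group.IsNilpotent Q›
    have hbase : R (n + 1) ≤ T :=
      (hRl _).trans ((Subgroup.lowerCentralSeries_antitone _ n.le_succ).trans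
        (by rw [hn]; exact bot_le))
    clear hn
    induction n with
    | zero => exact hbase
    | succ n ih => exact ih (step n hbase)
  intro x hx
  rw [hU]
  intro y
  exact hR1 (by
    rw [hRs 0, hR0]; exact Subgroup.commutator_mem_commutator hx (Subgroup.mem_top y))

theorem le_upperCentralSeries_of_absorbing [Group.IsNilpotent Q] {S : Set Q}
    (hS : Subgroup.closure S = ⊤) {B : ℕ → Set Q} (hBmono : Monotone B)
    (hB : ∀ n, ∀ a ∈ B n, ∀ s ∈ S, ⁅a, s⁆ ∈ B (2 * n + 12)) {n₀ : ℕ}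
    (h₀ : ∀ H : Subgroup Q, H.Normal → (H : Set Q) ⊆ B n₀ → H = ⊥) (k n : ℕ)
    (hn : 2 ^ k * (n + 12) ≤ n₀) (H : Subgroup Q) (hH : H.Normal)
    (hHB : (H : Set Q) ⊆ B n * (Subgroup.upperCentralSeries Q k : Set Q)) :
    H ≤ Subgroup.upperCentralSeries Q k := by
  induction k generalizing n H with
  | zero =>
    have : H = ⊥ := h₀ H hH (by
      refine hHB.trans ?_
      simpa using hBmono (by omega : n ≤ n₀))
    rw [this]; exact bot_le
  | succ k ih =>
    refine le_center_mod_of_absorbing hS (T := Subgroup.upperCentralSeries Q k)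
      (fun x => Subgroup.mem_upperCentralSeries_succ_iff) (hB n) ?_ hH hHB
    intro L hL hLB
    exact ih (2 * n + 12) (by rw [pow_succ] at hn; linarith) L hL hLB

/-- Left-normed commutators of increasing weight of elements of `S`. -/
def iteratedCommutators (S : Set Q) : ℕ → Set Q
  | 0 => S
  | j + 1 => {w | ∃ v ∈ iteratedCommutators S j, ∃ s ∈ S, w = ⁅v, s⁆}

theorem upperCentralSeries_eq_top_of_iteratedCommutators {S : Set Q}
    (hS : Subgroup.closure S = ⊤) {n : ℕ} (h : iteratedCommutators S n ⊆ {1}) :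
    Subgroup.upperCentralSeries Q n = ⊤ := by
  have key : ∀ i ≤ n, iteratedCommutators S (n - i) ⊆ Subgroup.upperCentralSeries Q i := by
    intro i
    induction i with
    | zero =>
      intro _ x hx
      simpa using h hx
    | succ i ih =>
      intro hi x hx
      rw [SetLike.mem_coe, Subgroup.mem_upperCentralSeries_succ_iff]
      intro y
      refine commutatorElement_mem_of_closure_eq_top hS (fun s hs => ih (by omega) ?_) y
      rw [show n - i = (n - (i + 1)) + 1 by omega]
      exact ⟨x, hx, s, hs, rfl⟩
  rw [eq_top_iff, ← hS, Subgroup.closure_le]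
  simpa [iteratedCommutators] using key n le_rfl

end CentralSeries

section RelativeSubgroups

open scoped commutatorElement

variable {G : Type*} [Group G]

/-- The elements of `C` commuting with every element of `s` modulo `P`, where `C` normalizes
`P`. -/
def centralizerMod (P C : Subgroup G) (hP : ∀ c ∈ C, ∀ p ∈ P, c * p * c⁻¹ ∈ P) (s : Set G) :
    Subgroup G where
  carrier := {y | y ∈ C ∧ ∀ c ∈ s, ⁅y, c⁆ ∈ P}
  one_mem' := ⟨C.one_mem, fun c _ => by simp⟩
  mul_mem' := by
    rintro y z ⟨hy, hy'⟩ ⟨hz, hz'⟩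
    refine ⟨C.mul_mem hy hz, fun c hc => ?_⟩
    have e : ⁅y * z, c⁆ = y * ⁅z, c⁆ * y⁻¹ * ⁅y, c⁆ := by
      simp only [commutatorElement_def]; group
    rw [e]
    exact P.mul_mem (hP y hy _ (hz' c hc)) (hy' c hc)
  inv_mem' := by
    rintro y ⟨hy, hy'⟩
    refine ⟨C.inv_mem hy, fun c hc => ?_⟩
    have e : ⁅y⁻¹, c⁆ = y⁻¹ * ⁅y, c⁆⁻¹ * y⁻¹⁻¹ := by
      simp only [commutatorElement_def]; group
    rw [e]
    exact hP _ (C.inv_mem hy) _ (P.inv_mem (hy' c hc))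

theorem mem_centralizerMod {P C : Subgroup G} {hP : ∀ c ∈ C, ∀ p ∈ P, c * p * c⁻¹ ∈ P}
    {s : Set G} {y : G} : y ∈ centralizerMod P C hP s ↔ y ∈ C ∧ ∀ c ∈ s, ⁅y, c⁆ ∈ P :=
  Iff.rfl

/-- If `F` normalizes `N ≤ F` and `A ^ 4 ∩ F ⊆ A ^ 2 * N`, then `F ∩ (A ^ 2 * N)` is a
subgroup. -/
def sqMulSubgroup (A : Set G) (hone : (1 : G) ∈ A) (hsymm : A⁻¹ = A) (N F : Subgroup G)
    (hNF : N ≤ F) (hnorm : ∀ c ∈ F, ∀ n ∈ N, c * n * c⁻¹ ∈ N)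
    (hF : ∀ x ∈ A ^ 4, x ∈ F → x ∈ A ^ 2 * (N : Set G)) : Subgroup G where
  carrier := {x | x ∈ F ∧ x ∈ A ^ 2 * (N : Set G)}
  one_mem' := ⟨F.one_mem, Set.mem_mul.2 ⟨1, Set.one_mem_pow hone, 1, N.one_mem, by simp⟩⟩
  mul_mem' := by
    rintro _ _ ⟨hx, a, ha, n, hn, rfl⟩ ⟨hy, b, hb, m, hm, rfl⟩
    refine ⟨F.mul_mem hx hy, ?_⟩
    have haF : a ∈ F := by simpa using F.mul_mem hx (F.inv_mem (hNF hn))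
    have hbF : b ∈ F := by simpa using F.mul_mem hy (F.inv_mem (hNF hm))
    obtain ⟨d, hd, k, hk, hdk⟩ := hF (a * b) (mul_mem_pow_add ha hb) (F.mul_mem haF hbF)
    have hn' : b⁻¹ * n * b ∈ N := by simpa using hnorm b⁻¹ (F.inv_mem hbF) n hn
    refine ⟨d, hd, k * (b⁻¹ * n * b) * m, N.mul_mem (N.mul_mem hk hn') hm, ?_⟩
    have hdk' : d * k = a * b := hdk
    simp only [← mul_assoc, hdk']
    group
  inv_mem' := by
    rintro _ ⟨hx, a, ha, n, hn, rfl⟩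
    have haF : a ∈ F := by simpa using F.mul_mem hx (F.inv_mem (hNF hn))
    exact ⟨F.inv_mem hx, a⁻¹, inv_mem_pow_of_symm hsymm ha, a * n⁻¹ * a⁻¹,
      hnorm a haF _ (N.inv_mem hn), by simp only; group⟩

/-- A subgroup `T` of `A ^ m`, normal in `D`, that absorbs every subgroup normal in `D` and
contained in `A ^ n * T`. -/
theorem IsKApproximateSubgroup.exists_absorbing {A : Set G} {K : ℝ}
    (hA : IsKApproximateSubgroup K A) (D : Subgroup G) (n : ℕ) :
    ∃ T ≤ D, (∀ d ∈ D, ∀ t ∈ T, d * t * d⁻¹ ∈ T) ∧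
      (T : Set G) ⊆ A ^ (2 + (n + 2) * ⌊K ^ (n + 2)⌋₊) ∧
      ∀ H ≤ D, T ≤ H → (∀ d ∈ D, ∀ h ∈ H, d * h * d⁻¹ ∈ H) →
        (H : Set G) ⊆ A ^ n * (T : Set G) → H ≤ T := by
  classical
  have hA' := hA
  obtain ⟨hfin, hsymm, hone, -⟩ := hA'
  obtain ⟨j, hj, H, hHD, hHn, hHA, hmax⟩ : ∃ j ≤ ⌊K ^ (n + 2)⌋₊, ∃ H ≤ D,
      (∀ d ∈ D, ∀ h ∈ H, d * h * d⁻¹ ∈ H) ∧ (H : Set G) ⊆ A ^ ((n + 2) * j) ∧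
      ∀ H' ≤ D, H ≤ H' → (∀ d ∈ D, ∀ h ∈ H', d * h * d⁻¹ ∈ H') →
        (H' : Set G) ⊆ A ^ (n + 2) * (H : Set G) → (H' : Set G) ⊆ A ^ 2 * (H : Set G) := by
    by_contra! hcon
    have hbound : ∀ S : Finset G, Separated A S → (S : Set G) ⊆ A ^ (n + 2) →
        S.card ≤ ⌊K ^ (n + 2)⌋₊ := fun S hS hSA =>
      Nat.le_floor (hA.card_separated_le hS hSA)
    have key : ∀ j : ℕ, ∃ H ≤ D, (∀ d ∈ D, ∀ h ∈ H, d * h * d⁻¹ ∈ H) ∧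
        (H : Set G) ⊆ A ^ ((n + 2) * j) ∧ ∃ S : Finset G, S.card = j ∧ Separated A S ∧
          (S : Set G) ⊆ A ^ (n + 2) ∧ (S : Set G) ⊆ H := by
      intro j
      induction j with
      | zero => exact ⟨⊥, bot_le, by simp, by simp, ∅, rfl, by simp [Separated], by simp, by simp⟩
      | succ j ih =>
        obtain ⟨H, hHD, hHn, hHA, S, hSc, hS, hSA, hSH⟩ := ih
        obtain ⟨H', hH'D, hHH', hH'n, hH'A, hnot⟩ :=
          hcon j (hSc ▸ hbound S hS hSA) H hHD hHn hHA
        obtain ⟨x, hxH', hx⟩ := Set.not_subset.1 hnot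
        obtain ⟨a, ha, h, hh, rfl⟩ := hH'A hxH'
        have haH' : a ∈ H' := by simpa using H'.mul_mem hxH' (H'.inv_mem (hHH' hh))
        have hax : a ∉ A ^ 2 * (H : Set G) := by
          rintro ⟨b, hb, k, hk, rfl⟩
          exact hx ⟨b, hb, k * h, H.mul_mem hk hh, by simp [mul_assoc]⟩
        refine ⟨H', hH'D, hH'n, ?_, insert a S, ?_, hS.insert hsymm hSH hax, ?_, ?_⟩
        · refine hH'A.trans ?_
          rw [show (n + 2) * (j + 1) = (n + 2) + (n + 2) * j by ring,
            pow_add A (n + 2)]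
          exact Set.mul_subset_mul_left hHA
        · rw [Finset.card_insert_of_notMem (notMem_of_notMem_mul hone hSH hax), hSc]
        · rw [Finset.coe_insert]; exact Set.insert_subset ha hSA
        · rw [Finset.coe_insert]; exact Set.insert_subset haH' (hSH.trans hHH')
    obtain ⟨-, -, -, -, S, hSc, hS, hSA, -⟩ := key (⌊K ^ (n + 2)⌋₊ + 1)
    have := hbound S hS hSA
    omega
  have hfinH : (A ^ 2 * (H : Set G)).Finite :=
    (finite_pow hfin 2).mul ((finite_pow hfin _).subset hHA)
  let 𝓕 : Set (Subgroup G) := {T | T ≤ D ∧ H ≤ T ∧ (∀ d ∈ D, ∀ t ∈ T, d * t * d⁻¹ ∈ T) ∧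
    (T : Set G) ⊆ A ^ 2 * (H : Set G)}
  have h𝓕fin : 𝓕.Finite := by
    refine Set.Finite.of_finite_image (f := fun T : Subgroup G => (T : Set G)) ?_
      SetLike.coe_injective.injOn
    refine hfinH.finite_subsets.subset ?_
    rintro _ ⟨T, hT, rfl⟩
    exact hT.2.2.2
  have h𝓕ne : 𝓕.Nonempty :=
    ⟨H, hHD, le_rfl, hHn, fun x hx => ⟨1, Set.one_mem_pow hone, x, hx, by simp⟩⟩
  obtain ⟨T, hT⟩ := h𝓕fin.exists_maximal h𝓕ne
  obtain ⟨⟨hTD, hHT, hTn, hTA⟩, hTmax⟩ := hT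
  refine ⟨T, hTD, hTn, ?_, ?_⟩
  · refine hTA.trans ?_
    rw [pow_add]
    refine Set.mul_subset_mul_left (hHA.trans (Set.pow_subset_pow_right hone ?_))
    exact Nat.mul_le_mul_left _ hj
  · intro H' hH'D hTH' hH'n hH'A
    refine hTmax ⟨hH'D, hHT.trans hTH', hH'n, ?_⟩ hTH'
    refine hmax H' hH'D (hHT.trans hTH') hH'n (hH'A.trans ?_)
    rw [pow_add, mul_assoc]
    exact Set.mul_subset_mul_left hTA

end RelativeSubgroups

section CentralChain

open scoped commutatorElement

variable {G : Type u} [Group G]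

/-- `A` meets at most `M` left cosets of `C`, witnessed by a labelling of the cosets. -/
def CosetLabelling (A : Set G) (M : ℝ) (C : Subgroup G) : Prop :=
  ∃ (ι : Type u) (_ : Finite ι) (f : G → ι), (Nat.card ι : ℝ) ≤ M ∧
    ∀ a ∈ A, ∀ b ∈ A, f a = f b → a⁻¹ * b ∈ C

theorem CosetLabelling.exists_cover {A : Set G} {M : ℝ} {C : Subgroup G}
    (h : CosetLabelling A M C) :
    ∃ X : Set G, X.Finite ∧ (X.ncard : ℝ) ≤ M ∧ A ⊆ X * (C : Set G) := by
  obtain ⟨ι, hι, f, hM, hf⟩ := h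
  have hr : ∀ i, ∃ r : G, ∀ a ∈ A, f a = i → r ∈ A ∧ f r = i := by
    intro i
    by_cases h : ∃ r ∈ A, f r = i
    · obtain ⟨r, hr⟩ := h
      exact ⟨r, fun _ _ _ => hr⟩
    · exact ⟨1, fun a ha hai => absurd ⟨a, ha, hai⟩ h⟩
  choose r hr using hr
  refine ⟨Set.range r, Set.finite_range r, ?_, ?_⟩
  · have hcard : ((Set.range r).ncard : ℝ) ≤ Nat.card ι := by
      exact_mod_cast Finite.card_range_le r
    exact hcard.trans hM
  · intro a ha
    obtain ⟨h1, h2⟩ := hr (f a) a ha rfl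
    exact ⟨r (f a), ⟨f a, rfl⟩, (r (f a))⁻¹ * a, hf _ h1 _ ha h2, mul_inv_cancel_left _ _⟩

/-- If `f` labels the cosets of `C` and the elements of `A ^ 2 ∩ C` may be labelled by `Y`,
combine the two labels. -/
theorem CosetLabelling.refine {A : Set G} (hsymm : A⁻¹ = A) {M L : ℝ} {C C' : Subgroup G}
    (h : CosetLabelling A M C) {Y : Set G} (hY : Y.Finite) (hYL : (Y.ncard : ℝ) ≤ L)
    (g : G → Y) (hg : ∀ b ∈ A ^ 2, b ∈ C → ∀ b' ∈ A ^ 2, b' ∈ C → g b = g b' →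
      b⁻¹ * b' ∈ A ^ 2 → b⁻¹ * b' ∈ C') : CosetLabelling A (M * L) C' := by
  obtain ⟨ι, hι, f, hM, hf⟩ := h
  have hr : ∀ i, ∃ r : G, ∀ a ∈ A, f a = i → r ∈ A ∧ f r = i := by
    intro i
    by_cases h : ∃ r ∈ A, f r = i
    · obtain ⟨r, hr⟩ := h
      exact ⟨r, fun _ _ _ => hr⟩
    · exact ⟨1, fun a ha hai => absurd ⟨a, ha, hai⟩ h⟩
  choose r hr using hr
  have hYf : Finite Y := hY
  have hsq : ∀ a ∈ A, ∀ b ∈ A, a⁻¹ * b ∈ A ^ 2 := by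
    intro a ha b hb
    rw [pow_two]
    exact Set.mul_mem_mul (by rw [← hsymm]; exact Set.inv_mem_inv.2 ha) hb
  refine ⟨ι × Y, inferInstance, fun a => (f a, g ((r (f a))⁻¹ * a)), ?_, ?_⟩
  · rw [Nat.card_prod]
    push_cast
    exact mul_le_mul hM hYL (Nat.cast_nonneg _) ((Nat.cast_nonneg _).trans hM)
  · intro a ha b hb hab
    obtain ⟨h1, h2⟩ := Prod.mk.inj hab
    obtain ⟨ra, hra⟩ := hr (f a) a ha rfl
    rw [← h1] at h2
    have e : ((r (f a))⁻¹ * a)⁻¹ * ((r (f a))⁻¹ * b) = a⁻¹ * b := by group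
    rw [← e]
    refine hg _ (hsq _ ra _ ha) (hf _ ra _ ha hra) _ (hsq _ ra _ hb)
      (hf _ ra _ hb (hra.trans h1)) h2 ?_
    rw [e]
    exact hsq a ha b hb

/-- The image of `N` lies in the `k`-th centre of every quotient of a subgroup `D` between `N`
and `C` in which the upper central series absorbs normal subgroups up to `A ^ 2`. -/
def MapsToCentre (A : Set G) (k : ℕ) (N C : Subgroup G) : Prop :=
  ∀ D : Subgroup G, D ≤ C → N ≤ D → ∀ (Q : Type u) [Group Q] (φ : D →* Q),
    Function.Surjective φ →
    (∀ j ≤ k, ∀ H : Subgroup Q, H.Normal →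
      (H : Set Q) ⊆ φ '' {d | (d : G) ∈ A ^ 2} * (Subgroup.upperCentralSeries Q j : Set Q) →
      H ≤ Subgroup.upperCentralSeries Q j) →
    ∀ x (hx : x ∈ D), x ∈ N → φ ⟨x, hx⟩ ∈ Subgroup.upperCentralSeries Q k

theorem map_mem_upperCentralSeries_of_subset_mul {A : Set G} {k : ℕ} {N P D : Subgroup G}
    (hND : N ≤ D) (hP : ∀ d ∈ D, ∀ p ∈ P, d * p * d⁻¹ ∈ P)
    (hPN : (P : Set G) ⊆ A ^ 2 * (N : Set G)) {Q : Type u} [Group Q] {φ : D →* Q}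
    (hφ : Function.Surjective φ)
    (habs : ∀ H : Subgroup Q, H.Normal →
      (H : Set Q) ⊆ φ '' {d | (d : G) ∈ A ^ 2} * (Subgroup.upperCentralSeries Q k : Set Q) →
      H ≤ Subgroup.upperCentralSeries Q k)
    (hN : ∀ x (hx : x ∈ D), x ∈ N → φ ⟨x, hx⟩ ∈ Subgroup.upperCentralSeries Q k) :
    ∀ x (hx : x ∈ D), x ∈ P → φ ⟨x, hx⟩ ∈ Subgroup.upperCentralSeries Q k := by
  have hPn : (P.subgroupOf D).Normal :=
    ⟨fun p hp d => Subgroup.mem_subgroupOf.2 (hP d d.2 p (Subgroup.mem_subgroupOf.1 hp))⟩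
  have hle := habs ((P.subgroupOf D).map φ) (hPn.map φ hφ) (by
    rintro _ ⟨⟨p, hpD⟩, hp, rfl⟩
    obtain ⟨a, ha, n, hn, han⟩ := hPN (Subgroup.mem_subgroupOf.1 hp)
    have han' : a * n = p := han
    have haD : a ∈ D := by
      rw [← mul_inv_eq_iff_eq_mul.2 han'.symm]; exact D.mul_mem hpD (D.inv_mem (hND hn))
    refine ⟨φ ⟨a, haD⟩, ⟨_, ha, rfl⟩, φ ⟨n, hND hn⟩, hN n (hND hn) hn, ?_⟩
    simp only [← map_mul]
    exact congrArg φ (Subtype.ext han'))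
  intro x hx hxP
  exact hle ⟨⟨x, hx⟩, Subgroup.mem_subgroupOf.2 hxP, rfl⟩

/-- A subgroup `N`, normal in `C`, reached after `k` central extensions by elements of `A ^ 6`
(interleaved with extensions inside `A ^ 2 * N`), where `A` meets at most `K ^ (9 * k)` left
cosets of `C`. -/
structure CentralChain (A : Set G) (K : ℝ) (k : ℕ) (N C : Subgroup G) : Prop where
  le : N ≤ C
  normal : ∀ c ∈ C, ∀ n ∈ N, c * n * c⁻¹ ∈ N
  le_closure : C ≤ Subgroup.closure ((A ^ 2 ∩ C) ∪ N)
  le_closure_pow : N ≤ Subgroup.closure (A ^ 6 ∩ N)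
  separated : ∃ S : Finset G, S.card = k ∧ Separated A S ∧ (S : Set G) ⊆ A ^ 6 ∧ (S : Set G) ⊆ N
  labelling : CosetLabelling A (K ^ (9 * k)) C
  centre : MapsToCentre A k N C

theorem CentralChain.zero {A : Set G} {K : ℝ} (hA : IsKApproximateSubgroup K A) :
    CentralChain A K 0 ⊥ (Subgroup.closure (A ^ 2)) where
  le := bot_le
  normal := by simp
  le_closure := by
    rw [Subgroup.closure_le]
    intro x hx
    exact Subgroup.subset_closure (Or.inl ⟨hx, Subgroup.subset_closure hx⟩)
  le_closure_pow := bot_le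
  separated := ⟨∅, rfl, by simp [Separated], by simp, by simp⟩
  labelling := by
    refine ⟨PUnit, inferInstance, fun _ => ⟨⟩, by simp, ?_⟩
    intro a ha b hb _
    apply Subgroup.subset_closure
    rw [pow_two]
    exact Set.mul_mem_mul (by rw [← hA.2.1]; exact Set.inv_mem_inv.2 ha) hb
  centre := by
    intro D _ _ Q _ φ _ _ x hx hx1
    rw [Subgroup.mem_bot] at hx1
    subst hx1
    have : φ ⟨1, hx⟩ = 1 := map_one φ
    rw [this]
    exact Subgroup.one_mem _

theorem CentralChain.succ [Group.IsNilpotent G] {A : Set G} {K : ℝ} {k : ℕ} {N C : Subgroup G}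
    (hA : IsKApproximateSubgroup K A) (h : CentralChain A K k N C)
    (hnt : ¬ A ^ 6 ∩ (C : Set G) ⊆ A ^ 2 * (N : Set G)) :
    ∃ N' C', CentralChain A K (k + 1) N' C' := by
  classical
  have hA' := hA
  obtain ⟨hfin, hsymm, hone, -⟩ := hA'
  let Γ : ℕ → Subgroup G := (⊤ : Subgroup G).lowerCentralSeries
  have hΓn : ∀ r, (Γ r).Normal := fun r =>
    inferInstanceAs ((⊤ : Subgroup G).lowerCentralSeries r).Normal
  have hΓc : ∀ r, ∀ g ∈ Γ r, ∀ y : G, ⁅g, y⁆ ∈ Γ (r + 1) := by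
    intro r g hg y
    change _ ∈ (⊤ : Subgroup G).lowerCentralSeries (r + 1)
    rw [Subgroup.lowerCentralSeries_succ]
    exact Subgroup.commutator_mem_commutator hg (Subgroup.mem_top y)
  let E : ℕ → Subgroup G := fun r => (Γ r ⊔ N) ⊓ C
  have hE : ∀ r x, x ∈ E r ↔ (∃ g ∈ Γ r, ∃ n ∈ N, g * n = x) ∧ x ∈ C := by
    intro r x
    have := hΓn r
    rw [Subgroup.mem_inf, Subgroup.mem_sup_of_normal_left]
  have hNE : ∀ r, N ≤ E r := fun r => le_inf le_sup_right h.le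
  have hEC : ∀ r, E r ≤ C := fun r => inf_le_right
  have hEn : ∀ r, ∀ c ∈ C, ∀ x ∈ E r, c * x * c⁻¹ ∈ E r := by
    intro r c hc x hx
    obtain ⟨⟨g, hg, n, hn, rfl⟩, hxC⟩ := (hE r x).1 hx
    refine (hE r _).2 ⟨⟨c * g * c⁻¹, (hΓn r).conj_mem g hg c, c * n * c⁻¹, h.normal c hc n hn,
      by group⟩, C.mul_mem (C.mul_mem hc hxC) (C.inv_mem hc)⟩
  have hEcomm : ∀ r, ∀ x ∈ E r, ∀ c ∈ C, ⁅x, c⁆ ∈ E (r + 1) := by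
    intro r x hx c hc
    obtain ⟨⟨g, hg, n, hn, rfl⟩, hxC⟩ := (hE r x).1 hx
    have hcn : ⁅n, c⁆ ∈ N := by
      rw [commutatorElement_def, mul_assoc, mul_assoc, ← mul_assoc c]
      exact N.mul_mem hn (h.normal c hc _ (N.inv_mem hn))
    refine Subgroup.mem_inf.2 ⟨?_, ?_⟩
    · have e : ⁅g * n, c⁆ = ⁅g, ⁅n, c⁆⁆ * ⁅n, c⁆ * ⁅g, c⁆ := by
        simp only [commutatorElement_def]; group
      rw [e]
      exact Subgroup.mul_mem _ (Subgroup.mul_mem_sup (hΓc r g hg _) hcn)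
        (Subgroup.mem_sup_left (hΓc r g hg c))
    · exact C.mul_mem (C.mul_mem (C.mul_mem hxC hc) (C.inv_mem hxC)) (C.inv_mem hc)
  obtain ⟨r, hr, x, hxA, hxE, hxN⟩ : ∃ r, (∀ y ∈ A ^ 6, y ∈ E (r + 1) → y ∈ A ^ 2 * (N : Set G)) ∧
      ∃ x ∈ A ^ 6, x ∈ E r ∧ x ∉ A ^ 2 * (N : Set G) := by
    have hex : ∃ r, ∀ y ∈ A ^ 6, y ∈ E r → y ∈ A ^ 2 * (N : Set G) := by
      obtain ⟨s, hs⟩ := Subgroup.nilpotent_iff_lowerCentralSeries.1 ‹Group.IsNilpotent G›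
      refine ⟨s, fun y _ hy => ?_⟩
      obtain ⟨⟨g, hg, n, hn, rfl⟩, -⟩ := (hE s y).1 hy
      have hg1 : g = 1 := by
        have : g ∈ (⊤ : Subgroup G).lowerCentralSeries s := hg
        rwa [hs, Subgroup.mem_bot] at this
      exact ⟨1, Set.one_mem_pow hone, n, hn, by simp [hg1]⟩
    have h0 : Nat.find hex ≠ 0 := by
      intro h0
      have hspec := Nat.find_spec hex
      rw [h0] at hspec
      refine hnt fun y hy => hspec y hy.1 ((hE 0 y).2 ⟨⟨y, ?_, 1, N.one_mem, mul_one y⟩, hy.2⟩)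
      change y ∈ (⊤ : Subgroup G).lowerCentralSeries 0
      simp
    obtain ⟨r, hr⟩ := Nat.exists_eq_succ_of_ne_zero h0
    refine ⟨r, by have hspec := Nat.find_spec hex; rwa [hr] at hspec, ?_⟩
    have := Nat.find_min hex (m := r) (by omega)
    push Not at this
    exact this
  have hNF := hNE (r + 1)
  have hFN : ∀ c ∈ E (r + 1), ∀ n ∈ N, c * n * c⁻¹ ∈ N := fun c hc => h.normal c (hEC _ hc)
  have hF4 : ∀ y ∈ A ^ 4, y ∈ E (r + 1) → y ∈ A ^ 2 * (N : Set G) := fun y hy =>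
    hr y (Set.pow_subset_pow_right hone (by norm_num) hy)
  let P := sqMulSubgroup A hone hsymm N (E (r + 1)) hNF hFN hF4
  have hPmem : ∀ y, y ∈ P ↔ y ∈ E (r + 1) ∧ y ∈ A ^ 2 * (N : Set G) := fun y => Iff.rfl
  have hNP : N ≤ P := fun n hn => (hPmem n).2 ⟨hNF hn, 1, Set.one_mem_pow hone, n, hn, by simp⟩
  have hPC : P ≤ C := fun p hp => hEC _ hp.1
  have hxC : x ∈ C := hEC _ hxE
  have hconjA : ∀ c ∈ A ^ 2, c ∈ C → ∀ p ∈ P, c * p * c⁻¹ ∈ P := by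
    intro c hc hcC p hp
    obtain ⟨hpE, a, ha, n, hn, han⟩ := (hPmem p).1 hp
    have han' : a * n = p := han
    subst han'
    refine (hPmem _).2 ⟨hEn _ c hcC _ hpE, ?_⟩
    have haE : a ∈ E (r + 1) := by
      simpa using (E (r + 1)).mul_mem hpE ((E (r + 1)).inv_mem (hNF hn))
    obtain ⟨b, hb, m, hm, hbm⟩ := hr (c * a * c⁻¹) (conj_mem_pow hsymm hc ha) (hEn _ c hcC a haE)
    have hbm' : b * m = c * a * c⁻¹ := hbm
    refine ⟨b, hb, m * (c * n * c⁻¹), N.mul_mem hm (h.normal c hcC n hn), ?_⟩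
    simp only [← mul_assoc, hbm']
    group
  have hPn : ∀ c ∈ C, ∀ p ∈ P, c * p * c⁻¹ ∈ P := by
    have hle : C ≤ Subgroup.normalizer (P : Set G) := by
      refine h.le_closure.trans ((Subgroup.closure_le _).2 ?_)
      rintro c (⟨hcA, hcC⟩ | hcN)
      · refine Subgroup.mem_normalizer_iff.2 fun p => ⟨hconjA c hcA hcC p, fun hp => ?_⟩
        have := hconjA c⁻¹ (inv_mem_pow_of_symm hsymm hcA) (C.inv_mem hcC) _ hp
        simpa [mul_assoc] using this
      · exact Subgroup.le_normalizer (hNP hcN)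
    exact fun c hc p hp => (Subgroup.mem_normalizer_iff.1 (hle hc) p).1 hp
  let C₁ := centralizerMod P C hPn {x}
  have hC₁ : ∀ y, y ∈ C₁ ↔ y ∈ C ∧ ⁅y, x⁆ ∈ P := by
    intro y
    exact mem_centralizerMod.trans (by simp)
  have hcommP : ∀ p ∈ P, ∀ c ∈ C, ⁅p, c⁆ ∈ P := by
    intro p hp c hc
    rw [commutatorElement_def, mul_assoc, mul_assoc, ← mul_assoc c]
    exact P.mul_mem hp (hPn c hc _ (P.inv_mem hp))
  let N' := P ⊔ Subgroup.zpowers x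
  have hPN' : P ≤ N' := le_sup_left
  have hxN' : x ∈ N' := Subgroup.mem_sup_right (Subgroup.mem_zpowers x)
  have hN_le_C₁ : N' ≤ C₁ := by
    refine sup_le (fun p hp => (hC₁ p).2 ⟨hPC hp, hcommP p hp x hxC⟩) ?_
    rw [Subgroup.zpowers_le]
    exact (hC₁ x).2 ⟨hxC, by simp⟩
  have hC₁C : C₁ ≤ C := fun y hy => hy.1
  have hN'comm : ∀ y ∈ N', ∀ c ∈ C₁, ⁅y, c⁆ ∈ P := by
    have hle : N' ≤ centralizerMod P C hPn C₁ := by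
      refine sup_le (fun p hp => ⟨hPC hp, fun c hc => hcommP p hp c (hC₁C hc)⟩) ?_
      rw [Subgroup.zpowers_le]
      refine ⟨hxC, fun c hc => ?_⟩
      rw [← commutatorElement_inv]
      exact P.inv_mem ((hC₁ c).1 hc).2
    exact fun y hy c hc => (hle hy).2 c hc
  have hN'n : ∀ c ∈ C₁, ∀ y ∈ N', c * y * c⁻¹ ∈ N' := by
    intro c hc y hy
    have e : c * y * c⁻¹ = ⁅y, c⁆⁻¹ * y := by simp only [commutatorElement_def]; group
    rw [e]
    exact N'.mul_mem (N'.inv_mem (hPN' (hN'comm y hy c hc))) hy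
  let C' := Subgroup.closure ((A ^ 2 ∩ C₁) ∪ N')
  have hC'C₁ : C' ≤ C₁ := by
    refine (Subgroup.closure_le _).2 ?_
    rintro c (hc | hc)
    · exact hc.2
    · exact hN_le_C₁ hc
  have hN_le_C : N' ≤ C' := fun y hy => Subgroup.subset_closure (Or.inr hy)
  refine ⟨N', C', hN_le_C, fun c hc => hN'n c (hC'C₁ hc), ?_, ?_, ?_, ?_, ?_⟩
  · refine (Subgroup.closure_le _).2 ?_
    rintro c (hc | hc)
    · exact Subgroup.subset_closure
        (Or.inl ⟨hc.1, Subgroup.subset_closure (Or.inl hc)⟩)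
    · exact Subgroup.subset_closure (Or.inr hc)
  · have hNcl : N ≤ Subgroup.closure (A ^ 6 ∩ N') :=
      h.le_closure_pow.trans (Subgroup.closure_mono
        (Set.inter_subset_inter_right _ (hNP.trans hPN')))
    refine sup_le ?_ ?_
    · rintro p hp
      obtain ⟨hpE, a, ha, n, hn, han⟩ := (hPmem p).1 hp
      have han' : a * n = p := han
      subst han'
      have haP : a ∈ P := by simpa using P.mul_mem hp (P.inv_mem (hNP hn))
      exact Subgroup.mul_mem _ (Subgroup.subset_closure
        ⟨Set.pow_subset_pow_right hone (by norm_num) ha, hPN' haP⟩) (hNcl hn)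
    · rw [Subgroup.zpowers_le]
      exact Subgroup.subset_closure ⟨hxA, hxN'⟩
  · obtain ⟨S, hSc, hS, hSA, hSN⟩ := h.separated
    refine ⟨insert x S, ?_, hS.insert hsymm hSN hxN, ?_, ?_⟩
    · rw [Finset.card_insert_of_notMem (notMem_of_notMem_mul hone hSN hxN), hSc]
    · rw [Finset.coe_insert]; exact Set.insert_subset hxA hSA
    · rw [Finset.coe_insert]
      exact Set.insert_subset hxN' (hSN.trans (hNP.trans hPN'))
  · obtain ⟨Y, hY, hYK, hYA⟩ := hA.exists_cover_pow 9
    have hg : ∀ b : G, ∃ y : Y, b ∈ A ^ 2 → (y : G)⁻¹ * (b * x * b⁻¹) ∈ A := by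
      intro b
      obtain ⟨y₀, hy₀, -⟩ := hYA (Set.one_mem_pow hone)
      by_cases hb : b ∈ A ^ 2
      · obtain ⟨y, hy, a, ha, hya⟩ := hYA (conj_mem_pow hsymm hb hxA)
        have hya' : y * a = b * x * b⁻¹ := hya
        exact ⟨⟨y, hy⟩, fun _ => by simpa [← hya'] using ha⟩
      · exact ⟨⟨y₀, hy₀⟩, fun hb' => absurd hb' hb⟩
    choose g hg using hg
    rw [show 9 * (k + 1) = 9 * k + 9 by ring, pow_add]
    refine h.labelling.refine hsymm hY hYK g ?_
    intro b hb hbC b' hb' hbC' hbb hA2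
    refine Subgroup.subset_closure (Or.inl ⟨hA2, ?_⟩)
    have h1 := hg b hb
    have h2 := hg b' hb'
    rw [← hbb] at h2
    have hu : ⁅b, x⁻¹⁆ * ⁅x⁻¹, b'⁆ ∈ P := by
      refine (hPmem _).2 ⟨?_, ?_⟩
      · refine Subgroup.mul_mem _ ?_ (hEcomm r _ ((E r).inv_mem hxE) _ hbC')
        rw [← commutatorElement_inv]
        exact Subgroup.inv_mem _ (hEcomm r _ ((E r).inv_mem hxE) _ hbC)
      · refine ⟨_, ?_, 1, N.one_mem, mul_one _⟩
        have e : ⁅b, x⁻¹⁆ * ⁅x⁻¹, b'⁆ =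
            ((g b : G)⁻¹ * (b * x * b⁻¹))⁻¹ * ((g b : G)⁻¹ * (b' * x * b'⁻¹)) := by
          simp only [commutatorElement_def]; group
        rw [e, pow_two]
        exact Set.mul_mem_mul (by rw [← hsymm]; exact Set.inv_mem_inv.2 h1) h2
    refine (hC₁ _).2 ⟨C.mul_mem (C.inv_mem hbC) hbC', ?_⟩
    have e : ⁅b⁻¹ * b', x⁆ =
        (x * b⁻¹) * (⁅b, x⁻¹⁆ * ⁅x⁻¹, b'⁆) * (x * b⁻¹)⁻¹ := by
      simp only [commutatorElement_def]; group
    rw [e]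
    exact hPn _ (C.mul_mem hxC (C.inv_mem hbC)) _ hu
  · intro D hDC' hN'D Q _ φ hφ habs y hyD hyN'
    have hDC₁ : D ≤ C₁ := hDC'.trans hC'C₁
    have hPD : P ≤ D := hPN'.trans hN'D
    have hND : N ≤ D := hNP.trans hPD
    have hNZ := h.centre D (hDC₁.trans hC₁C) hND Q φ hφ (fun j hj => habs j (hj.trans k.le_succ))
    have hPZ := map_mem_upperCentralSeries_of_subset_mul hND
      (fun d hd => hPn d (hC₁C (hDC₁ hd))) (fun p hp => ((hPmem p).1 hp).2) hφ
      (habs k k.le_succ) hNZ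
    rw [Subgroup.mem_upperCentralSeries_succ_iff]
    intro z
    obtain ⟨d, rfl⟩ := hφ z
    rw [← map_commutatorElement]
    exact hPZ _ _ (hN'comm y hyN' d (hDC₁ d.2))

end CentralChain

section IteratedCommutators

open scoped commutatorElement

variable {Q R : Type*} [Group Q] [Group R]

theorem iteratedCommutators_mono {S S' : Set Q} (h : S ⊆ S') (n : ℕ) :
    iteratedCommutators S n ⊆ iteratedCommutators S' n := by
  induction n with
  | zero => exact h
  | succ n ih =>
    rintro _ ⟨v, hv, s, hs, rfl⟩
    exact ⟨v, ih hv, s, h hs, rfl⟩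

theorem image_iteratedCommutators (φ : Q →* R) (S : Set Q) (n : ℕ) :
    φ '' iteratedCommutators S n = iteratedCommutators (φ '' S) n := by
  induction n with
  | zero => rfl
  | succ n ih =>
    ext w
    constructor
    · rintro ⟨_, ⟨v, hv, s, hs, rfl⟩, rfl⟩
      exact ⟨φ v, ih ▸ ⟨v, hv, rfl⟩, φ s, ⟨s, hs, rfl⟩, map_commutatorElement φ v s⟩
    · rintro ⟨v', hv', _, ⟨s, hs, rfl⟩, rfl⟩
      rw [← ih] at hv'
      obtain ⟨v, hv, rfl⟩ := hv'
      exact ⟨_, ⟨v, hv, s, hs, rfl⟩, map_commutatorElement φ v s⟩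

theorem iteratedCommutators_subset_of_upperCentralSeries_eq_top {n : ℕ}
    (h : Subgroup.upperCentralSeries Q n = ⊤) (S : Set Q) : iteratedCommutators S n ⊆ {1} := by
  have key : ∀ j ≤ n, iteratedCommutators S j ⊆ Subgroup.upperCentralSeries Q (n - j) := by
    intro j
    induction j with
    | zero => intro _; simp [h]
    | succ j ih =>
      rintro hj _ ⟨v, hv, s, -, rfl⟩
      have hv' := ih (by omega) hv
      rw [show n - j = (n - (j + 1)) + 1 by omega, SetLike.mem_coe,
        Subgroup.mem_upperCentralSeries_succ_iff] at hv'
      exact hv' s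
  simpa using key n le_rfl

theorem exists_iteratedCommutators_subset_pow {A : Set Q} (hA : A⁻¹ = A) (p n : ℕ) :
    ∃ w, iteratedCommutators (A ^ p) n ⊆ A ^ w := by
  induction n with
  | zero => exact ⟨p, subset_rfl⟩
  | succ n ih =>
    obtain ⟨w, hw⟩ := ih
    refine ⟨w + p + w + p, ?_⟩
    rintro _ ⟨v, hv, s, hs, rfl⟩
    exact comm_mem_pow hA (hw hv) hs

theorem closure_preimage_subtype_eq_top {C : Subgroup Q} {s : Set Q}
    (h : C ≤ Subgroup.closure (s ∩ C)) :
    Subgroup.closure {d : C | (d : Q) ∈ s} = ⊤ := by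
  rw [eq_top_iff]
  rintro ⟨x, hx⟩ -
  have hle : Subgroup.closure (s ∩ C) ≤
      (Subgroup.closure {d : C | (d : Q) ∈ s}).map C.subtype := by
    rw [Subgroup.closure_le]
    rintro y ⟨hy, hyC⟩
    exact ⟨⟨y, hyC⟩, Subgroup.subset_closure hy, rfl⟩
  obtain ⟨y, hy, hyx⟩ := hle (h hx)
  have : y = ⟨x, hx⟩ := Subtype.ext hyx
  exact this ▸ hy

theorem closure_image_eq_top {φ : Q →* R} (hφ : Function.Surjective φ) {S : Set Q}
    (hS : Subgroup.closure S = ⊤) : Subgroup.closure (φ '' S) = ⊤ := by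
  rw [← MonoidHom.map_closure, hS, ← MonoidHom.range_eq_map, MonoidHom.range_eq_top.2 hφ]

end IteratedCommutators
section Structure

open scoped commutatorElement

variable {G : Type u} [Group G]

/-- In a nilpotent group a central chain of maximal length is reached after at most `K ^ 6`
steps. -/
theorem exists_terminal_centralChain [Group.IsNilpotent G] {A : Set G} {K : ℝ}
    (hA : IsKApproximateSubgroup K A) :
    ∃ k ≤ ⌊K ^ 6⌋₊, ∃ N C, CentralChain A K k N C ∧ A ^ 6 ∩ (C : Set G) ⊆ A ^ 2 * (N : Set G) := by
  have hbound : ∀ {k N C}, CentralChain A K k N C → k ≤ ⌊K ^ 6⌋₊ := by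
    intro k N C h
    obtain ⟨S, rfl, hS, hSA, -⟩ := h.separated
    exact Nat.le_floor (hA.card_separated_le hS hSA)
  by_contra! hcon
  have key : ∀ k : ℕ, ∃ N C, CentralChain A K k N C := by
    intro k
    induction k with
    | zero => exact ⟨_, _, CentralChain.zero hA⟩
    | succ k ih =>
      obtain ⟨N, C, h⟩ := ih
      exact h.succ hA (hcon k (hbound h) N C h)
  obtain ⟨N, C, h⟩ := key (⌊K ^ 6⌋₊ + 1)
  have := hbound h
  omega

theorem CentralChain.le_closure_pow_six {A : Set G} {K : ℝ} {k : ℕ} {N C : Subgroup G}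
    (h : CentralChain A K k N C) (hone : (1 : G) ∈ A) :
    C ≤ Subgroup.closure (A ^ 6 ∩ (C : Set G)) := by
  refine h.le_closure.trans ((Subgroup.closure_le _).2 ?_)
  rintro x (⟨hx, hxC⟩ | hx)
  · exact Subgroup.subset_closure ⟨Set.pow_subset_pow_right hone (by norm_num) hx, hxC⟩
  · exact (h.le_closure_pow.trans (Subgroup.closure_mono (Set.inter_subset_inter_right _ h.le))) hx

theorem CentralChain.subset_mul {A : Set G} {K : ℝ} {k : ℕ} {N C : Subgroup G}
    (h : CentralChain A K k N C) (hone : (1 : G) ∈ A) (hsymm : A⁻¹ = A)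
    (ht : A ^ 6 ∩ (C : Set G) ⊆ A ^ 2 * (N : Set G)) : (C : Set G) ⊆ A ^ 2 * (N : Set G) := by
  have hle : C ≤ sqMulSubgroup A hone hsymm N C h.le h.normal
      (fun x hx hxC => ht ⟨Set.pow_subset_pow_right hone (by norm_num) hx, hxC⟩) := by
    refine h.le_closure.trans ((Subgroup.closure_le _).2 ?_)
    rintro x (⟨hx, hxC⟩ | hx)
    · exact ⟨hxC, x, hx, 1, N.one_mem, mul_one x⟩
    · exact ⟨h.le hx, 1, Set.one_mem_pow hone, x, hx, one_mul x⟩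
  exact fun x hx => (hle hx).2

/-- The structure theorem in a nilpotent group, with nilpotency of `C / H` expressed through
iterated commutators. -/
theorem IsKApproximateSubgroup.exists_subgroups_of_isNilpotent [Group.IsNilpotent G] {A : Set G}
    {K : ℝ} (hK : 1 ≤ K) (hA : IsKApproximateSubgroup K A) {n n₀ : ℕ} (hn : n = ⌊K ^ 6⌋₊)
    (hn₀ : n₀ = 2 ^ n * 14) :
    ∃ H C : Subgroup G, H ≤ C ∧ (∀ c ∈ C, ∀ h ∈ H, c * h * c⁻¹ ∈ H) ∧
      (H : Set G) ⊆ A ^ (2 + (n₀ + 2) * ⌊K ^ (n₀ + 2)⌋₊) ∧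
      iteratedCommutators (C : Set G) n ⊆ H ∧ CosetLabelling A (K ^ (9 * n)) C := by
  have hA' := hA
  obtain ⟨-, hsymm, hone, -⟩ := hA'
  obtain ⟨k, hk, N, C, h, ht⟩ := exists_terminal_centralChain hA
  rw [← hn] at hk
  have hCN := h.subset_mul hone hsymm ht
  obtain ⟨T, hTC, hTn, hTA, hTabs⟩ := hA.exists_absorbing C n₀
  refine ⟨T, C, hTC, hTn, hTA, ?_, ?_⟩
  swap
  · obtain ⟨ι, hι, f, hf, hf'⟩ := h.labelling
    exact ⟨ι, hι, f, hf.trans (pow_le_pow_right₀ hK (by omega)), hf'⟩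
  have hTnorm : (T.subgroupOf C).Normal :=
    ⟨fun p hp d => Subgroup.mem_subgroupOf.2 (hTn d d.2 p (Subgroup.mem_subgroupOf.1 hp))⟩
  let φ : C →* C ⧸ T.subgroupOf C := QuotientGroup.mk' _
  have hφ : Function.Surjective φ := QuotientGroup.mk'_surjective _
  have hφ1 : ∀ d : C, φ d = 1 ↔ (d : G) ∈ T := fun d =>
    (QuotientGroup.eq_one_iff d).trans Subgroup.mem_subgroupOf
  have hQ : Group.IsNilpotent (C ⧸ T.subgroupOf C) := Group.nilpotent_of_surjective φ hφ
  let B : ℕ → Set (C ⧸ T.subgroupOf C) := fun i => φ '' {d | (d : G) ∈ A ^ i}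
  have hS : Subgroup.closure (B 6) = ⊤ :=
    closure_image_eq_top hφ (closure_preimage_subtype_eq_top (h.le_closure_pow_six hone))
  have hBmono : Monotone B := fun i j hij =>
    Set.image_mono fun d hd => Set.pow_subset_pow_right hone hij hd
  have hB : ∀ i, ∀ a ∈ B i, ∀ s ∈ B 6, ⁅a, s⁆ ∈ B (2 * i + 12) := by
    rintro i _ ⟨a, ha, rfl⟩ _ ⟨s, hs, rfl⟩
    refine ⟨⁅a, s⁆, ?_, map_commutatorElement φ a s⟩
    have := comm_mem_pow hsymm (x := (a : G)) (y := (s : G)) ha hs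
    rwa [show i + 6 + i + 6 = 2 * i + 12 by ring] at this
  have h₀ : ∀ H : Subgroup (C ⧸ T.subgroupOf C), H.Normal → (H : Set _) ⊆ B n₀ → H = ⊥ := by
    intro H hH hHB
    rw [eq_bot_iff]
    intro q hq
    obtain ⟨d, rfl⟩ := hφ q
    rw [Subgroup.mem_bot, hφ1]
    refine hTabs ((H.comap φ).map C.subtype) (Subgroup.map_subtype_le _) ?_ ?_ ?_
      ⟨d, hq, rfl⟩
    · intro t ht
      refine ⟨⟨t, hTC ht⟩, ?_, rfl⟩
      rw [SetLike.mem_coe, Subgroup.mem_comap, (hφ1 ⟨t, hTC ht⟩).2 ht]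
      exact H.one_mem
    · rintro c hc _ ⟨e, he, rfl⟩
      exact ⟨⟨c, hc⟩ * e * ⟨c, hc⟩⁻¹, (hH.comap φ).conj_mem e he ⟨c, hc⟩, rfl⟩
    · rintro _ ⟨e, he, rfl⟩
      obtain ⟨a, ha, hae⟩ := hHB he
      have h1 : φ (a⁻¹ * e) = 1 := by rw [map_mul, map_inv, hae, inv_mul_cancel]
      exact ⟨a, ha, _, (hφ1 _).1 h1, by simp⟩
  have habs : ∀ j ≤ k, ∀ H : Subgroup (C ⧸ T.subgroupOf C), H.Normal →
      (H : Set _) ⊆ B 2 * (Subgroup.upperCentralSeries (C ⧸ T.subgroupOf C) j : Set _) →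
      H ≤ Subgroup.upperCentralSeries _ j := fun j hj H hH hHB =>
    le_upperCentralSeries_of_absorbing hS hBmono hB h₀ j 2
      (by rw [hn₀]; exact Nat.mul_le_mul_right _ (Nat.pow_le_pow_right two_pos (hj.trans hk)))
      H hH hHB
  have hNZ := h.centre C le_rfl h.le _ φ hφ habs
  have hCZ := map_mem_upperCentralSeries_of_subset_mul h.le
    (fun d hd p hp => C.mul_mem (C.mul_mem hd hp) (C.inv_mem hd)) hCN hφ (habs k le_rfl) hNZ
  have hZ : Subgroup.upperCentralSeries (C ⧸ T.subgroupOf C) n = ⊤ := by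
    rw [eq_top_iff]
    intro q _
    obtain ⟨d, rfl⟩ := hφ q
    exact Subgroup.upperCentralSeries_mono _ hk (hCZ d d.2 d.2)
  have hCu : (C : Set G) = C.subtype '' Set.univ := by simp
  rw [hCu, ← image_iteratedCommutators]
  rintro _ ⟨d, hd, rfl⟩
  refine (hφ1 d).1 (iteratedCommutators_subset_of_upperCentralSeries_eq_top hZ (φ '' Set.univ) ?_)
  rw [← image_iteratedCommutators]
  exact ⟨d, hd, rfl⟩

theorem IsKApproximateSubgroup.image {G' : Type*} [Group G'] {A : Set G} {K : ℝ}
    (hA : IsKApproximateSubgroup K A) (π : G →* G') : IsKApproximateSubgroup K (π '' A) := by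
  obtain ⟨hfin, hsymm, hone, X, hX, hXK, hXA⟩ := hA
  refine ⟨hfin.image π, ?_, ⟨1, hone, map_one π⟩, π '' X, hX.image π, ?_, ?_⟩
  · rw [← Set.image_inv, hsymm]
  · exact (by exact_mod_cast Set.ncard_image_le hX : ((π '' X).ncard : ℝ) ≤ X.ncard).trans hXK
  · rw [← Set.image_mul, ← Set.image_mul]
    exact Set.image_mono hXA

theorem ResiduallyNilpotent.exists_notMem_lowerCentralSeries (hG : ResiduallyNilpotent G) {g : G}
    (hg : g ≠ 1) : ∃ r, g ∉ (⊤ : Subgroup G).lowerCentralSeries r := by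
  obtain ⟨N, _, π, hN, hπ⟩ := hG g hg
  obtain ⟨r, hr⟩ := Subgroup.nilpotent_iff_lowerCentralSeries.1 hN
  refine ⟨r, fun h => hπ ?_⟩
  have := Subgroup.mem_map_of_mem π h
  rw [Subgroup.map_lowerCentralSeries] at this
  have hbot : π g ∈ (⊤ : Subgroup N).lowerCentralSeries r :=
    Subgroup.lowerCentralSeries_mono r le_top this
  rwa [hr, Subgroup.mem_bot] at hbot

theorem ResiduallyNilpotent.exists_lowerCentralSeries_inter (hG : ResiduallyNilpotent G)
    {s : Set G} (hs : s.Finite) :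
    ∃ r, ∀ g ∈ s, g ∈ (⊤ : Subgroup G).lowerCentralSeries r → g = 1 := by
  have h : ∀ g : G, ∃ r, g ∈ (⊤ : Subgroup G).lowerCentralSeries r → g = 1 := by
    intro g
    by_cases hg : g = 1
    · exact ⟨0, fun _ => hg⟩
    · obtain ⟨r, hr⟩ := hG.exists_notMem_lowerCentralSeries hg
      exact ⟨r, fun h => absurd h hr⟩
  choose r hr using h
  obtain ⟨R, hR⟩ := (hs.image r).bddAbove
  exact ⟨R, fun g hg hgR => hr g
    (Subgroup.lowerCentralSeries_antitone _ (hR ⟨g, hg, rfl⟩) hgR)⟩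

theorem isNilpotent_quotient_lowerCentralSeries (r : ℕ) :
    Group.IsNilpotent (G ⧸ (⊤ : Subgroup G).lowerCentralSeries r) := by
  have hπ := QuotientGroup.mk'_surjective ((⊤ : Subgroup G).lowerCentralSeries r)
  have h := Subgroup.map_lowerCentralSeries (S := ⊤)
    (QuotientGroup.mk' ((⊤ : Subgroup G).lowerCentralSeries r)) r
  rw [← MonoidHom.range_eq_map, MonoidHom.range_eq_top.2 hπ, QuotientGroup.map_mk'_self] at h
  exact Subgroup.nilpotent_iff_lowerCentralSeries.2 ⟨r, h.symm⟩

theorem upperCentralSeries_eq_top_of_iteratedCommutators_subset {S : Set G} {H : Subgroup G}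
    [(H.subgroupOf (Subgroup.closure S)).Normal] {n : ℕ} (h : iteratedCommutators S n ⊆ H) :
    Subgroup.upperCentralSeries (Subgroup.closure S ⧸ H.subgroupOf (Subgroup.closure S)) n =
      ⊤ := by
  refine upperCentralSeries_eq_top_of_iteratedCommutators
    (closure_image_eq_top (QuotientGroup.mk'_surjective _)
      (Subgroup.closure_closure_coe_preimage (k := S))) ?_
  rw [← image_iteratedCommutators]
  rintro _ ⟨d, hd, rfl⟩
  refine (QuotientGroup.eq_one_iff d).2 (Subgroup.mem_subgroupOf.2 (h ?_))
  have hd' : (d : G) ∈ (Subgroup.closure S).subtype '' iteratedCommutators _ n := ⟨d, hd, rfl⟩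
  rw [image_iteratedCommutators] at hd'
  refine iteratedCommutators_mono ?_ n hd'
  rintro _ ⟨s, hs, rfl⟩
  exact hs

/-- The structure theorem for residually nilpotent groups, deduced from the nilpotent case by
passing to a nilpotent quotient that is injective on a large power of `A`. -/
theorem IsKApproximateSubgroup.exists_subgroups (hG : ResiduallyNilpotent G) {A : Set G}
    {K : ℝ} (hK : 1 ≤ K) (hA : IsKApproximateSubgroup K A) {n n₀ m : ℕ} (hn : n = ⌊K ^ 6⌋₊)
    (hn₀ : n₀ = 2 ^ n * 14) (hm : m = 2 + (n₀ + 2) * ⌊K ^ (n₀ + 2)⌋₊) :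
    ∃ H C : Subgroup G, H ≤ C ∧ ∃ _ : (H.subgroupOf C).Normal, (H : Set G) ⊆ A ^ m ∧
      Subgroup.upperCentralSeries (C ⧸ H.subgroupOf C) n = ⊤ ∧
      CosetLabelling A (K ^ (9 * n)) C := by
  have hA' := hA
  obtain ⟨hfin, hsymm, hone, -⟩ := hA'
  obtain ⟨w, hw⟩ := exists_iteratedCommutators_subset_pow hsymm (m + 2) n
  obtain ⟨r, hr⟩ := hG.exists_lowerCentralSeries_inter (finite_pow hfin (w + 4 * m + 4))
  have hQ := isNilpotent_quotient_lowerCentralSeries (G := G) r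
  let π : G →* G ⧸ (⊤ : Subgroup G).lowerCentralSeries r := QuotientGroup.mk' _
  obtain ⟨H', C', hHC', hHn', hHA', hiter, ι, hι, f, hf, hf'⟩ :=
    (hA.image π).exists_subgroups_of_isNilpotent hK hn hn₀
  rw [← hm, ← Set.image_pow] at hHA'
  have lift : ∀ {p g}, p ≤ w + 3 * m + 4 → g ∈ A ^ p → π g ∈ H' → g ∈ A ^ m := by
    intro p g hp hg hgH
    obtain ⟨a, ha, hag⟩ := hHA' hgH
    have h1 : a⁻¹ * g = 1 := by
      refine hr _ (Set.pow_subset_pow_right hone (by omega)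
        (mul_mem_pow_add (inv_mem_pow_of_symm hsymm ha) hg)) ((QuotientGroup.eq_one_iff _).1 ?_)
      change π (a⁻¹ * g) = 1
      rw [map_mul, map_inv, hag, inv_mul_cancel]
    rwa [← inv_mul_eq_one.1 h1]
  let H : Subgroup G :=
    { carrier := {h | h ∈ A ^ m ∧ π h ∈ H'}
      one_mem' := ⟨Set.one_mem_pow hone, by simp⟩
      mul_mem' := by
        rintro x y ⟨hx, hx'⟩ ⟨hy, hy'⟩
        have hxy : π (x * y) ∈ H' := by rw [map_mul]; exact H'.mul_mem hx' hy'
        exact ⟨lift (by omega) (mul_mem_pow_add hx hy) hxy, hxy⟩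
      inv_mem' := by
        rintro x ⟨hx, hx'⟩
        exact ⟨inv_mem_pow_of_symm hsymm hx, by rw [map_inv]; exact H'.inv_mem hx'⟩ }
  let S : Set G := A ^ (m + 2) ∩ π ⁻¹' C'
  have hHC : H ≤ Subgroup.closure S := fun h hh => Subgroup.subset_closure
    ⟨Set.pow_subset_pow_right hone (by omega) hh.1, hHC' hh.2⟩
  have hconj : ∀ s ∈ S, ∀ h ∈ H, s * h * s⁻¹ ∈ H := by
    rintro s ⟨hs, hs'⟩ h ⟨hh, hh'⟩
    have hsh : π (s * h * s⁻¹) ∈ H' := by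
      rw [map_mul, map_mul, map_inv]; exact hHn' _ hs' _ hh'
    exact ⟨lift (by omega) (conj_mem_pow hsymm hs hh) hsh, hsh⟩
  have hSinv : ∀ s ∈ S, s⁻¹ ∈ S := fun s hs =>
    ⟨inv_mem_pow_of_symm hsymm hs.1, by
      rw [Set.mem_preimage, map_inv]; exact C'.inv_mem hs.2⟩
  have hnorm : Subgroup.closure S ≤ Subgroup.normalizer (H : Set G) := by
    rw [Subgroup.closure_le]
    intro s hs
    refine Subgroup.mem_normalizer_iff.2 fun h => ⟨hconj s hs h, fun hh => ?_⟩
    have := hconj _ (hSinv s hs) _ hh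
    simpa [mul_assoc] using this
  have hHnormal : (H.subgroupOf (Subgroup.closure S)).Normal :=
    ⟨fun p hp d => Subgroup.mem_subgroupOf.2
      ((Subgroup.mem_normalizer_iff.1 (hnorm d.2) p).1 (Subgroup.mem_subgroupOf.1 hp))⟩
  refine ⟨H, Subgroup.closure S, hHC, hHnormal, fun h hh => hh.1, ?_, ι, hι, f ∘ π, hf, ?_⟩
  · refine upperCentralSeries_eq_top_of_iteratedCommutators_subset fun x hx => ?_
    have hxH : π x ∈ H' := by
      refine hiter (iteratedCommutators_mono (S := π '' S) ?_ n ?_)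
      · rintro _ ⟨s, hs, rfl⟩
        exact hs.2
      · rw [← image_iteratedCommutators]
        exact ⟨x, hx, rfl⟩
    exact ⟨lift (by omega) (hw (iteratedCommutators_mono Set.inter_subset_left n hx)) hxH, hxH⟩
  · intro a ha b hb hab
    refine Subgroup.subset_closure ⟨Set.pow_subset_pow_right hone (by omega : 2 ≤ m + 2) ?_, ?_⟩
    · rw [pow_two]
      exact Set.mul_mem_mul (by rw [← hsymm]; exact Set.inv_mem_inv.2 ha) hb
    · have := hf' _ ⟨a, ha, rfl⟩ _ ⟨b, hb, rfl⟩ hab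
      rwa [← map_inv, ← map_mul] at this

theorem pow_nine_mul_floor_le_exp {K : ℝ} (hK : 1 ≤ K) :
    K ^ (9 * ⌊K ^ 6⌋₊) ≤ Real.exp (K ^ (15 : ℝ)) := by
  have hK0 : 0 < K := one_pos.trans_le hK
  have hfloor : (⌊K ^ 6⌋₊ : ℝ) ≤ K ^ 6 := Nat.floor_le (by positivity)
  have hlog : Real.log K ≤ K ^ 9 / 9 := by
    have := Real.log_le_rpow_div hK0.le (ε := 9) (by norm_num)
    exact_mod_cast this
  rw [← Real.exp_log (pow_pos hK0 (9 * ⌊K ^ 6⌋₊)), Real.exp_le_exp, Real.log_pow,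
    show (15 : ℝ) = (15 : ℕ) by norm_num, Real.rpow_natCast]
  push_cast
  calc 9 * (⌊K ^ 6⌋₊ : ℝ) * Real.log K ≤ 9 * K ^ 6 * (K ^ 9 / 9) := by
        refine mul_le_mul (by linarith) hlog (Real.log_nonneg hK) (by positivity)
    _ = K ^ 15 := by ring

end Structure

theorem statement_0 :
    ∃ (c : ℝ) (m : ℝ → ℕ), 0 < c ∧
      ∀ (G : Type*) [Group G], ResiduallyNilpotent G →
        ∀ K : ℝ, 1 ≤ K → ∀ A : Set G, IsKApproximateSubgroup K A →
          ∃ (H C : Subgroup G), H ≤ C ∧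
            ∃ _ : (H.subgroupOf C).Normal,
              (H : Set G) ⊆ A ^ m K ∧
              upperCentralSeries (↥C ⧸ H.subgroupOf C) ⌊K ^ 6⌋₊ = ⊤ ∧
              ∃ X : Set G, X.Finite ∧ (X.ncard : ℝ) ≤ Real.exp (K ^ c) ∧
                A ⊆ X * (C : Set G) := by
  refine ⟨15, fun K => 2 + (2 ^ ⌊K ^ 6⌋₊ * 14 + 2) * ⌊K ^ (2 ^ ⌊K ^ 6⌋₊ * 14 + 2)⌋₊,
    by norm_num, ?_⟩
  intro G _ hG K hK A hA
  obtain ⟨H, C, hHC, hn, hHA, hZ, hcover⟩ := hA.exists_subgroups hG hK rfl rfl rfl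
  obtain ⟨X, hX, hXK, hXA⟩ := hcover.exists_cover
  exact ⟨H, C, hHC, hn, hHA, hZ, X, hX, hXK.trans (pow_nine_mul_floor_le_exp hK), hXA⟩
end

section
/- There exist absolute constants c₁, c₂ > 0 such that the following holds. Let K ≥ 1 and r ≥ 1, let G be a residually nilpotent group in which every element has order at most r, and let A be a K-approximate subgroup of G. Then there exist a nilpotent subgroup N of G with N ⊆ A^{⌈c₂ · r · K^6⌉} and a set X ⊆ G with |X| ≤ exp(K^{c₁}) such that A ⊆ X·N. -/
open Pointwise

universe u

section FiniteSets

variable {G : Type*} [Group G]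

theorem ncard_pow_le (X : Set G) (n : ℕ) : (X ^ n).ncard ≤ X.ncard ^ n := by
  induction n with
  | zero => simp [← Set.singleton_one]
  | succ n ih =>
    rw [pow_succ, pow_succ]
    calc (X ^ n * X).ncard ≤ (X ^ n).ncard * X.ncard := Set.natCard_mul_le
      _ ≤ _ := Nat.mul_le_mul_right _ ih

theorem finite_set_pow {X : Set G} (hX : X.Finite) (n : ℕ) : (X ^ n).Finite := by
  induction n with
  | zero => simp [← Set.singleton_one]
  | succ n ih => rw [pow_succ]; exact ih.mul hX

/-- If a set `S` is divided into finitely many classes such that quotients of elements of the same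
class lie in `D`, then `S` is covered by that many left cosets of `D`, with representatives
in `S`. -/
theorem exists_cover_of_classes {β : Type*} (S : Set G) (D : Set G) (f : G → β) (Y : Set β)
    (hY : Y.Finite) (hf : ∀ c ∈ S, f c ∈ Y)
    (hD : ∀ c ∈ S, ∀ d ∈ S, f c = f d → c⁻¹ * d ∈ D) :
    ∃ W ⊆ S, W.Finite ∧ W.ncard ≤ Y.ncard ∧ S ⊆ W * D := by
  obtain ⟨W, hWS, hbij⟩ := Set.SurjOn.exists_bijOn_subset (Set.surjOn_image f S)
  have hsub : f '' S ⊆ Y := Set.image_subset_iff.2 hf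
  refine ⟨W, hWS, ?_, ?_, ?_⟩
  · exact Set.Finite.of_finite_image (hbij.image_eq ▸ hY.subset hsub) hbij.injOn
  · rw [← hbij.injOn.ncard_image, hbij.image_eq]
    exact Set.ncard_le_ncard hsub hY
  · intro d hd
    obtain ⟨c, hc, hcd⟩ := hbij.surjOn ⟨d, hd, rfl⟩
    exact ⟨c, hc, c⁻¹ * d, hD c (hWS hc) d hd hcd, by group⟩

/-- A set covered by left cosets of `C` is covered by as many left translates of `(A⁻¹A) ∩ C`. -/
theorem exists_cover_inter {A X : Set G} {C : Subgroup G} (hsymm : A⁻¹ = A) (hX : X.Finite)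
    (hA : A ⊆ X * (C : Set G)) :
    ∃ W : Set G, W.Finite ∧ W.ncard ≤ X.ncard ∧ A ⊆ W * (A ^ 2 ∩ (C : Set G)) := by
  have hex : ∀ a, ∃ x, a ∈ A → x ∈ X ∧ x⁻¹ * a ∈ C := by
    intro a
    by_cases ha : a ∈ A
    · obtain ⟨x, hx, c, hc, rfl⟩ := hA ha
      exact ⟨x, fun _ => ⟨hx, by simpa using hc⟩⟩
    · exact ⟨1, fun h => absurd h ha⟩
  choose f hf using hex
  obtain ⟨W, -, hWf, hWc, hAW⟩ := exists_cover_of_classes A (A ^ 2 ∩ (C : Set G)) f X hX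
    (fun a ha => (hf a ha).1) (by
      intro a ha b hb hab
      refine ⟨?_, ?_⟩
      · rw [pow_two]
        exact Set.mul_mem_mul (hsymm ▸ Set.inv_mem_inv.2 ha) hb
      · have h := C.mul_mem (C.inv_mem (hf a ha).2) (hf b hb).2
        rw [hab] at h
        simpa [mul_assoc] using h)
  exact ⟨W, hWf, hWc, hAW⟩

end FiniteSets

namespace IsKApproximateSubgroup

variable {G : Type*} [Group G] {K : ℝ} {A : Set G}

theorem inv_mem_pow (hA : IsKApproximateSubgroup K A) {n : ℕ} {x : G} (hx : x ∈ A ^ n) :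
    x⁻¹ ∈ A ^ n := by
  have h : (A ^ n)⁻¹ = A ^ n := by rw [← inv_pow, hA.2.1]
  rw [← h]
  simpa using hx

theorem mem_pow_of_le (hA : IsKApproximateSubgroup K A) {m n : ℕ} (hmn : m ≤ n) {x : G}
    (hx : x ∈ A ^ m) : x ∈ A ^ n :=
  Set.pow_subset_pow_right hA.2.2.1 hmn hx

theorem mul_mem_pow {m n : ℕ} {x y : G} (hx : x ∈ A ^ m) (hy : y ∈ A ^ n) :
    x * y ∈ A ^ (m + n) := by
  rw [pow_add]
  exact Set.mul_mem_mul hx hy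

theorem finite_pow (hA : IsKApproximateSubgroup K A) (n : ℕ) : (A ^ n).Finite :=
  finite_set_pow hA.1 n

theorem exists_pow_succ_subset (hA : IsKApproximateSubgroup K A) (n : ℕ) :
    ∃ Y : Set G, Y.Finite ∧ (Y.ncard : ℝ) ≤ K ^ n ∧ A ^ (n + 1) ⊆ Y * A := by
  obtain ⟨X, hXf, hXK, hX⟩ := hA.2.2.2
  refine ⟨X ^ n, finite_set_pow hXf n, ?_, ?_⟩
  · calc ((X ^ n).ncard : ℝ) ≤ (X.ncard : ℝ) ^ n := by exact_mod_cast ncard_pow_le X n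
      _ ≤ K ^ n := by gcongr
  · exact Set.pow_subset_pow_mul_of_sq_subset_mul (by rwa [pow_two]) (Nat.succ_ne_zero n)

theorem ncard_pow_succ_le (hA : IsKApproximateSubgroup K A) (n : ℕ) :
    ((A ^ (n + 1)).ncard : ℝ) ≤ K ^ n * A.ncard := by
  obtain ⟨Y, hYf, hYK, hY⟩ := hA.exists_pow_succ_subset n
  calc ((A ^ (n + 1)).ncard : ℝ) ≤ ((Y * A).ncard : ℝ) := by
        exact_mod_cast Set.ncard_le_ncard hY (hYf.mul hA.1)
    _ ≤ (Y.ncard : ℝ) * A.ncard := by exact_mod_cast Set.natCard_mul_le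
    _ ≤ _ := by gcongr

theorem ncard_pos (hA : IsKApproximateSubgroup K A) : 0 < A.ncard :=
  (Set.ncard_pos hA.1).2 ⟨1, hA.2.2.1⟩

/-- If `A⁴ ∩ Γ` lies in `A² N`, where `N` is a normal subgroup of `Γ`, then `(A² ∩ Γ) N` is a
subgroup. -/
theorem exists_subgroup_of_pow_four (hA : IsKApproximateSubgroup K A) {Γ N : Subgroup G}
    (hN : N ≤ Γ) (hnorm : ∀ c ∈ Γ, ∀ n ∈ N, c * n * c⁻¹ ∈ N)
    (h4 : ∀ x ∈ A ^ 4, x ∈ Γ → x ∈ A ^ 2 * (N : Set G)) :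
    ∃ H : Subgroup G, N ≤ H ∧ H ≤ Γ ∧ (H : Set G) ⊆ A ^ 2 * (N : Set G) ∧
      ∀ x ∈ A ^ 4, x ∈ Γ → x ∈ H := by
  have key : ∀ x ∈ A ^ 4, x ∈ Γ → ∃ a ∈ A ^ 2, a ∈ Γ ∧ ∃ n ∈ N, a * n = x := by
    intro x hx hxΓ
    obtain ⟨a, ha, n, hn, rfl⟩ := h4 x hx hxΓ
    exact ⟨a, ha, (Γ.mul_mem_cancel_right (hN hn)).1 hxΓ, n, hn, rfl⟩
  let H : Subgroup G :=
    { carrier := {x | ∃ a ∈ A ^ 2, a ∈ Γ ∧ ∃ n ∈ N, a * n = x}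
      one_mem' := ⟨1, Set.one_mem_pow hA.2.2.1, Γ.one_mem, 1, N.one_mem, by simp⟩
      mul_mem' := by
        rintro _ _ ⟨a, ha, haΓ, n, hn, rfl⟩ ⟨b, hb, hbΓ, m, hm, rfl⟩
        obtain ⟨c, hc, hcΓ, l, hl, hcl⟩ := key (a * b) (mul_mem_pow ha hb) (Γ.mul_mem haΓ hbΓ)
        refine ⟨c, hc, hcΓ, l * (b⁻¹ * n * b) * m, ?_, ?_⟩
        · have := hnorm b⁻¹ (Γ.inv_mem hbΓ) n hn
          rw [inv_inv] at this
          exact N.mul_mem (N.mul_mem hl this) hm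
        · rw [← mul_assoc, ← mul_assoc, hcl]
          group
      inv_mem' := by
        rintro _ ⟨a, ha, haΓ, n, hn, rfl⟩
        exact ⟨a⁻¹, hA.inv_mem_pow ha, Γ.inv_mem haΓ, a * n⁻¹ * a⁻¹,
          hnorm a haΓ _ (N.inv_mem hn), by group⟩ }
  refine ⟨H, ?_, ?_, ?_, key⟩
  · intro n hn
    exact ⟨1, Set.one_mem_pow hA.2.2.1, Γ.one_mem, n, hn, by simp⟩
  · rintro _ ⟨a, -, haΓ, n, hn, rfl⟩
    exact Γ.mul_mem haΓ (hN hn)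
  · rintro _ ⟨a, ha, -, n, hn, rfl⟩
    exact ⟨a, ha, n, hn, rfl⟩

end IsKApproximateSubgroup

section ResiduallyNilpotent

variable {G : Type u} [Group G]

theorem ResiduallyNilpotent.exists_lowerCentralSeries_notMem (hG : ResiduallyNilpotent G) {g : G}
    (hg : g ≠ 1) : ∃ i, g ∉ (⊤ : Subgroup G).lowerCentralSeries i := by
  obtain ⟨N, _, π, hN, hπ⟩ := hG g hg
  obtain ⟨i, hi⟩ := Subgroup.nilpotent_iff_lowerCentralSeries.1 hN
  refine ⟨i, fun hgi => hπ ?_⟩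
  have h1 : π g ∈ ((⊤ : Subgroup G).lowerCentralSeries i).map π := Subgroup.mem_map_of_mem π hgi
  rw [Subgroup.map_lowerCentralSeries] at h1
  have h2 : π g ∈ (⊤ : Subgroup N).lowerCentralSeries i :=
    Subgroup.lowerCentralSeries_mono i le_top h1
  rw [hi] at h2
  simpa using h2

theorem ResiduallyNilpotent.exists_lowerCentralSeries_inter_subset (hG : ResiduallyNilpotent G)
    {S : Set G} (hS : S.Finite) :
    ∃ i, ∀ g ∈ S, g ∈ (⊤ : Subgroup G).lowerCentralSeries i → g = 1 := by
  induction S, hS using Set.Finite.induction_on with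
  | empty => exact ⟨0, by simp⟩
  | @insert a S _ _ ih =>
    obtain ⟨i, hi⟩ := ih
    have hj : ∃ j, a ∈ (⊤ : Subgroup G).lowerCentralSeries j → a = 1 := by
      by_cases ha : a = 1
      · exact ⟨0, fun _ => ha⟩
      · obtain ⟨j, hj⟩ := hG.exists_lowerCentralSeries_notMem ha
        exact ⟨j, fun h => absurd h hj⟩
    obtain ⟨j, hj⟩ := hj
    refine ⟨max i j, fun g hg hgm => ?_⟩
    rcases hg with rfl | hg
    · exact hj (Subgroup.lowerCentralSeries_antitone _ (le_max_right i j) hgm)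
    · exact hi g hg (Subgroup.lowerCentralSeries_antitone _ (le_max_left i j) hgm)

theorem ResiduallyNilpotent.isNilpotent_of_finite (hG : ResiduallyNilpotent G) (N : Subgroup G)
    (hN : (N : Set G).Finite) : Group.IsNilpotent N := by
  obtain ⟨i, hi⟩ := hG.exists_lowerCentralSeries_inter_subset hN
  refine (Subgroup.isNilpotent_iff_lowerCentralSeries N).2 ⟨i, ?_⟩
  rw [eq_bot_iff]
  intro g hg
  have h1 : g ∈ N := Subgroup.lowerCentralSeries_antitone N (Nat.zero_le i) hg
  exact Subgroup.mem_bot.2 (hi g h1 (Subgroup.lowerCentralSeries_mono i le_top hg))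

end ResiduallyNilpotent

section Iteration

variable {G : Type u} [Group G]

/-- A finite subgroup `N`, normal in `C`, recording `j` rounds of the construction: `N` lies in
`A ^ (8 * r * j)`, the translates of `A` by elements of `A⁶ ∩ N` cover at least `j + 1` times as
many elements as `A`, and `A` lies in at most `K ^ (15 * j)` left cosets of `C`. -/
structure IterationStage (K : ℝ) (A : Set G) (r j : ℕ) (N C : Subgroup G) : Prop where
  le : N ≤ C
  conj_mem : ∀ c ∈ C, ∀ n ∈ N, c * n * c⁻¹ ∈ N
  subset_pow : (N : Set G) ⊆ A ^ (8 * r * j)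
  ncard_le : (j + 1) * A.ncard ≤ (A * (A ^ 6 ∩ (N : Set G))).ncard
  cover : ∃ X : Set G, X.Finite ∧ (X.ncard : ℝ) ≤ K ^ (15 * j) ∧ A ⊆ X * (C : Set G)

theorem IsKApproximateSubgroup.iterationStage_zero {K : ℝ} {A : Set G}
    (hA : IsKApproximateSubgroup K A) (r : ℕ) : IterationStage K A r 0 ⊥ ⊤ where
  le := bot_le
  conj_mem := by simp
  subset_pow := by simp
  ncard_le := by
    have h : A ^ 6 ∩ ((⊥ : Subgroup G) : Set G) = {1} := by
      ext x
      simp only [Subgroup.coe_bot, Set.mem_inter_iff, Set.mem_singleton_iff,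
        and_iff_right_iff_imp]
      rintro rfl
      exact Set.one_mem_pow hA.2.2.1
    rw [h]
    simp
  cover := ⟨{1}, Set.finite_singleton 1, by simp, by simp⟩

theorem IterationStage.succ_le {K : ℝ} {A : Set G} {r j : ℕ} {N C : Subgroup G}
    (h : IterationStage K A r j N C) (hA : IsKApproximateSubgroup K A) :
    (j : ℝ) + 1 ≤ K ^ 6 := by
  have h1 : (A * (A ^ 6 ∩ (N : Set G))).ncard ≤ (A ^ (6 + 1)).ncard := by
    refine Set.ncard_le_ncard ?_ (hA.finite_pow _)
    rw [pow_succ' A 6]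
    exact Set.mul_subset_mul_left Set.inter_subset_left
  have h2 : ((j : ℝ) + 1) * A.ncard ≤ K ^ 6 * A.ncard :=
    le_trans (by exact_mod_cast h.ncard_le.trans h1) (hA.ncard_pow_succ_le 6)
  exact le_of_mul_le_mul_right h2 (by exact_mod_cast hA.ncard_pos)

/-- If `S` is finite, `C` normalises the finite subgroup `N` and `S ∩ C` is not contained in
`T ⊇ N`, then some layer `Γ` of the lower central series, taken modulo `N` inside `C`, satisfies
`S ∩ Γ ⊆ T` while `S ∩ C` has an element outside `T` whose commutators with `C` lie in `Γ`. -/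
theorem ResiduallyNilpotent.exists_layer (hG : ResiduallyNilpotent G) {S T : Set G}
    (hS : S.Finite) {N C : Subgroup G} (hNf : (N : Set G).Finite) (hNC : N ≤ C)
    (hnorm : ∀ c ∈ C, ∀ n ∈ N, c * n * c⁻¹ ∈ N) (hNT : (N : Set G) ⊆ T)
    (hST : ¬ ∀ x ∈ S, x ∈ C → x ∈ T) :
    ∃ Γ : Subgroup G, N ≤ Γ ∧ Γ ≤ C ∧ (∀ c ∈ C, ∀ x ∈ Γ, c * x * c⁻¹ ∈ Γ) ∧
      (∀ x ∈ S, x ∈ Γ → x ∈ T) ∧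
      ∃ z ∈ S, z ∈ C ∧ z ∉ T ∧ ∀ c ∈ C, c * z * c⁻¹ * z⁻¹ ∈ Γ := by
  let L : ℕ → Subgroup G := fun i => ((⊤ : Subgroup G).lowerCentralSeries i ⊔ N) ⊓ C
  have mem_L : ∀ {i x}, x ∈ L i ↔
      (∃ g ∈ (⊤ : Subgroup G).lowerCentralSeries i, ∃ n ∈ N, g * n = x) ∧ x ∈ C := by
    intro i x
    rw [Subgroup.mem_inf, ← SetLike.mem_coe, Subgroup.normal_mul]
    rfl
  have hfinal : ∃ i, ∀ x ∈ S, x ∈ L i → x ∈ T := by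
    obtain ⟨i, hi⟩ := hG.exists_lowerCentralSeries_inter_subset (hS.mul hNf)
    refine ⟨i, fun x hx hxL => ?_⟩
    obtain ⟨⟨g, hg, n, hn, rfl⟩, -⟩ := mem_L.1 hxL
    have : g = 1 := hi g ⟨g * n, hx, n⁻¹, N.inv_mem hn, by group⟩ hg
    rw [this, one_mul]
    exact hNT hn
  have hlast : ∃ i, (¬ ∀ x ∈ S, x ∈ L i → x ∈ T) ∧ ∀ x ∈ S, x ∈ L (i + 1) → x ∈ T := by
    by_contra! hcon
    obtain ⟨i, hi⟩ := hfinal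
    have hall : ∀ i, ¬ ∀ x ∈ S, x ∈ L i → x ∈ T := by
      intro i
      induction i with
      | zero => simpa [L] using hST
      | succ i ih =>
        intro hi
        obtain ⟨x, hx, hxL, hxT⟩ := hcon i (by push Not at ih; exact ih)
        exact hxT (hi x hx hxL)
    exact hall i hi
  obtain ⟨i, hi, hi'⟩ := hlast
  push Not at hi
  obtain ⟨z, hzS, hzL, hzT⟩ := hi
  refine ⟨L (i + 1), le_inf le_sup_right hNC, inf_le_right, ?_, hi', z, hzS, hzL.2, hzT, ?_⟩
  · intro c hc x hx
    obtain ⟨⟨g, hg, n, hn, rfl⟩, hxC⟩ := mem_L.1 hx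
    refine mem_L.2 ⟨⟨c * g * c⁻¹, Subgroup.Normal.conj_mem inferInstance g hg c,
      c * n * c⁻¹, hnorm c hc n hn, by group⟩, C.mul_mem (C.mul_mem hc hxC) (C.inv_mem hc)⟩
  · intro c hc
    obtain ⟨⟨g, hg, n, hn, rfl⟩, hzC⟩ := mem_L.1 hzL
    have hgC : g ∈ C := (C.mul_mem_cancel_right (hNC hn)).1 hzC
    have hcomm : g * c * g⁻¹ * c⁻¹ ∈ (⊤ : Subgroup G).lowerCentralSeries (i + 1) :=
      Subgroup.commutator_mem_commutator hg (Subgroup.mem_top c)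
    have hn' : g * (n * c * n⁻¹ * c⁻¹) * g⁻¹ ∈ N := by
      refine hnorm g hgC _ ?_
      have := N.mul_mem hn (hnorm c hc n⁻¹ (N.inv_mem hn))
      simpa [mul_assoc] using this
    have hL : c * (g * n) * c⁻¹ * (g * n)⁻¹ =
        (g * (n * c * n⁻¹ * c⁻¹) * g⁻¹ * (g * c * g⁻¹ * c⁻¹))⁻¹ := by group
    rw [hL]
    refine Subgroup.inv_mem _ (Subgroup.mul_mem _ ⟨Subgroup.mem_sup_right hn', ?_⟩
      ⟨Subgroup.mem_sup_left hcomm, ?_⟩)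
    · exact hNC hn'
    · exact C.mul_mem (C.mul_mem (C.mul_mem hgC hc) (C.inv_mem hgC)) (C.inv_mem hc)

/-- The elements of `C` centralising `z` modulo the subgroup `H`, which `C` normalises. -/
def centralizerModulo (C H : Subgroup G) (hH : ∀ c ∈ C, ∀ x ∈ H, c * x * c⁻¹ ∈ H) (z : G) :
    Subgroup G where
  carrier := {c | c ∈ C ∧ c * z * c⁻¹ * z⁻¹ ∈ H}
  one_mem' := ⟨C.one_mem, by simp⟩
  mul_mem' := by
    rintro c d ⟨hc, hcz⟩ ⟨hd, hdz⟩
    refine ⟨C.mul_mem hc hd, ?_⟩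
    have := H.mul_mem (hH c hc _ hdz) hcz
    convert this using 1
    group
  inv_mem' := by
    rintro c ⟨hc, hcz⟩
    refine ⟨C.inv_mem hc, ?_⟩
    have := hH c⁻¹ (C.inv_mem hc) _ (H.inv_mem hcz)
    convert this using 1
    group

theorem zpowers_subset_pow {r : ℕ} (hr : ∀ g : G, 0 < orderOf g ∧ orderOf g ≤ r) {A : Set G}
    (h1 : (1 : G) ∈ A) {k : ℕ} {z : G} (hz : z ∈ A ^ k) :
    (Subgroup.zpowers z : Set G) ⊆ A ^ (k * r) := by
  intro x hx
  have hfin : IsOfFinOrder z := orderOf_pos_iff.1 (hr z).1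
  classical
  rw [SetLike.mem_coe, hfin.mem_zpowers_iff_mem_range_orderOf, Finset.mem_image] at hx
  obtain ⟨i, hi, rfl⟩ := hx
  have hi' : k * i ≤ k * r :=
    Nat.mul_le_mul_left k ((Finset.mem_range.1 hi).le.trans (hr z).2)
  refine Set.pow_subset_pow_right h1 hi' ?_
  rw [pow_mul]
  exact Set.pow_mem_pow hz

/-- Enlarging a subgroup of `C` by an element `z` whose conjugates by `C` it controls. -/
theorem conj_mem_zpowers_sup {H D : Subgroup G} {z : G}
    (hH : ∀ c ∈ D, ∀ x ∈ H, c * x * c⁻¹ ∈ H) (hz : ∀ c ∈ D, c * z * c⁻¹ * z⁻¹ ∈ H) :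
    ∀ c ∈ D, ∀ n ∈ Subgroup.zpowers z ⊔ H, c * n * c⁻¹ ∈ Subgroup.zpowers z ⊔ H := by
  intro c hc
  have hle : Subgroup.zpowers z ⊔ H ≤
      (Subgroup.zpowers z ⊔ H).comap (MulAut.conj c).toMonoidHom := by
    refine sup_le ?_ ?_
    · rw [Subgroup.zpowers_le]
      have h1 := (Subgroup.zpowers z ⊔ H).mul_mem (Subgroup.mem_sup_right (hz c hc))
        (Subgroup.mem_sup_left (Subgroup.mem_zpowers z))
      simpa using h1
    · intro x hx
      exact Subgroup.mem_sup_right (hH c hc x hx)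
  intro n hn
  exact hle hn

theorem IterationStage.terminal_or_succ (hG : ResiduallyNilpotent G) {K : ℝ} {A : Set G}
    (hA : IsKApproximateSubgroup K A) {r : ℕ} (hr1 : 1 ≤ r)
    (hr : ∀ g : G, 0 < orderOf g ∧ orderOf g ≤ r) {j : ℕ} {N C : Subgroup G}
    (h : IterationStage K A r j N C) :
    (∃ B : Subgroup G, A ^ 2 ∩ (C : Set G) ⊆ B ∧ (B : Set G) ⊆ A ^ 2 * (N : Set G)) ∨
      ∃ N' C' : Subgroup G, IterationStage K A r (j + 1) N' C' := by
  have hone : (1 : G) ∈ A ^ 2 := Set.one_mem_pow hA.2.2.1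
  let E : Subgroup G := Subgroup.closure (A ^ 2 ∩ (C : Set G) ∪ N)
  have hEC : E ≤ C := (Subgroup.closure_le C).2 (Set.union_subset Set.inter_subset_right h.le)
  have hAE : A ^ 2 ∩ (C : Set G) ⊆ E := fun x hx => Subgroup.subset_closure (Or.inl hx)
  have hNE : N ≤ E := fun x hx => Subgroup.subset_closure (Or.inr hx)
  have hEN : ∀ c ∈ E, ∀ n ∈ N, c * n * c⁻¹ ∈ N := fun c hc => h.conj_mem c (hEC hc)
  by_cases hterm : ∀ x ∈ A ^ 6, x ∈ E → x ∈ A ^ 2 * (N : Set G)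
  · left
    obtain ⟨B, -, -, hBA, hB⟩ := hA.exists_subgroup_of_pow_four hNE hEN
      (fun x hx => hterm x (hA.mem_pow_of_le (by norm_num) hx))
    exact ⟨B, fun x hx => hB x (hA.mem_pow_of_le (by norm_num) hx.1) (hAE hx), hBA⟩
  right
  have hNf : (N : Set G).Finite := (hA.finite_pow _).subset h.subset_pow
  obtain ⟨Γ, hNΓ, hΓE, hEΓ, hΓ, z, hzA, hzE, hzN, hzΓ⟩ := hG.exists_layer (hA.finite_pow 6) hNf
    hNE hEN (fun n hn => (⟨1, hone, n, hn, one_mul n⟩ : n ∈ A ^ 2 * (N : Set G))) hterm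
  obtain ⟨H, hNH, hHΓ, hHA, hH⟩ := hA.exists_subgroup_of_pow_four hNΓ
    (fun c hc => hEN c (hΓE hc)) (fun x hx => hΓ x (hA.mem_pow_of_le (by norm_num) hx))
  have hH6 : ∀ x ∈ A ^ 6, x ∈ Γ → x ∈ H := by
    intro x hx hxΓ
    obtain ⟨a, ha, n, hn, rfl⟩ := hΓ x hx hxΓ
    exact H.mul_mem (hH a (hA.mem_pow_of_le (by norm_num) ha)
      ((Γ.mul_mem_cancel_right (hNΓ hn)).1 hxΓ)) (hNH hn)
  have hconj : ∀ c ∈ A ^ 2, c ∈ E → ∀ x ∈ H, c * x * c⁻¹ ∈ H := by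
    intro c hc hcE x hx
    obtain ⟨a, ha, n, hn, rfl⟩ := hHA hx
    have haΓ : a ∈ Γ := (Γ.mul_mem_cancel_right (hNΓ hn)).1 (hHΓ hx)
    have h1 : c * a * c⁻¹ ∈ H := hH6 _
      (IsKApproximateSubgroup.mul_mem_pow (IsKApproximateSubgroup.mul_mem_pow hc ha)
        (hA.inv_mem_pow hc)) (hEΓ c hcE a haΓ)
    have h2 := H.mul_mem h1 (hNH (hEN c hcE n hn))
    convert h2 using 1
    group
  have hEH : ∀ c ∈ E, ∀ x ∈ H, c * x * c⁻¹ ∈ H := by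
    have hle : E ≤ Subgroup.normalizer (H : Set G) := by
      refine (Subgroup.closure_le _).2 ?_
      rintro c (⟨hcA, hcC⟩ | hc)
      · refine Subgroup.mem_normalizer_iff.2 fun x => ⟨hconj c hcA (hAE ⟨hcA, hcC⟩) x, fun hx => ?_⟩
        have h1 := hconj c⁻¹ (hA.inv_mem_pow hcA) (E.inv_mem (hAE ⟨hcA, hcC⟩)) _ hx
        simpa [mul_assoc] using h1
      · exact Subgroup.le_normalizer (hNH hc)
    exact fun c hc x => (Subgroup.mem_normalizer_iff.1 (hle hc) x).1
  let D : Subgroup G := centralizerModulo E H hEH z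
  have hDE : D ≤ E := fun c hc => hc.1
  have hDz : ∀ c ∈ D, c * z * c⁻¹ * z⁻¹ ∈ H := fun c hc => hc.2
  have hHD : H ≤ D := by
    intro x hx
    refine ⟨hΓE (hHΓ hx), ?_⟩
    have h1 := H.mul_mem hx (hEH z hzE x⁻¹ (H.inv_mem hx))
    simpa [mul_assoc] using h1
  have hzD : z ∈ D := ⟨hzE, by simp⟩
  refine ⟨Subgroup.zpowers z ⊔ H, D, ?_, ?_, ?_, ?_, ?_⟩
  · exact sup_le ((Subgroup.zpowers_le).2 hzD) hHD
  · exact conj_mem_zpowers_sup (fun c hc => hEH c (hDE hc)) hDz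
  · have hzH : Subgroup.zpowers z ≤ Subgroup.normalizer (H : Set G) := by
      rw [Subgroup.zpowers_le, Subgroup.mem_normalizer_iff]
      refine fun x => ⟨hEH z hzE x, fun hx => ?_⟩
      have h1 := hEH z⁻¹ (E.inv_mem hzE) _ hx
      simpa [mul_assoc] using h1
    rw [Subgroup.coe_mul_of_left_le_normalizer_right _ _ hzH]
    rintro _ ⟨x, hx, y, hy, rfl⟩
    obtain ⟨a, ha, n, hn, rfl⟩ := hHA hy
    have h1 := IsKApproximateSubgroup.mul_mem_pow (zpowers_subset_pow hr hA.2.2.1 hzA hx)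
      (IsKApproximateSubgroup.mul_mem_pow ha (h.subset_pow hn))
    refine hA.mem_pow_of_le ?_ h1
    rw [mul_add]
    omega
  · have hdisj : Disjoint (A * (A ^ 6 ∩ (N : Set G))) (A * {z}) := by
      rw [Set.disjoint_left]
      rintro _ ⟨a, ha, n, ⟨-, hn⟩, rfl⟩ ⟨b, hb, w, hw, hab⟩
      rw [Set.mem_singleton_iff] at hw
      subst hw
      refine hzN ⟨b⁻¹ * a, ?_, n, hn, ?_⟩
      · rw [pow_two]
        exact Set.mul_mem_mul (hA.2.1 ▸ Set.inv_mem_inv.2 hb) ha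
      · change b * w = a * n at hab
        change b⁻¹ * a * n = w
        rw [mul_assoc, ← hab, inv_mul_cancel_left]
    have hcard : (A * {z}).ncard = A.ncard := by
      rw [Set.mul_singleton]
      exact Set.ncard_image_of_injective _ (mul_left_injective z)
    have hf1 : (A * (A ^ 6 ∩ (N : Set G))).Finite :=
      hA.1.mul ((hA.finite_pow 6).inter_of_left _)
    have hf2 : (A * (A ^ 6 ∩ ((Subgroup.zpowers z ⊔ H : Subgroup G) : Set G))).Finite :=
      hA.1.mul ((hA.finite_pow 6).inter_of_left _)
    calc (j + 1 + 1) * A.ncard = (j + 1) * A.ncard + (A * {z}).ncard := by rw [hcard]; ring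
      _ ≤ (A * (A ^ 6 ∩ (N : Set G))).ncard + (A * {z}).ncard :=
        Nat.add_le_add_right h.ncard_le _
      _ = (A * (A ^ 6 ∩ (N : Set G)) ∪ A * {z}).ncard :=
        (Set.ncard_union_eq hdisj hf1 (hA.1.mul (Set.finite_singleton z))).symm
      _ ≤ _ := by
        refine Set.ncard_le_ncard (Set.union_subset ?_ ?_) hf2
        · exact Set.mul_subset_mul_left (Set.inter_subset_inter_right _
            (fun n hn => Subgroup.mem_sup_right (hNH hn)))
        · refine Set.mul_subset_mul_left (Set.singleton_subset_iff.2 ⟨hzA, ?_⟩)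
          exact Subgroup.mem_sup_left (Subgroup.mem_zpowers z)
  · obtain ⟨X, hXf, hXK, hX⟩ := h.cover
    obtain ⟨W, hWf, hWX, hAW⟩ := exists_cover_inter hA.2.1 hXf hX
    obtain ⟨Y, hYf, hYK, hY⟩ := hA.exists_pow_succ_subset 15
    have hcover : ∃ V ⊆ A ^ 2 ∩ (C : Set G), V.Finite ∧ V.ncard ≤ Y.ncard ∧
        A ^ 2 ∩ (C : Set G) ⊆ V * (D : Set G) := by
      have hex : ∀ c, ∃ y, c ∈ A ^ 2 ∩ (C : Set G) →
          y ∈ Y ∧ y⁻¹ * (c * z * c⁻¹ * z⁻¹) ∈ A := by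
        intro c
        by_cases hc : c ∈ A ^ 2 ∩ (C : Set G)
        · have h16 : c * z * c⁻¹ * z⁻¹ ∈ A ^ (2 + 6 + 2 + 6) :=
            IsKApproximateSubgroup.mul_mem_pow (IsKApproximateSubgroup.mul_mem_pow
              (IsKApproximateSubgroup.mul_mem_pow hc.1 hzA) (hA.inv_mem_pow hc.1))
              (hA.inv_mem_pow hzA)
          obtain ⟨y, hy, a, ha, hya⟩ := hY h16
          refine ⟨y, fun _ => ⟨hy, ?_⟩⟩
          rw [← hya]
          simpa using ha
        · exact ⟨1, fun h => absurd h hc⟩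
      choose f hf using hex
      refine exists_cover_of_classes _ _ f Y hYf (fun c hc => (hf c hc).1) ?_
      intro c hc d hd hcd
      have hcE := hAE hc
      have hdE := hAE hd
      refine ⟨E.mul_mem (E.inv_mem hcE) hdE, ?_⟩
      have h1 : (c * z * c⁻¹ * z⁻¹)⁻¹ * (d * z * d⁻¹ * z⁻¹) ∈ H := by
        refine hH _ (hA.mem_pow_of_le (by norm_num : 2 ≤ 4) ?_)
          (Γ.mul_mem (Γ.inv_mem (hzΓ c hcE)) (hzΓ d hdE))
        have h2 := Set.mul_mem_mul (hA.2.1 ▸ Set.inv_mem_inv.2 (hf c hc).2 : _ ∈ A) (hf d hd).2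
        rw [← pow_two, hcd] at h2
        simpa [mul_assoc] using h2
      have h2 := hEH (z * c⁻¹ * z⁻¹)
        (E.mul_mem (E.mul_mem hzE (E.inv_mem hcE)) (E.inv_mem hzE)) _ h1
      convert h2 using 1
      group
    obtain ⟨V, -, hVf, hVY, hV⟩ := hcover
    refine ⟨W * V, hWf.mul hVf, ?_, ?_⟩
    · calc ((W * V).ncard : ℝ) ≤ (W.ncard : ℝ) * V.ncard := by
            exact_mod_cast Set.natCard_mul_le
        _ ≤ (X.ncard : ℝ) * Y.ncard := by gcongr
        _ ≤ K ^ (15 * j) * K ^ 15 := by gcongr; exact (Nat.cast_nonneg _).trans hXK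
        _ = K ^ (15 * (j + 1)) := by rw [← pow_add, mul_add, mul_one]
    · rw [mul_assoc]
      exact hAW.trans (Set.mul_subset_mul_left hV)

theorem IsKApproximateSubgroup.exists_terminal_stage (hG : ResiduallyNilpotent G) {K : ℝ}
    {A : Set G} (hA : IsKApproximateSubgroup K A) {r : ℕ} (hr1 : 1 ≤ r)
    (hr : ∀ g : G, 0 < orderOf g ∧ orderOf g ≤ r) :
    ∃ (j : ℕ) (N C B : Subgroup G), IterationStage K A r j N C ∧
      A ^ 2 ∩ (C : Set G) ⊆ B ∧ (B : Set G) ⊆ A ^ 2 * (N : Set G) := by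
  by_contra! hcon
  have hall : ∀ j, ∃ N C : Subgroup G, IterationStage K A r j N C := by
    intro j
    induction j with
    | zero => exact ⟨⊥, ⊤, hA.iterationStage_zero r⟩
    | succ j ih =>
      obtain ⟨N, C, h⟩ := ih
      rcases h.terminal_or_succ hG hA hr1 hr with ⟨B, hB, hBN⟩ | h'
      · exact absurd hBN (hcon j N C B h hB)
      · exact h'
  obtain ⟨j, hj⟩ := exists_nat_gt (K ^ 6)
  obtain ⟨N, C, h⟩ := hall j
  have := h.succ_le hA
  linarith

end Iteration

theorem pow_le_exp_pow {K : ℝ} (hK : 1 ≤ K) {j : ℕ} (hj : (j : ℝ) + 1 ≤ K ^ 6) :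
    K ^ (15 * j) ≤ Real.exp (K ^ (21 : ℝ)) := by
  have hK0 : 0 < K := by linarith
  have hlog : 15 * Real.log K ≤ K ^ 15 := by
    have h1 := Real.add_one_le_exp (15 * Real.log K)
    have h2 : Real.exp (15 * Real.log K) = K ^ 15 := by
      rw [show (15 : ℝ) * Real.log K = ((15 : ℕ) : ℝ) * Real.log K by norm_num,
        Real.exp_nat_mul, Real.exp_log hK0]
    linarith
  have h0 : 0 ≤ Real.log K := Real.log_nonneg hK
  calc K ^ (15 * j) = Real.exp (j * (15 * Real.log K)) := by
        rw [mul_comm 15 j, pow_mul', Real.exp_nat_mul]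
        congr 1
        rw [show (15 : ℝ) * Real.log K = ((15 : ℕ) : ℝ) * Real.log K by norm_num,
          Real.exp_nat_mul, Real.exp_log hK0]
    _ ≤ Real.exp (K ^ (21 : ℝ)) := by
        refine Real.exp_le_exp.2 ?_
        calc (j : ℝ) * (15 * Real.log K) ≤ K ^ 6 * K ^ 15 := by
              gcongr
              linarith
          _ = K ^ (21 : ℝ) := by
              rw [← pow_add, ← Real.rpow_natCast]
              norm_num

theorem statement_2 :
    ∃ c₁ c₂ : ℝ, 0 < c₁ ∧ 0 < c₂ ∧
      ∀ (G : Type*) [Group G], ResiduallyNilpotent G →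
        ∀ r : ℕ, 1 ≤ r → (∀ g : G, 0 < orderOf g ∧ orderOf g ≤ r) →
          ∀ K : ℝ, 1 ≤ K → ∀ A : Set G, IsKApproximateSubgroup K A →
            ∃ N : Subgroup G, Group.IsNilpotent ↥N ∧
              (N : Set G) ⊆ A ^ ⌈c₂ * r * K ^ 6⌉₊ ∧
              ∃ X : Set G, X.Finite ∧ (X.ncard : ℝ) ≤ Real.exp (K ^ c₁) ∧
                A ⊆ X * (N : Set G) := by

  refine ⟨21, 8, by norm_num, by norm_num, ?_⟩
  intro G _ hG r hr1 hr K hK A hA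
  obtain ⟨j, N, C, B, h, hCB, hBN⟩ := hA.exists_terminal_stage hG hr1 hr
  have hj := h.succ_le hA
  have hpow : (B : Set G) ⊆ A ^ ⌈(8 : ℝ) * r * K ^ 6⌉₊ := by
    intro x hx
    obtain ⟨a, ha, n, hn, rfl⟩ := hBN hx
    refine hA.mem_pow_of_le ?_ (IsKApproximateSubgroup.mul_mem_pow ha (h.subset_pow hn))
    have h1 : ((8 * r * (j + 1) : ℕ) : ℝ) ≤ 8 * r * K ^ 6 := by
      push_cast
      gcongr
    have h2 : 8 * r * (j + 1) ≤ ⌈(8 : ℝ) * r * K ^ 6⌉₊ := by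
      exact_mod_cast h1.trans (Nat.le_ceil _)
    refine le_trans ?_ h2
    rw [mul_add]
    omega
  refine ⟨B, hG.isNilpotent_of_finite B ((hA.finite_pow _).subset hpow), hpow, ?_⟩
  obtain ⟨X, hXf, hXK, hX⟩ := h.cover
  obtain ⟨W, hWf, hWX, hAW⟩ := exists_cover_inter hA.2.1 hXf hX
  refine ⟨W, hWf, ?_, hAW.trans (Set.mul_subset_mul_left hCB)⟩
  calc (W.ncard : ℝ) ≤ X.ncard := by exact_mod_cast hWX
    _ ≤ K ^ (15 * j) := hXK
    _ ≤ _ := pow_le_exp_pow hK hj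
end

section
/- Let K ≥ 1 and r ≥ 1, let G be a nilpotent group in which every element has order at most r, and let A be a K-approximate subgroup of G. Then there exist a subgroup N of G with N ⊆ A^{(3r+2)K^6 + 2} and a set X ⊆ G with |X| ≤ K^{35K^6 + 2} such that A ⊆ X·N. -/
open Pointwise

/-- A set whose points are sorted into finitely many classes, such that `b⁻¹ * b' ∈ D` for any two
points `b`, `b'` of one class, is covered by as many left translates of `D`. -/
lemma exists_cover_of_classes_s3 {G β : Type*} [Group G] {B D : Set G} {X : Set β} (hX : X.Finite)
    (f : G → β) (hf : ∀ b ∈ B, f b ∈ X)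
    (hD : ∀ b ∈ B, ∀ b' ∈ B, f b = f b' → b⁻¹ * b' ∈ D) :
    ∃ Y : Set G, Y.Finite ∧ Y.ncard ≤ X.ncard ∧ B ⊆ Y * D := by
  obtain ⟨Y, hYB, hY⟩ := Set.exists_subset_bijOn B f
  have hsub : f '' Y ⊆ X := by
    rintro _ ⟨y, hy, rfl⟩
    exact hf y (hYB hy)
  refine ⟨Y, Set.Finite.of_finite_image (hX.subset hsub) hY.injOn, ?_, ?_⟩
  · rw [← hY.injOn.ncard_image]
    exact Set.ncard_le_ncard hsub hX
  · intro b hb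
    obtain ⟨y, hy, hyb⟩ := hY.surjOn (Set.mem_image_of_mem f hb)
    exact ⟨y, hy, y⁻¹ * b, hD y (hYB hy) b hb hyb, by simp⟩

/-- A set covered by left cosets of a subgroup `C` is covered by as many left translates of
`A⁻¹ * A ∩ C`. -/
lemma exists_cover_inv_mul_inter {G : Type*} [Group G] {A X : Set G} {C : Subgroup G}
    (hX : X.Finite) (hA : A ⊆ X * (C : Set G)) :
    ∃ Y : Set G, Y.Finite ∧ Y.ncard ≤ X.ncard ∧ A ⊆ Y * (A⁻¹ * A ∩ (C : Set G)) := by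
  have h : ∀ a : G, ∃ x, a ∈ A → x ∈ X ∧ x⁻¹ * a ∈ C := by
    intro a
    by_cases ha : a ∈ A
    · obtain ⟨x, hx, c, hc, rfl⟩ := hA ha
      exact ⟨x, fun _ => ⟨hx, by simpa using hc⟩⟩
    · exact ⟨1, fun h => absurd h ha⟩
  choose f hf using h
  refine exists_cover_of_classes_s3 hX f (fun b hb => (hf b hb).1) fun b hb b' hb' hbb' =>
    ⟨⟨b⁻¹, by simpa using hb, b', hb', rfl⟩, ?_⟩
  have := C.mul_mem (C.inv_mem (hf b hb).2) (hf b' hb').2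
  rw [hbb'] at this
  simpa [mul_assoc] using this

lemma pow_succ_subset_pow_mul {G : Type*} [Group G] {A X : Set G} (h : A * A ⊆ X * A) (n : ℕ) :
    A ^ (n + 1) ⊆ X ^ n * A := by
  induction n with
  | zero => simp
  | succ n ih =>
    calc A ^ (n + 1 + 1) = A ^ (n + 1) * A := pow_succ _ _
      _ ⊆ X ^ n * A * A := Set.mul_subset_mul_right ih
      _ = X ^ n * (A * A) := mul_assoc _ _ _
      _ ⊆ X ^ n * (X * A) := Set.mul_subset_mul_left h
      _ = X ^ (n + 1) * A := by rw [pow_succ, mul_assoc]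

lemma finite_pow_s3 {G : Type*} [Group G] {X : Set G} (hX : X.Finite) (n : ℕ) :
    (X ^ n).Finite := by
  induction n with
  | zero => simp [← Set.singleton_one]
  | succ n ih =>
    rw [pow_succ]
    exact ih.mul hX

lemma ncard_mul_le_mul_ncard {G : Type*} [Group G] (S T : Set G) :
    (S * T).ncard ≤ S.ncard * T.ncard :=
  Set.natCard_mul_le

lemma ncard_pow_le_pow_ncard {G : Type*} [Group G] (X : Set G) (n : ℕ) :
    (X ^ n).ncard ≤ X.ncard ^ n := by
  induction n with
  | zero => simp [← Set.singleton_one]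
  | succ n ih =>
    rw [pow_succ, pow_succ]
    exact (ncard_mul_le_mul_ncard _ _).trans (Nat.mul_le_mul_right _ ih)

/-- In a nilpotent group, a normal section `C / H` has a central series. -/
lemma exists_central_series_of_le_normalizer {G : Type*} [Group G] (hG : Group.IsNilpotent G)
    {H C : Subgroup G} (hHC : H ≤ C) (hCH : C ≤ Subgroup.normalizer (H : Set G)) :
    ∃ (Γ : ℕ → Subgroup G) (n : ℕ), Γ 0 = C ∧ Γ n = H ∧
      ∀ j, H ≤ Γ j ∧ Γ j ≤ C ∧ C ≤ Subgroup.normalizer (Γ j : Set G) ∧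
        ∀ g ∈ Γ j, ∀ c ∈ C, g⁻¹ * (c * g * c⁻¹) ∈ Γ (j + 1) := by
  obtain ⟨n, hn⟩ := Subgroup.nilpotent_iff_lowerCentralSeries.mp hG
  let L : ℕ → Subgroup G := (⊤ : Subgroup G).lowerCentralSeries
  have hmem : ∀ j g, g ∈ (L j ⊓ C) ⊔ H ↔ ∃ t ∈ L j ⊓ C, ∃ k ∈ H, t * k = g := by
    intro j g
    rw [← SetLike.mem_coe (B := G),
      Subgroup.coe_mul_of_left_le_normalizer_right _ _ (inf_le_right.trans hCH)]
    exact Set.mem_mul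
  have hconj : ∀ c ∈ C, ∀ k ∈ H, c * k * c⁻¹ ∈ H := Subgroup.le_normalizer_iff.mp hCH
  refine ⟨fun j => (L j ⊓ C) ⊔ H, n, ?_, ?_, fun j => ⟨le_sup_right, sup_le inf_le_right hHC,
    ?_, ?_⟩⟩
  · simpa [L] using hHC
  · simp [L, hn]
  · have hL : (L j).Normal := inferInstance
    refine Subgroup.le_normalizer_iff.mpr fun c hc g hg => ?_
    obtain ⟨t, ht, k, hk, rfl⟩ := (hmem j g).mp hg
    refine (hmem j _).mpr ⟨c * t * c⁻¹, ⟨hL.conj_mem t ht.1 c,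
      C.mul_mem (C.mul_mem hc ht.2) (C.inv_mem hc)⟩, c * k * c⁻¹, hconj c hc k hk, by group⟩
  · intro g hg c hc
    obtain ⟨t, ht, k, hk, rfl⟩ := (hmem j g).mp hg
    have h1 : t⁻¹ * c * t * c⁻¹ ∈ L (j + 1) ⊓ C := by
      refine ⟨?_, C.mul_mem (C.mul_mem (C.mul_mem (C.inv_mem ht.2) hc) ht.2) (C.inv_mem hc)⟩
      have := Subgroup.commutator_mem_commutator ((L j).inv_mem ht.1) (Subgroup.mem_top c)
      simpa [L, Subgroup.lowerCentralSeries_succ, commutatorElement_def] using this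
    have h2 := Subgroup.mul_mem _ (Subgroup.mul_mem ((L (j + 1) ⊓ C) ⊔ H)
      (Subgroup.mem_sup_right (H.inv_mem hk)) (Subgroup.mem_sup_left h1))
      (Subgroup.mem_sup_right (hconj c hc k hk))
    convert h2 using 1
    group

lemma subset_normalizer_of_inv_eq {G : Type*} [Group G] {B S : Set G} (hB : B⁻¹ = B)
    (h : ∀ b ∈ B, ∀ s ∈ S, b * s * b⁻¹ ∈ S) : B ⊆ Subgroup.normalizer S := by
  intro b hb s
  refine ⟨h b hb s, fun hs => ?_⟩
  have hb' : b⁻¹ ∈ B := by rw [← hB]; simpa using hb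
  simpa [mul_assoc] using h _ hb' _ hs

/-- If `B` is symmetric and normalises `H`, and `B ^ 3` meets `Γ ≥ H` only inside `H * B`, then
`H * B ∩ Γ` is a subgroup normalised by `B`. -/
lemma exists_subgroup_coe_eq_mul_inter {G : Type*} [Group G] {B : Set G} (hB : B⁻¹ = B)
    (h1 : (1 : G) ∈ B) {H Γ : Subgroup G} (hHΓ : H ≤ Γ)
    (hBH : B ⊆ Subgroup.normalizer (H : Set G)) (hBΓ : B ⊆ Subgroup.normalizer (Γ : Set G))
    (hcube : ∀ b₁ ∈ B, ∀ b₂ ∈ B, ∀ b₃ ∈ B, b₁ * b₂ * b₃ ∈ Γ → b₁ * b₂ * b₃ ∈ (H : Set G) * B) :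
    ∃ S : Subgroup G, (S : Set G) = (H : Set G) * B ∩ Γ ∧
      B ⊆ Subgroup.normalizer (S : Set G) := by
  have hinv : ∀ b ∈ B, b⁻¹ ∈ B := fun b hb => by rw [← hB]; simpa using hb
  have hH : ∀ b ∈ B, ∀ k ∈ H, b * k * b⁻¹ ∈ H := fun b hb k hk => (hBH hb k).mp hk
  have hmul : ∀ k ∈ H, ∀ g ∈ (H : Set G) * B, k * g ∈ (H : Set G) * B := by
    rintro k hk _ ⟨k', hk', b, hb, rfl⟩
    exact ⟨k * k', H.mul_mem hk hk', b, hb, by simp [mul_assoc]⟩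
  have hΓ : ∀ k ∈ H, ∀ b, k * b ∈ Γ → b ∈ Γ := fun k hk b h =>
    (Subgroup.mul_mem_cancel_left Γ (hHΓ hk)).mp h
  let S : Subgroup G :=
    { carrier := (H : Set G) * B ∩ Γ
      one_mem' := ⟨⟨1, H.one_mem, 1, h1, by simp⟩, Γ.one_mem⟩
      mul_mem' := by
        rintro _ _ ⟨⟨k, hk, b, hb, rfl⟩, hg⟩ ⟨⟨k', hk', b', hb', rfl⟩, hg'⟩
        refine ⟨?_, Γ.mul_mem hg hg'⟩
        have h2 := hcube b hb b' hb' 1 h1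
          (by simpa using Γ.mul_mem (hΓ k hk b hg) (hΓ k' hk' b' hg'))
        have h3 := hmul _ (H.mul_mem hk (hH b hb k' hk')) _ h2
        convert h3 using 1
        group
      inv_mem' := by
        rintro _ ⟨⟨k, hk, b, hb, rfl⟩, hg⟩
        refine ⟨⟨b⁻¹ * k⁻¹ * b⁻¹⁻¹, hH _ (hinv b hb) _ (H.inv_mem hk), b⁻¹, hinv b hb, ?_⟩,
          Γ.inv_mem hg⟩
        simp }
  refine ⟨S, rfl, subset_normalizer_of_inv_eq hB ?_⟩
  rintro b hb _ ⟨⟨k, hk, b', hb', rfl⟩, hg⟩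
  have h2 := hcube b hb b' hb' _ (hinv b hb) ((hBΓ hb b').mp (hΓ k hk b' hg))
  refine ⟨?_, (hBΓ hb _).mp hg⟩
  have h3 := hmul _ (hH b hb k hk) _ h2
  convert h3 using 1
  simp only
  group

/-- Either `H * B` is a subgroup, or some `h ∈ B ^ 3` outside `H * B` is central modulo a subgroup
`Γ` such that `H * B ∩ Γ` is a subgroup. -/
lemma exists_subgroup_or_exists_central {G : Type*} [Group G] (hG : Group.IsNilpotent G)
    {B : Set G} (hB : B⁻¹ = B) (h1 : (1 : G) ∈ B) {H C : Subgroup G} (hHC : H ≤ C)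
    (hCH : C ≤ Subgroup.normalizer (H : Set G)) (hBC : B ⊆ C) :
    (∃ N : Subgroup G, (N : Set G) = (H : Set G) * B) ∨
    ∃ (S Γ : Subgroup G) (h : G), H ≤ S ∧ Γ ≤ C ∧ (S : Set G) = (H : Set G) * B ∩ Γ ∧
      B ⊆ Subgroup.normalizer (S : Set G) ∧ h ∈ B * B * B ∧ h ∉ (H : Set G) * B ∧
      ∀ c ∈ C, h⁻¹ * (c * h * c⁻¹) ∈ Γ := by
  obtain ⟨Γ, n, hΓ0, hΓn, hΓ⟩ := exists_central_series_of_le_normalizer hG hHC hCH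
  let P : ℕ → Prop := fun j => ∀ b₁ ∈ B, ∀ b₂ ∈ B, ∀ b₃ ∈ B, b₁ * b₂ * b₃ ∈ Γ j →
    b₁ * b₂ * b₃ ∈ (H : Set G) * B
  have hS : ∀ j, P j → ∃ S : Subgroup G, (S : Set G) = (H : Set G) * B ∩ Γ j ∧
      B ⊆ Subgroup.normalizer (S : Set G) := fun j hj =>
    exists_subgroup_coe_eq_mul_inter hB h1 (hΓ j).1 (hBC.trans hCH)
      (hBC.trans (hΓ j).2.2.1) hj
  by_cases h0 : P 0
  · obtain ⟨S, hS, -⟩ := hS 0 h0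
    refine Or.inl ⟨S, hS.trans (Set.inter_eq_left.mpr ?_)⟩
    rintro _ ⟨k, hk, b, hb, rfl⟩
    rw [hΓ0]
    exact C.mul_mem (hHC hk) (hBC hb)
  · right
    have hn : P n := fun b₁ _ b₂ _ b₃ _ h => ⟨_, hΓn ▸ h, 1, h1, by simp⟩
    obtain ⟨j, hj, hj1⟩ : ∃ j, ¬ P j ∧ P (j + 1) := by
      by_contra! hcon
      exact Nat.rec (motive := fun j => ¬ P j) h0 hcon n hn
    obtain ⟨S, hSeq, hBS⟩ := hS (j + 1) hj1
    simp only [P] at hj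
    push Not at hj
    obtain ⟨b₁, hb₁, b₂, hb₂, b₃, hb₃, hbΓ, hbn⟩ := hj
    refine ⟨S, Γ (j + 1), _, fun k hk => ?_, (hΓ (j + 1)).2.1, hSeq, hBS,
      Set.mul_mem_mul (Set.mul_mem_mul hb₁ hb₂) hb₃, hbn, (hΓ j).2.2.2 _ hbΓ⟩
    rw [← SetLike.mem_coe, hSeq]
    exact ⟨⟨k, hk, 1, h1, by simp⟩, (hΓ (j + 1)).1 hk⟩

/-- The cyclic subgroup generated by an element of order at most `r` in a symmetric set `A ^ m`
lies in `A ^ (m * s)` as soon as `r ≤ 2 * s + 1`. -/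
lemma zpowers_subset_pow_s3 {G : Type*} [Group G] {A : Set G} (hA : A⁻¹ = A) (h1 : (1 : G) ∈ A)
    {m r : ℕ} {h : G} (hh : h ∈ A ^ (2 * m)) (h0 : 0 < orderOf h) (hr : orderOf h ≤ r) :
    (Subgroup.zpowers h : Set G) ⊆ A ^ (m * r) := by
  have hinv : h⁻¹ ∈ A ^ (2 * m) := by
    rw [← hA, inv_pow]
    simpa using hh
  have hpow : ∀ g ∈ A ^ (2 * m), ∀ i, 2 * i ≤ r → g ^ i ∈ A ^ (m * r) := by
    intro g hg i hi
    have h2 : g ^ i ∈ A ^ (2 * m * i) := by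
      rw [pow_mul]
      exact Set.pow_mem_pow hg
    refine Set.pow_subset_pow_right h1 ?_ h2
    calc 2 * m * i = m * (2 * i) := by ring
      _ ≤ m * r := Nat.mul_le_mul_left _ hi
  intro g hg
  have hfin : IsOfFinOrder h := orderOf_pos_iff.mp h0
  classical
  obtain ⟨i, hi, rfl⟩ := Finset.mem_image.mp (hfin.mem_zpowers_iff_mem_range_orderOf.mp hg)
  rw [Finset.mem_range] at hi
  rcases le_total (2 * i) (orderOf h) with h2 | h2
  · exact hpow h hh i (h2.trans hr)
  · have h3 : h ^ i = h⁻¹ ^ (orderOf h - i) := by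
      rw [inv_pow, eq_inv_iff_mul_eq_one, ← pow_add, Nat.add_sub_cancel' hi.le,
        pow_orderOf_eq_one]
    simp only [h3]
    exact hpow _ hinv _ (by omega)

/-- The state after `k` steps of the construction: a normal section `C / H`, where `H` lies in
`A ^ (c * k)` and `A` is covered by few cosets of `C`, with `k` elements of `A ^ 6 ∩ H` whose
translates of `A` are disjoint. -/
structure SectionData {G : Type*} [Group G] (A : Set G) (c M k : ℕ) (H C : Subgroup G) :
    Prop where
  le : H ≤ C
  le_normalizer : C ≤ Subgroup.normalizer (H : Set G)
  subset_pow : (H : Set G) ⊆ A ^ (c * k)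
  cover : ∃ X : Set G, X.Finite ∧ X.ncard ≤ M ^ k ∧ A ⊆ X * (C : Set G)
  translates : ∃ T : Finset G, T.card = k ∧ (T : Set G) ⊆ A ^ 6 ∩ H ∧
    ∀ t ∈ T, ∀ t' ∈ T, t ≠ t' → ∀ a ∈ A, ∀ a' ∈ A, t * a ≠ t' * a'

namespace SectionData

variable {G : Type*} [Group G] {A : Set G} {c M k : ℕ} {H C : Subgroup G}

lemma card_mul_le (hfin : A.Finite) (hD : SectionData A c M k H C) :
    k * A.ncard ≤ (A ^ 7).ncard := by
  obtain ⟨T, rfl, hT, hdis⟩ := hD.translates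
  have hinj : Set.InjOn (fun p : G × G => p.1 * p.2) ((T : Set G) ×ˢ A) := by
    rintro ⟨t, a⟩ ⟨ht, ha⟩ ⟨t', a'⟩ ⟨ht', ha'⟩ h
    by_cases htt : t = t'
    · subst htt
      simpa using h
    · exact absurd h (hdis t ht t' ht' htt a ha a' ha')
  rw [← Set.ncard_coe_finset, ← Set.ncard_prod, ← hinj.ncard_image]
  refine Set.ncard_le_ncard ?_ (finite_pow_s3 hfin 7)
  rintro _ ⟨⟨t, a⟩, ⟨ht, ha⟩, rfl⟩
  rw [pow_succ]
  exact Set.mul_mem_mul (hT ht).1 ha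

lemma exists_subgroup_or_succ (hG : Group.IsNilpotent G) {r : ℕ}
    (hord : ∀ g : G, 0 < orderOf g ∧ orderOf g ≤ r) (hAinv : A⁻¹ = A)
    (h1 : (1 : G) ∈ A) {X : Set G} (hX : X.Finite) (hAX : A * A ⊆ X * A)
    (hD : SectionData A (3 * r + 2) (X.ncard ^ 9) k H C) :
    (∃ N : Subgroup G, (N : Set G) ⊆ A ^ ((3 * r + 2) * k + 2) ∧
      ∃ Y : Set G, Y.Finite ∧ Y.ncard ≤ (X.ncard ^ 9) ^ k ∧ A ⊆ Y * (N : Set G)) ∨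
    ∃ H' C' : Subgroup G, SectionData A (3 * r + 2) (X.ncard ^ 9) (k + 1) H' C' := by
  obtain ⟨Z, hZ, hZcard, hAZ⟩ := hD.cover
  obtain ⟨Y, hY, hYcard, hAY⟩ := exists_cover_inv_mul_inter hZ hAZ
  set B : Set G := A⁻¹ * A ∩ (C : Set G) with hBdef
  have hBA : B ⊆ A ^ 2 := by
    rw [hBdef, hAinv, pow_two]
    exact Set.inter_subset_left
  have hBC : B ⊆ C := Set.inter_subset_right
  have hBinv : B⁻¹ = B := by simp [hBdef, Set.inter_inv, mul_inv_rev]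
  have hB1 : (1 : G) ∈ B := ⟨⟨1, by simpa using h1, 1, h1, by simp⟩, C.one_mem⟩
  have hHB : (H : Set G) * B ⊆ A ^ ((3 * r + 2) * k + 2) := by
    rw [pow_add]
    exact Set.mul_subset_mul hD.subset_pow hBA
  rcases exists_subgroup_or_exists_central hG hBinv hB1 hD.le hD.le_normalizer hBC with
    ⟨N, hN⟩ | ⟨S, Γ, h, hHS, hΓC, hS, hBS, hh, hhn, hcent⟩
  · left
    refine ⟨N, hN ▸ hHB, Y, hY, hYcard.trans hZcard, hAY.trans (Set.mul_subset_mul_left ?_)⟩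
    rw [hN]
    exact fun b hb => ⟨1, H.one_mem, b, hb, by simp⟩
  right
  have hhC : h ∈ C := by
    obtain ⟨_, ⟨b₁, hb₁, b₂, hb₂, rfl⟩, b₃, hb₃, rfl⟩ := hh
    exact C.mul_mem (C.mul_mem (hBC hb₁) (hBC hb₂)) (hBC hb₃)
  have hhS : h ∈ Subgroup.normalizer (S : Set G) := by
    obtain ⟨_, ⟨b₁, hb₁, b₂, hb₂, rfl⟩, b₃, hb₃, rfl⟩ := hh
    exact Subgroup.mul_mem _ (Subgroup.mul_mem _ (hBS hb₁) (hBS hb₂)) (hBS hb₃)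
  have hhA : h ∈ A ^ 6 := by
    have : B * B * B ⊆ A ^ 2 * A ^ 2 * A ^ 2 :=
      Set.mul_subset_mul (Set.mul_subset_mul hBA hBA) hBA
    rw [← pow_add, ← pow_add] at this
    exact this hh
  have hBΓS : ∀ b ∈ B, b ∈ Γ → b ∈ S := fun b hb hbΓ => by
    rw [← SetLike.mem_coe, hS]
    exact ⟨⟨1, H.one_mem, b, hb, by simp⟩, hbΓ⟩
  have hSC : S ≤ C := fun s hs => by
    rw [← SetLike.mem_coe, hS] at hs
    exact hΓC hs.2
  set H' := S ⊔ Subgroup.zpowers h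
  set C' := C ⊓ Subgroup.normalizer (H' : Set G)
  have hzle : Subgroup.zpowers h ≤ Subgroup.normalizer (S : Set G) := by simpa using hhS
  have hSH' : S ≤ H' := le_sup_left
  have hhH' : h ∈ H' := Subgroup.mem_sup_right (Subgroup.mem_zpowers h)
  have hnorm : ∀ g ∈ Subgroup.normalizer (S : Set G), h⁻¹ * (g * h * g⁻¹) ∈ S →
      ∀ x ∈ H', g * x * g⁻¹ ∈ H' := by
    intro g hg hgS
    have : H' ≤ H'.comap (MulAut.conj g).toMonoidHom := by
      refine sup_le (fun s hs => ?_) ?_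
      · exact hSH' ((hg s).mp hs)
      · rw [Subgroup.zpowers_le]
        have := H'.mul_mem hhH' (hSH' hgS)
        simpa [mul_assoc] using this
    exact fun x hx => this hx
  have hcoset : ∀ b ∈ B, ∀ b' ∈ B,
      (b * h * b⁻¹)⁻¹ * (b' * h * b'⁻¹) ∈ S → b⁻¹ * b' ∈ C' := by
    intro b hb b' hb' hs
    have key : ∀ b ∈ B, ∀ b' ∈ B, (b * h * b⁻¹)⁻¹ * (b' * h * b'⁻¹) ∈ S →
        ∀ x ∈ H', (b⁻¹ * b') * x * (b⁻¹ * b')⁻¹ ∈ H' := by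
      intro b hb b' hb' hs
      refine hnorm _ (Subgroup.mul_mem _ (Subgroup.inv_mem _ (hBS hb)) (hBS hb')) ?_
      have := (Subgroup.mem_normalizer_iff.mp (Subgroup.inv_mem _ (hBS hb)) _).mp hs
      convert this using 1
      group
    refine ⟨C.mul_mem (C.inv_mem (hBC hb)) (hBC hb'), Subgroup.mem_normalizer_iff.mpr fun x =>
      ⟨key b hb b' hb' hs x, fun hx => ?_⟩⟩
    have hs' := S.inv_mem hs
    have := key b' hb' b hb (by convert hs' using 1; group) _ hx
    convert this using 1
    group
  have hBcover : ∃ W : Set G, W.Finite ∧ W.ncard ≤ X.ncard ^ 9 ∧ B ⊆ W * (C' : Set G) := by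
    have hA10 := pow_succ_subset_pow_mul hAX 9
    have hex : ∀ b : G, ∃ x, b ∈ B → x ∈ X ^ 9 ∧ x⁻¹ * (b * h * b⁻¹) ∈ A := by
      intro b
      by_cases hb : b ∈ B
      · have hb' : b⁻¹ ∈ B := by rw [← hBinv]; simpa using hb
        have hmem : b * h * b⁻¹ ∈ A ^ 10 := by
          have := Set.mul_mem_mul (Set.mul_mem_mul (hBA hb) hhA) (hBA hb')
          rwa [← pow_add, ← pow_add] at this
        obtain ⟨x, hx, a, ha, hxa⟩ := hA10 hmem
        refine ⟨x, fun _ => ⟨hx, ?_⟩⟩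
        rw [← hxa]
        simpa using ha
      · exact ⟨1, fun h => absurd h hb⟩
    choose f hf using hex
    obtain ⟨W, hW, hWcard, hBW⟩ := exists_cover_of_classes_s3 (D := (C' : Set G)) (X := X ^ 9)
      (finite_pow_s3 hX 9) f (fun b hb => (hf b hb).1) (fun b hb b' hb' hbb' => by
        have hu : ∀ b ∈ B, b * h * b⁻¹ ∈ C := fun b hb =>
          C.mul_mem (C.mul_mem (hBC hb) hhC) (C.inv_mem (hBC hb))
        refine hcoset b hb b' hb' (hBΓS _ ⟨?_, C.mul_mem (C.inv_mem (hu b hb)) (hu b' hb')⟩ ?_)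
        · refine ⟨_, Set.inv_mem_inv.mpr (hf b hb).2, _, (hf b' hb').2, ?_⟩
          simp only [hbb']
          group
        · have := Γ.mul_mem (Γ.inv_mem (hcent b (hBC hb))) (hcent b' (hBC hb'))
          convert this using 1
          group)
    exact ⟨W, hW, hWcard.trans (ncard_pow_le_pow_ncard X 9), hBW⟩
  obtain ⟨W, hW, hWcard, hBW⟩ := hBcover
  refine ⟨H', C', ⟨?_, inf_le_right, ?_, ⟨Y * W, hY.mul hW, ?_, ?_⟩, ?_⟩⟩
  · exact le_inf (sup_le hSC (by simpa using hhC)) Subgroup.le_normalizer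
  · have hHpow : (H' : Set G) = S * (Subgroup.zpowers h : Set G) :=
      Subgroup.coe_mul_of_right_le_normalizer_left _ _ hzle
    have hz := zpowers_subset_pow_s3 (m := 3) hAinv h1 hhA (hord h).1 (hord h).2
    have hSA : (S : Set G) ⊆ A ^ ((3 * r + 2) * k + 2) := by
      rw [hS]
      exact Set.inter_subset_left.trans hHB
    rw [hHpow, show (3 * r + 2) * (k + 1) = (3 * r + 2) * k + 2 + 3 * r by ring, pow_add]
    exact Set.mul_subset_mul hSA hz
  · rw [pow_succ]
    exact (ncard_mul_le_mul_ncard _ _).trans (Nat.mul_le_mul (hYcard.trans hZcard) hWcard)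
  · rw [mul_assoc]
    exact hAY.trans (Set.mul_subset_mul_left hBW)
  · obtain ⟨T, hTk, hT, hdis⟩ := hD.translates
    have hnew : ∀ t ∈ T, ∀ a ∈ A, ∀ a' ∈ A, h * a ≠ t * a' := by
      intro t ht a ha a' ha' heq
      have hta : t⁻¹ * h = a' * a⁻¹ := by
        rw [inv_mul_eq_iff_eq_mul, ← mul_assoc, ← heq, mul_inv_cancel_right]
      refine hhn ⟨t, (hT ht).2, t⁻¹ * h, ⟨⟨a', ?_, a⁻¹, ?_, hta.symm⟩,
        C.mul_mem (C.inv_mem (hD.le (hT ht).2)) hhC⟩, by simp⟩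
      · rwa [hAinv]
      · rw [← hAinv]
        simpa using ha
    have hhT : h ∉ T := fun hhT => hnew h hhT 1 h1 1 h1 rfl
    refine ⟨T.cons h hhT, by simp [hTk], ?_, ?_⟩
    · intro t ht
      rcases Finset.mem_cons.mp ht with rfl | ht
      · exact ⟨hhA, hhH'⟩
      · exact ⟨(hT ht).1, hSH' (hHS (hT ht).2)⟩
    · intro t hth t' hth' hne a ha a' ha'
      rcases Finset.mem_cons.mp hth with rfl | ht <;>
        rcases Finset.mem_cons.mp hth' with rfl | ht'
      · exact absurd rfl hne
      · exact hnew t' ht' a ha a' ha'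
      · exact (hnew t ht a' ha' a ha).symm
      · exact hdis t ht t' ht' hne a ha a' ha'

end SectionData

theorem statement_3 {G : Type*} [Group G] (hG : Group.IsNilpotent G)
    (r : ℕ) (hr : 1 ≤ r) (hord : ∀ g : G, 0 < orderOf g ∧ orderOf g ≤ r)
    (K : ℝ) (hK : 1 ≤ K) (A : Set G) (hA : IsKApproximateSubgroup K A) :
    ∃ N : Subgroup G, (N : Set G) ⊆ A ^ (⌈((3 * r + 2 : ℕ) : ℝ) * K ^ 6⌉₊ + 2) ∧
      ∃ X : Set G, X.Finite ∧ (X.ncard : ℝ) ≤ K ^ ((35 : ℝ) * K ^ 6 + 2) ∧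
        A ⊆ X * (N : Set G) := by
  obtain ⟨hfin, hAinv, h1, X, hX, hXK, hAX⟩ := hA
  have hApos : 0 < A.ncard := (Set.ncard_pos hfin).mpr ⟨1, h1⟩
  have hbound : ∀ {k : ℕ} {H C : Subgroup G},
      SectionData A (3 * r + 2) (X.ncard ^ 9) k H C → k ≤ X.ncard ^ 6 := by
    intro k H C hD
    refine Nat.le_of_mul_le_mul_right ((hD.card_mul_le hfin).trans ?_) hApos
    calc (A ^ 7).ncard ≤ (X ^ 6 * A).ncard :=
          Set.ncard_le_ncard (pow_succ_subset_pow_mul hAX 6) ((finite_pow_s3 hX 6).mul hfin)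
      _ ≤ (X ^ 6).ncard * A.ncard := ncard_mul_le_mul_ncard _ _
      _ ≤ X.ncard ^ 6 * A.ncard := Nat.mul_le_mul_right _ (ncard_pow_le_pow_ncard X 6)
  obtain ⟨k, H, C, hD, hmax⟩ : ∃ (k : ℕ) (H C : Subgroup G),
      SectionData A (3 * r + 2) (X.ncard ^ 9) k H C ∧
        ¬ ∃ H' C' : Subgroup G, SectionData A (3 * r + 2) (X.ncard ^ 9) (k + 1) H' C' := by
    by_contra! hcon
    have hall : ∀ k, ∃ H C : Subgroup G, SectionData A (3 * r + 2) (X.ncard ^ 9) k H C := by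
      intro k
      induction k with
      | zero =>
        refine ⟨⊥, ⊤, ⟨bot_le, Subgroup.le_normalizer_of_normal, by simp,
          ⟨{1}, Set.finite_singleton 1, by simp, by simp⟩, ∅, by simp⟩⟩
      | succ k ih =>
        obtain ⟨H, C, hD⟩ := ih
        exact hcon k H C hD
    obtain ⟨H, C, hD⟩ := hall (X.ncard ^ 6 + 1)
    exact Nat.not_succ_le_self _ (hbound hD)
  obtain ⟨N, hN, Y, hY, hYcard, hAY⟩ :=
    (hD.exists_subgroup_or_succ hG hord hAinv h1 hX hAX).resolve_right hmax
  have hkK : (k : ℝ) ≤ K ^ 6 :=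
    calc (k : ℝ) ≤ (X.ncard : ℝ) ^ 6 := by exact_mod_cast hbound hD
      _ ≤ K ^ 6 := by gcongr
  refine ⟨N, hN.trans (Set.pow_subset_pow_right h1 (Nat.add_le_add_right ?_ 2)),
    Y, hY, ?_, hAY⟩
  · rw [← Nat.cast_le (α := ℝ)]
    refine le_trans ?_ (Nat.le_ceil _)
    push_cast
    gcongr
  · calc (Y.ncard : ℝ) ≤ ((X.ncard : ℝ) ^ 9) ^ k := by exact_mod_cast hYcard
      _ ≤ (K ^ 9) ^ k := by gcongr
      _ = K ^ ((9 : ℝ) * k) := by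
        rw [← pow_mul, ← Real.rpow_natCast]
        push_cast
        rfl
      _ ≤ K ^ ((35 : ℝ) * K ^ 6 + 2) := by
        refine Real.rpow_le_rpow_of_exponent_le hK ?_
        have : 0 ≤ K ^ 6 := by positivity
        linarith
end

section
/- Let G be a group with a subgroup H, let K ≥ 1, and let A be a K-approximate subgroup of G. Then for every integer m ≥ 2: (1) A^m ∩ H can be covered by at most K^{m-1} left translates of A^2 ∩ H; (2) A^m ∩ H is a K^{2m-1}-approximate subgroup of G. -/
open Pointwise

/-- A finite symmetric subset `A` (with `1 ∈ A`) of a group `G` is a `K`-approximate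
subgroup if there is a set `X ⊆ G` with `|X| ≤ K` and `A·A ⊆ X·A`. -/
def IsFiniteApproximateSubgroup {G : Type*} [Group G] (K : ℝ) (A : Set G) : Prop :=
  A.Finite ∧ A⁻¹ = A ∧ (1 : G) ∈ A ∧
    ∃ X : Set G, X.Finite ∧ (X.ncard : ℝ) ≤ K ∧ A * A ⊆ X * A

theorem IsFiniteApproximateSubgroup.isApproximateSubgroup {G : Type*} [Group G] {K : ℝ}
    {A : Set G} (hA : IsFiniteApproximateSubgroup K A) : IsApproximateSubgroup K A := by
  obtain ⟨-, hinv, hone, X, hX, hXK, hsub⟩ := hA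
  refine ⟨hone, hinv, hX.toFinset, ?_, ?_⟩
  · rwa [← Set.ncard_eq_toFinset_card X hX]
  · simpa [sq] using hsub

theorem IsApproximateSubgroup.isFiniteApproximateSubgroup {G : Type*} [Group G] {K : ℝ}
    {A : Set G} (hA : IsApproximateSubgroup K A) (hfin : A.Finite) :
    IsFiniteApproximateSubgroup K A := by
  obtain ⟨hone, hinv, F, hF, hsub⟩ := hA
  refine ⟨hfin, hinv, hone, F, F.finite_toSet, ?_, ?_⟩
  · rwa [Set.ncard_coe_finset]
  · simpa [sq] using hsub

theorem Set.Finite.pow {M : Type*} [Monoid M] {s : Set M} (hs : s.Finite) (n : ℕ) :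
    (s ^ n).Finite := by
  induction n with
  | zero => simp
  | succ n ih => rw [pow_succ]; exact ih.mul hs

theorem statement_6 {G : Type*} [Group G] (H : Subgroup G) (K : ℝ) (hK : 1 ≤ K)
    (A : Set G) (hA : IsFiniteApproximateSubgroup K A) (m : ℕ) (hm : 2 ≤ m) :
    (∃ T : Set G, T.Finite ∧ (T.ncard : ℝ) ≤ K ^ (m - 1) ∧
      A ^ m ∩ (H : Set G) ⊆ T * (A ^ 2 ∩ (H : Set G))) ∧
    IsFiniteApproximateSubgroup (K ^ (2 * m - 1)) (A ^ m ∩ (H : Set G)) := by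
  have hA' := hA.isApproximateSubgroup
  have hH : IsApproximateSubgroup 1 (H : Set G) := .subgroup
  have hsq : (H : Set G) ^ 2 = H := by simp [sq]
  constructor
  · obtain ⟨F, hF, hsub⟩ := hA'.pow_inter_pow_covBySMul_sq_inter_sq hH hm le_rfl
    refine ⟨F, F.finite_toSet, ?_, ?_⟩
    · simpa [Set.ncard_coe_finset] using hF
    · simpa [hsq] using hsub
  · have h := hA'.pow_inter_pow hH hm le_rfl
    rw [hsq, one_pow, mul_one] at h
    exact h.isFiniteApproximateSubgroup ((hA.1.pow m).inter_of_left _)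
end

section
/- Let G be a group, let K, K' ≥ 1, let A be a K-approximate subgroup of G, and let H be a subgroup of G such that |A^2 ∩ H| ≥ |A|/K'. Then the number of distinct left cosets of H meeting A is at most K'·K^2. -/
open Pointwise

/-- A set meeting `N` left cosets of `H`, multiplied by a subset `B` of `H`, has at least
`N * |B|` elements. -/
lemma ncard_image_mk_mul_ncard_le {G : Type*} [Group G] {H : Subgroup G} {A B : Set G}
    (hA : A.Finite) (hB : B.Finite) (hBH : B ⊆ H) :
    ((QuotientGroup.mk : G → G ⧸ H) '' A).ncard * B.ncard ≤ (A * B).ncard := by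
  have hrep : ∀ q ∈ (QuotientGroup.mk : G → G ⧸ H) '' A, ∃ a ∈ A, (a : G ⧸ H) = q :=
    fun _ hq => hq
  choose! r hrA hr using hrep
  rw [← Set.ncard_prod]
  refine Set.ncard_le_ncard_of_injOn (fun p => r p.1 * p.2) ?_ ?_ (hA.mul hB)
  · rintro ⟨q, b⟩ ⟨hq, hb⟩
    exact Set.mul_mem_mul (hrA q hq) hb
  · rintro ⟨q, b⟩ ⟨hq, hb⟩ ⟨q', b'⟩ ⟨hq', hb'⟩ heq
    simp only at hq hb hq' hb' heq
    have hqq : q = q' := by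
      rw [← hr q hq, ← hr q' hq', ← QuotientGroup.mk_mul_of_mem (r q) (hBH hb), heq,
        QuotientGroup.mk_mul_of_mem (r q') (hBH hb')]
    subst hqq
    rw [mul_left_cancel heq]

lemma IsKApproximateSubgroup.ncard_mul_sq_le {G : Type*} [Group G] {K : ℝ} {A : Set G}
    (hA : IsKApproximateSubgroup K A) : ((A * A ^ 2).ncard : ℝ) ≤ K ^ 2 * A.ncard := by
  obtain ⟨hfin, -, -, X, hX, hXK, hAX⟩ := hA
  have hsub : A * A ^ 2 ⊆ X * (X * A) := by
    calc A * A ^ 2 = A * A * A := by rw [sq, mul_assoc]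
      _ ⊆ X * A * A := Set.mul_subset_mul_right hAX
      _ = X * (A * A) := mul_assoc _ _ _
      _ ⊆ X * (X * A) := Set.mul_subset_mul_left hAX
  have hcard : (A * A ^ 2).ncard ≤ X.ncard * (X.ncard * A.ncard) :=
    calc (A * A ^ 2).ncard ≤ (X * (X * A)).ncard :=
          Set.ncard_le_ncard hsub (hX.mul (hX.mul hfin))
      _ ≤ X.ncard * (X * A).ncard := by
          simpa only [Nat.card_coe_set_eq] using Set.natCard_mul_le
      _ ≤ X.ncard * (X.ncard * A.ncard) := by
          gcongr
          simpa only [Nat.card_coe_set_eq] using Set.natCard_mul_le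
  calc ((A * A ^ 2).ncard : ℝ) ≤ (X.ncard : ℝ) * (X.ncard * A.ncard) := by exact_mod_cast hcard
    _ = (X.ncard : ℝ) ^ 2 * A.ncard := by ring
    _ ≤ K ^ 2 * A.ncard := by gcongr

theorem statement_8 {G : Type*} [Group G] (K K' : ℝ) (hK : 1 ≤ K) (hK' : 1 ≤ K')
    (A : Set G) (hA : IsKApproximateSubgroup K A) (H : Subgroup G)
    (h : (A.ncard : ℝ) / K' ≤ ((A ^ 2 ∩ (H : Set G)).ncard : ℝ)) :
    ((((QuotientGroup.mk : G → G ⧸ H) '' A).ncard : ℝ)) ≤ K' * K ^ 2 := by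
  have hfin : A.Finite := hA.1
  have hfin2 : (A ^ 2).Finite := by rw [sq]; exact hfin.mul hfin
  have hpos : (0 : ℝ) < A.ncard := by
    exact_mod_cast (Set.ncard_pos hfin).2 ⟨1, hA.2.2.1⟩
  have hK'pos : 0 < K' := by linarith
  set N := ((QuotientGroup.mk : G → G ⧸ H) '' A).ncard
  have hlower : (N : ℝ) * (A ^ 2 ∩ (H : Set G)).ncard ≤ (A * A ^ 2).ncard := by
    exact_mod_cast (ncard_image_mk_mul_ncard_le hfin (hfin2.inter_of_left _)
      Set.inter_subset_right).trans (Set.ncard_le_ncard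
        (Set.mul_subset_mul_left Set.inter_subset_left) (hfin.mul hfin2))
  have hN : (N : ℝ) * (A.ncard / K') ≤ K ^ 2 * A.ncard :=
    (mul_le_mul_of_nonneg_left h N.cast_nonneg).trans (hlower.trans hA.ncard_mul_sq_le)
  rw [← mul_div_assoc, div_le_iff₀ hK'pos] at hN
  refine le_of_mul_le_mul_right ?_ hpos
  linarith
end

section
/- Let K ≥ 1, let A be a K-approximate subgroup of a group G, and let Z_j, Z_{j+1} be subgroups of G with [G, Z_j] ⊆ Z_{j+1} and A^2 ∩ Z_{j+1} = {1}. Let m be a positive integer and let ω ∈ A^m ∩ Z_j. Then |A^2 ∩ C_G(ω)| ≥ |A| / K^{2m+2}, where C_G(ω) is the centraliser of ω in G. -/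
open Pointwise

/-- If `A * A ⊆ X * A`, then powers of `A` are covered by translates of `A` by powers of `X`. -/
theorem Set.pow_succ_subset_pow_mul_of_mul_subset {M : Type*} [Monoid M] {A X : Set M}
    (h : A * A ⊆ X * A) (n : ℕ) : A ^ (n + 1) ⊆ X ^ n * A := by
  induction n with
  | zero => simp
  | succ n ih =>
    calc A ^ (n + 1 + 1) = A ^ (n + 1) * A := pow_succ _ _
      _ ⊆ X ^ n * A * A := Set.mul_subset_mul_right ih
      _ = X ^ n * (A * A) := mul_assoc _ _ _
      _ ⊆ X ^ n * (X * A) := Set.mul_subset_mul_left h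
      _ = X ^ (n + 1) * A := by rw [pow_succ, mul_assoc]

/-- Conjugates `a⁻¹ * ω * a` and `b⁻¹ * ω * b` of `ω ∈ H` differ by an element of `⁅⊤, H⁆`. -/
theorem Subgroup.inv_conj_mul_conj_mem_commutator {G : Type*} [Group G] {H : Subgroup G} {ω : G}
    (hω : ω ∈ H) (a b : G) :
    (a⁻¹ * ω * a)⁻¹ * (b⁻¹ * ω * b) ∈ ⁅(⊤ : Subgroup G), H⁆ := by
  have key (g : G) : ω⁻¹ * (g⁻¹ * ω * g) ∈ ⁅(⊤ : Subgroup G), H⁆ := by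
    have := inv_mem (Subgroup.commutator_mem_commutator (Subgroup.mem_top g⁻¹) (inv_mem hω))
    convert this using 1
    simp only [commutatorElement_def]
    group
  convert mul_mem (inv_mem (key a)) (key b) using 1
  group

theorem statement_10 {G : Type*} [Group G] (K : ℝ) (hK : 1 ≤ K) (A : Set G)
    (hA : IsKApproximateSubgroup K A) (Zj Zj1 : Subgroup G)
    (hcomm : ⁅(⊤ : Subgroup G), Zj⁆ ≤ Zj1)
    (hint : A ^ 2 ∩ (Zj1 : Set G) = {1}) (m : ℕ) (hm : 0 < m)
    (ω : G) (hω : ω ∈ A ^ m ∩ (Zj : Set G)) :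
    (A.ncard : ℝ) / K ^ (2 * m + 2) ≤
      ((A ^ 2 ∩ (Subgroup.centralizer {ω} : Set G)).ncard : ℝ) := by
  classical
  obtain ⟨hfin, hsymm, -, X, hXfin, hXK, hAX⟩ := hA
  lift A to Finset G using hfin
  lift X to Finset G using hXfin
  have hinv {a : G} (ha : a ∈ (A : Set G)) : a⁻¹ ∈ (A : Set G) := by
    rw [← hsymm]
    simpa using ha
  have hcover (a : G) (ha : a ∈ A) :
      ∃ x ∈ X ^ (m + 1), ∃ y ∈ A, x * y = a⁻¹ * ω * a := by
    have hmem : a⁻¹ * ω * a ∈ (A : Set G) ^ (m + 1 + 1) := by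
      rw [pow_succ, pow_succ']
      exact Set.mul_mem_mul (Set.mul_mem_mul (hinv ha) hω.1) ha
    obtain ⟨x, hx, y, hy, hxy⟩ := Set.pow_succ_subset_pow_mul_of_mul_subset hAX (m + 1) hmem
    exact ⟨x, by exact_mod_cast hx, y, hy, hxy⟩
  choose! x hx y hy hxy using hcover
  have hconj {a b : G} (ha : a ∈ A) (hb : b ∈ A) (hab : x a = x b) :
      a⁻¹ * ω * a = b⁻¹ * ω * b := by
    have hquot : (a⁻¹ * ω * a)⁻¹ * (b⁻¹ * ω * b) = (y a)⁻¹ * y b := by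
      rw [← hxy a ha, ← hxy b hb, hab]
      group
    have h1 : (a⁻¹ * ω * a)⁻¹ * (b⁻¹ * ω * b) ∈ (A : Set G) ^ 2 ∩ (Zj1 : Set G) := by
      refine ⟨?_, hcomm (Subgroup.inv_conj_mul_conj_mem_commutator hω.2 a b)⟩
      rw [hquot, pow_two]
      exact Set.mul_mem_mul (hinv (hy a ha)) (hy b hb)
    rw [hint] at h1
    exact inv_mul_eq_one.mp h1
  set C : Set G := (A : Set G) ^ 2 ∩ (Subgroup.centralizer {ω} : Set G)
  have hCfin : C.Finite := by
    refine Set.Finite.subset (A ^ 2).finite_toSet ?_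
    rw [Finset.coe_pow]
    exact Set.inter_subset_left
  have hfiber : ∀ z ∈ X ^ (m + 1), (A.filter (x · = z)).card ≤ C.ncard := by
    intro z _
    obtain hempty | ⟨b, hb⟩ := (A.filter (x · = z)).eq_empty_or_nonempty
    · simp [hempty]
    rw [Finset.mem_filter] at hb
    rw [← Set.ncard_coe_finset]
    refine Set.ncard_le_ncard_of_injOn (· * b⁻¹) ?_ (mul_left_injective b⁻¹).injOn hCfin
    intro a ha
    rw [Finset.mem_coe, Finset.mem_filter] at ha
    refine ⟨?_, ?_⟩
    · rw [pow_two]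
      exact Set.mul_mem_mul ha.1 (hinv hb.1)
    · rw [SetLike.mem_coe, Subgroup.mem_centralizer_singleton_iff]
      have h := hconj ha.1 hb.1 (ha.2.trans hb.2.symm)
      calc a * b⁻¹ * ω = a * (b⁻¹ * ω * b) * b⁻¹ := by group
        _ = ω * (a * b⁻¹) := by rw [← h]; group
  have hcard : A.card ≤ C.ncard * X.card ^ (m + 1) :=
    (Finset.card_le_mul_card_image_of_maps_to hx _ hfiber).trans
      (Nat.mul_le_mul_left _ Finset.card_pow_le)
  rw [Set.ncard_coe_finset] at hXK ⊢
  rw [div_le_iff₀ (by positivity)]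
  calc (A.card : ℝ) ≤ C.ncard * (X.card : ℝ) ^ (m + 1) := by exact_mod_cast hcard
    _ ≤ C.ncard * K ^ (m + 1) := by gcongr
    _ ≤ C.ncard * K ^ (2 * m + 2) := by gcongr <;> omega
end

section
/- Let K ≥ 1, let G be a nilpotent group, and let A be a K-approximate subgroup of G. Then there exist an integer k ≤ K^6, subgroups D_{k+1} ⊇ D_k ⊇ … ⊇ D_1 of G, subgroups C_0 ⊇ C_1 ⊇ … ⊇ C_k of G with C_0 = ⟨A⟩, and elements γ_1,…,γ_k ∈ G such that each γ_i normalises D_i and, writing H_0 = {1} and H_i = ⟨γ_i⟩·D_i for i = 1,…,k, the following hold for all i = 1,…,k: (1) D_i is normal in C_{i-1}; (2) the image of γ_i is central in C_i/D_i (in particular H_i is normal in C_i); (3) H_{i-1} ⊆ D_i; (4) D_i ⊆ A^2·H_{i-1}; (5) C_i = ⟨A^2 ∩ C_i⟩·H_i; (6) γ_i ∈ A^6 and γ_i ∉ A^2·H_{i-1}; (7) |A^2 ∩ C_i| ≥ K^{-35i}·|A|; and moreover (8) C_k = D_{k+1}. -/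
open Pointwise

namespace NilpotentApproximateSubgroup

/-- The subgroup `C` normalises the subgroup `D`, elementwise. -/
def Normalizes {G : Type*} [Group G] (C D : Subgroup G) : Prop :=
  ∀ c ∈ C, ∀ d ∈ D, c * d * c⁻¹ ∈ D

section Group

variable {G : Type*} [Group G]

lemma Normalizes.le_normalizer {C D : Subgroup G} (h : Normalizes C D) :
    C ≤ Subgroup.normalizer (D : Set G) := by
  intro c hc
  rw [Subgroup.mem_normalizer_iff]
  refine fun d => ⟨h c hc d, fun hd => ?_⟩
  have := h c⁻¹ (inv_mem hc) _ hd
  simpa [mul_assoc] using this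

lemma normalizes_of_le_normalizer {C D : Subgroup G}
    (h : C ≤ Subgroup.normalizer (D : Set G)) : Normalizes C D :=
  fun _ hc d => (Subgroup.mem_normalizer_iff.1 (h hc) d).1

lemma Normalizes.conj_inv {C D : Subgroup G} (h : Normalizes C D) {c d : G}
    (hc : c ∈ C) (hd : d ∈ D) : c⁻¹ * d * c ∈ D := by
  simpa using h c⁻¹ (inv_mem hc) d hd

lemma Normalizes.mono {B C D : Subgroup G} (h : Normalizes C D) (hB : B ≤ C) :
    Normalizes B D := fun c hc => h c (hB hc)

lemma Normalizes.coe_sup {C D : Subgroup G} (h : Normalizes C D) :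
    ((C ⊔ D : Subgroup G) : Set G) = C * D :=
  Subgroup.coe_mul_of_left_le_normalizer_right C D h.le_normalizer

lemma normalizes_closure {S : Set G} (hS : S⁻¹ = S) {D : Subgroup G}
    (h : ∀ s ∈ S, ∀ d ∈ D, s * d * s⁻¹ ∈ D) : Normalizes (Subgroup.closure S) D := by
  apply normalizes_of_le_normalizer
  rw [Subgroup.closure_le]
  intro s hs
  rw [SetLike.mem_coe, Subgroup.mem_normalizer_iff]
  refine fun d => ⟨h s hs d, fun hd => ?_⟩
  have hs' : s⁻¹ ∈ S := by rw [← hS]; simpa using hs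
  have := h s⁻¹ hs' _ hd
  simpa [mul_assoc] using this

lemma Normalizes.sup_left {B C D : Subgroup G} (hB : Normalizes B D) (hC : Normalizes C D) :
    Normalizes (B ⊔ C) D :=
  normalizes_of_le_normalizer (sup_le hB.le_normalizer hC.le_normalizer)

/-- The elements of `C` commuting with `γ` modulo `D`. -/
def centralizerMod (C D : Subgroup G) (h : Normalizes C D) (γ : G) : Subgroup G where
  carrier := {c | c ∈ C ∧ γ⁻¹ * c⁻¹ * γ * c ∈ D}
  one_mem' := ⟨one_mem C, by simp [one_mem]⟩
  mul_mem' := by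
    rintro a b ⟨ha, ha'⟩ ⟨hb, hb'⟩
    refine ⟨mul_mem ha hb, ?_⟩
    have := mul_mem hb' (h.conj_inv hb ha')
    convert this using 1
    group
  inv_mem' := by
    rintro a ⟨ha, ha'⟩
    refine ⟨inv_mem ha, ?_⟩
    have := h a ha _ (inv_mem ha')
    convert this using 1
    group

lemma mem_centralizerMod {C D : Subgroup G} {h : Normalizes C D} {γ c : G} :
    c ∈ centralizerMod C D h γ ↔ c ∈ C ∧ γ⁻¹ * c⁻¹ * γ * c ∈ D := Iff.rfl

/-- The lower central series of the ambient group, enlarged by a subgroup `D`. -/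
def lowerSeries (D : Subgroup G) (n : ℕ) : Subgroup G :=
  (⊤ : Subgroup G).lowerCentralSeries n ⊔ D

lemma commutator_mem_lowerSeries_succ {C D : Subgroup G} (h : Normalizes C D) (n : ℕ)
    {z c : G} (hz : z ∈ lowerSeries D n) (hc : c ∈ C) :
    z⁻¹ * c⁻¹ * z * c ∈ lowerSeries D (n + 1) := by
  obtain ⟨x, hx, d, hd, rfl⟩ := Subgroup.mem_sup_of_normal_left.1 hz
  have h1 : x⁻¹ * c⁻¹ * x * c ∈ (⊤ : Subgroup G).lowerCentralSeries (n + 1) := by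
    rw [Subgroup.lowerCentralSeries_succ]
    have := Subgroup.commutator_mem_commutator (inv_mem hx) (Subgroup.mem_top c⁻¹)
    simpa [commutatorElement_def] using this
  have h2 := mul_mem (mul_mem (Subgroup.mem_sup_right (inv_mem hd)) (Subgroup.mem_sup_left h1))
    (Subgroup.mem_sup_right (h.conj_inv hc hd) :
      _ ∈ (⊤ : Subgroup G).lowerCentralSeries (n + 1) ⊔ D)
  rw [lowerSeries]
  convert h2 using 1
  simp only [mul_inv_rev, mul_assoc, mul_inv_cancel_left]

lemma lowerSeries_antitone (D : Subgroup G) : Antitone (lowerSeries D) := fun _ _ hmn =>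
  sup_le_sup_right ((⊤ : Subgroup G).lowerCentralSeries_antitone hmn) D

lemma normalizes_lowerSeries {C D : Subgroup G} (h : Normalizes C D) (n : ℕ) :
    Normalizes C (lowerSeries D n) := by
  intro c hc z hz
  have h1 := commutator_mem_lowerSeries_succ h n hz (inv_mem hc)
  have h2 := mul_mem hz (lowerSeries_antitone D n.le_succ h1)
  convert h2 using 1
  group

section SymmetricSet

variable {A : Set G}

lemma inv_mem_pow (hinv : A⁻¹ = A) {n : ℕ} {a : G} (ha : a ∈ A ^ n) : a⁻¹ ∈ A ^ n := by
  rw [← hinv, inv_pow]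
  simpa using ha

lemma mul_mem_pow {m n : ℕ} {a b : G} (ha : a ∈ A ^ m) (hb : b ∈ A ^ n) :
    a * b ∈ A ^ (m + n) := by
  rw [pow_add]
  exact Set.mul_mem_mul ha hb

lemma finite_pow (hfin : A.Finite) (n : ℕ) : (A ^ n).Finite := by
  induction n with
  | zero => simp
  | succ n ih => exact pow_succ A n ▸ ih.mul hfin

variable (A) in
/-- A subgroup generated modulo a normal subgroup by its intersection with `A ^ 2`. -/
structure NormalPair where
  /-- The larger subgroup. -/
  C : Subgroup G
  /-- The normal subgroup. -/
  H : Subgroup G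
  H_le : H ≤ C
  normalizes : Normalizes C H
  C_eq : C = Subgroup.closure (A ^ 2 ∩ (C : Set G)) ⊔ H

/-- Subgroups normal in `p.C` lying between `p.H` and `A ^ 2 * p.H`. -/
structure NormalPair.IsSmall (p : NormalPair A) (D : Subgroup G) : Prop where
  H_le : p.H ≤ D
  le_C : D ≤ p.C
  normalizes : Normalizes p.C D
  subset : (D : Set G) ⊆ A ^ 2 * (p.H : Set G)

lemma NormalPair.isSmall_H (p : NormalPair A) (h1 : (1 : G) ∈ A) : p.IsSmall p.H :=
  ⟨le_rfl, p.H_le, p.normalizes, fun h hh => ⟨1, Set.one_mem_pow h1, h, hh, one_mul h⟩⟩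

lemma NormalPair.exists_maximal (p : NormalPair A) (hfin : A.Finite) (h1 : (1 : G) ∈ A) :
    ∃ D, Maximal p.IsSmall D := by
  have hf : {D | p.IsSmall D}.Finite := by
    refine Set.Finite.of_injOn (f := fun D : Subgroup G => A ^ 2 ∩ (D : Set G))
      (t := 𝒫 (A ^ 2)) (fun D _ => Set.inter_subset_left) ?_ (finite_pow hfin 2).finite_subsets
    have key : ∀ D E : Subgroup G, p.IsSmall D → p.IsSmall E →
        A ^ 2 ∩ (D : Set G) = A ^ 2 ∩ (E : Set G) → D ≤ E := by
      intro D E hD hE hDE x hx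
      obtain ⟨a, ha, h, hh, rfl⟩ := hD.subset hx
      have haD : a ∈ D := by
        simpa using mul_mem hx (inv_mem (hD.H_le hh))
      have haE : a ∈ A ^ 2 ∩ (E : Set G) := hDE ▸ ⟨ha, haD⟩
      exact mul_mem haE.2 (hE.H_le hh)
    exact fun D hD E hE hDE => le_antisymm (key D E hD hE hDE) (key E D hE hD hDE.symm)
  exact hf.exists_maximal ⟨p.H, p.isSmall_H h1⟩

/-- If `A ^ 6 ∩ W` lies in `A ^ 2 * p.H`, it lies in any maximal small subgroup `D ≤ W`. -/
lemma NormalPair.mem_of_maximal (p : NormalPair A) (hinv : A⁻¹ = A) (h1 : (1 : G) ∈ A)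
    {D W : Subgroup G} (hD : Maximal p.IsSmall D) (hDW : D ≤ W) (hWC : W ≤ p.C)
    (hW : Normalizes p.C W)
    (hsub : ∀ x ∈ A ^ 6, x ∈ W → x ∈ A ^ 2 * (p.H : Set G)) {x : G} (hx : x ∈ A ^ 6)
    (hxW : x ∈ W) : x ∈ D := by
  have hHW : p.H ≤ W := hD.prop.H_le.trans hDW
  have hmul : ∀ y ∈ A ^ 6, y ∈ W → ∀ h ∈ p.H, y * h ∈ A ^ 2 * (p.H : Set G) := by
    intro y hy hyW h hh
    obtain ⟨a, ha, k, hk, rfl⟩ := hsub y hy hyW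
    exact ⟨a, ha, k * h, mul_mem hk hh, (mul_assoc _ _ _).symm⟩
  have h26 : A ^ 2 ⊆ A ^ 6 := Set.pow_subset_pow_right h1 (by norm_num)
  have h46 : A ^ 4 ⊆ A ^ 6 := Set.pow_subset_pow_right h1 (by norm_num)
  let E : Subgroup G :=
    { carrier := {x | x ∈ W ∧ x ∈ A ^ 2 * (p.H : Set G)}
      one_mem' := ⟨one_mem W, (p.isSmall_H h1).subset (one_mem p.H)⟩
      mul_mem' := by
        rintro _ _ ⟨hxW, a, ha, h, hh, rfl⟩ ⟨hyW, b, hb, k, hk, rfl⟩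
        refine ⟨mul_mem hxW hyW, ?_⟩
        have haW : a ∈ W := by simpa using mul_mem hxW (inv_mem (hHW hh))
        have hbW : b ∈ W := by simpa using mul_mem hyW (inv_mem (hHW hk))
        have := hmul (a * b) (h46 (mul_mem_pow ha hb)) (mul_mem haW hbW)
          (b⁻¹ * h * b * k) (mul_mem (p.normalizes.conj_inv (hWC hbW) hh) hk)
        convert this using 1
        simp only [mul_assoc, mul_inv_cancel_left]
      inv_mem' := by
        rintro _ ⟨hxW, a, ha, h, hh, rfl⟩
        refine ⟨inv_mem hxW, ?_⟩
        have haW : a ∈ W := by simpa using mul_mem hxW (inv_mem (hHW hh))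
        refine ⟨a⁻¹, inv_mem_pow hinv ha, a * h⁻¹ * a⁻¹,
          p.normalizes a (hWC haW) _ (inv_mem hh), ?_⟩
        simp [mul_assoc] }
  have hHE : p.H ≤ E := fun h hh => ⟨hHW hh, (p.isSmall_H h1).subset hh⟩
  have hEC : Normalizes p.C E := by
    rw [p.C_eq]
    apply Normalizes.sup_left
    · apply normalizes_closure
      · rw [Set.inter_inv, ← inv_pow, hinv, inv_coe_set]
      · rintro b ⟨hb, hbC⟩ _ ⟨hxW, a, ha, h, hh, rfl⟩
        refine ⟨hW b hbC _ hxW, ?_⟩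
        have haW : a ∈ W := by simpa using mul_mem hxW (inv_mem (hHW hh))
        have := hmul (b * a * b⁻¹) (mul_mem_pow (mul_mem_pow hb ha) (inv_mem_pow hinv hb))
          (hW b hbC a haW) (b * h * b⁻¹) (p.normalizes b hbC h hh)
        convert this using 1
        group
    · exact fun c hc d hd => mul_mem (mul_mem (hHE hc) hd) (inv_mem (hHE hc))
  have hE : p.IsSmall E := ⟨hHE, fun x hx => hWC hx.1, hEC, fun x hx => hx.2⟩
  exact hD.le_of_ge hE (fun d hd => ⟨hDW hd, hD.prop.subset hd⟩) ⟨hxW, hsub x hx hxW⟩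

/-- Either a maximal small subgroup is everything, or some element of `A ^ 6` outside
`A ^ 2 * p.H` has all its commutators with `p.C` in a subgroup meeting `A ^ 6` inside `D`. -/
lemma NormalPair.eq_or_exists (p : NormalPair A) (hG : Group.IsNilpotent G) (hinv : A⁻¹ = A)
    (h1 : (1 : G) ∈ A) {D : Subgroup G} (hD : Maximal p.IsSmall D) :
    D = p.C ∨ ∃ γ ∈ A ^ 6, γ ∈ p.C ∧ γ ∉ A ^ 2 * (p.H : Set G) ∧ ∃ W : Subgroup G,
      (∀ c ∈ p.C, γ⁻¹ * c⁻¹ * γ * c ∈ W) ∧ ∀ x ∈ A ^ 6, x ∈ W → x ∈ D := by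
  obtain ⟨n, hn⟩ := Subgroup.nilpotent_iff_lowerCentralSeries.1 hG
  have key : ∀ j, (∀ x ∈ A ^ 6, x ∈ p.C ⊓ lowerSeries D j → x ∈ A ^ 2 * (p.H : Set G)) →
      ∀ x ∈ A ^ 6, x ∈ p.C ⊓ lowerSeries D j → x ∈ D := fun j hj x hx hxW =>
    p.mem_of_maximal hinv h1 hD (le_inf hD.prop.le_C le_sup_right) inf_le_left
      (fun c hc z hz => ⟨p.C.mul_mem (p.C.mul_mem hc hz.1) (p.C.inv_mem hc),
        normalizes_lowerSeries hD.prop.normalizes j c hc z hz.2⟩) hj hx hxW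
  by_cases h0 : ∀ x ∈ A ^ 6, x ∈ p.C ⊓ lowerSeries D 0 → x ∈ A ^ 2 * (p.H : Set G)
  · refine Or.inl (le_antisymm hD.prop.le_C ?_)
    rw [p.C_eq]
    refine sup_le ((Subgroup.closure_le D).2 ?_) hD.prop.H_le
    rintro x ⟨hx, hxC⟩
    exact key 0 h0 x (Set.pow_subset_pow_right h1 (by norm_num) hx)
      ⟨hxC, Subgroup.mem_sup_left (Subgroup.mem_top x)⟩
  · right
    have hP : ∃ j, ∀ x ∈ A ^ 6, x ∈ p.C ⊓ lowerSeries D j → x ∈ A ^ 2 * (p.H : Set G) := by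
      refine ⟨n, fun x _ hx => hD.prop.subset ?_⟩
      have := hx.2
      rwa [lowerSeries, hn, bot_sup_eq] at this
    classical
    obtain ⟨j, hj⟩ : ∃ j, Nat.find hP = j + 1 :=
      Nat.exists_eq_succ_of_ne_zero (fun h => h0 (h ▸ Nat.find_spec hP))
    have hlt := Nat.find_min hP (m := j) (by omega)
    have hspec := Nat.find_spec hP
    rw [hj] at hspec
    push Not at hlt
    obtain ⟨γ, hγ, hγW, hγn⟩ := hlt
    refine ⟨γ, hγ, hγW.1, hγn, p.C ⊓ lowerSeries D (j + 1), fun c hc => ⟨?_, ?_⟩, key _ hspec⟩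
    · exact p.C.mul_mem (p.C.mul_mem (p.C.mul_mem (p.C.inv_mem hγW.1) (p.C.inv_mem hc)) hγW.1) hc
    · exact commutator_mem_lowerSeries_succ hD.prop.normalizes j hγW.2 hc

end SymmetricSet

end Group

section Counting

variable {G : Type*} [Group G] {K : ℝ} {A : Set G}

lemma isApproximateSubgroup (hA : IsKApproximateSubgroup K A) : IsApproximateSubgroup K A := by
  obtain ⟨-, hinv, h1, X, hX, hXK, hAX⟩ := hA
  refine ⟨h1, hinv, hX.toFinset, ?_, ?_⟩
  · rwa [← Set.ncard_eq_toFinset_card X hX]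
  · simpa [sq] using hAX

lemma exists_finset_pow_subset (hA : IsApproximateSubgroup K A) (n : ℕ) :
    ∃ F : Finset G, (F.card : ℝ) ≤ K ^ n ∧ A ^ (n + 1) ⊆ F * A := by
  classical
  obtain ⟨F, hF, hAF⟩ := hA.sq_covBySMul
  refine ⟨F ^ n, ?_, ?_⟩
  · calc ((F ^ n).card : ℝ) ≤ (F.card : ℝ) ^ n := mod_cast Finset.card_pow_le
      _ ≤ K ^ n := by gcongr
  · rw [Finset.coe_pow]
    exact Set.pow_subset_pow_mul_of_sq_subset_mul hAF (by lia)

/-- If `g` maps `S` into `A ^ (n + 1)` and elements of `S` with `A ^ 2`-close images have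
quotient in `T`, then `|S| ≤ K ^ n |T|`. -/
lemma ncard_le_of_maps_pow (hA : IsApproximateSubgroup K A) {n : ℕ} {S T : Set G}
    (hS : S.Finite) (hT : T.Finite) (g : G → G) (hg : ∀ s ∈ S, g s ∈ A ^ (n + 1))
    (hST : ∀ s ∈ S, ∀ t ∈ S, (g s)⁻¹ * g t ∈ A ^ 2 → s⁻¹ * t ∈ T) :
    (S.ncard : ℝ) ≤ K ^ n * T.ncard := by
  classical
  obtain ⟨F, hF, hAF⟩ := exists_finset_pow_subset hA n
  have hex : ∀ s ∈ S, ∃ x ∈ F, x⁻¹ * g s ∈ A := by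
    intro s hs
    obtain ⟨x, hx, a, ha, hxa⟩ := hAF (hg s hs)
    exact ⟨x, hx, by simpa [← hxa] using ha⟩
  choose! f hfF hfA using hex
  have hcard : hS.toFinset.card ≤ hT.toFinset.card * F.card := by
    refine Finset.card_le_mul_card_image_of_maps_to (f := f)
      (fun s hs => hfF s (hS.mem_toFinset.1 hs)) _ fun x _ => ?_
    rcases (hS.toFinset.filter fun s => f s = x).eq_empty_or_nonempty with he | ⟨s, hs⟩
    · simp [he]
    · simp only [Finset.mem_filter, Set.Finite.mem_toFinset] at hs
      refine Finset.card_le_card_of_injOn (fun t => s⁻¹ * t) ?_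
        (fun _ _ _ _ h => mul_left_cancel h)
      intro t ht
      simp only [Finset.coe_filter, Set.Finite.mem_toFinset, Set.mem_ofPred_eq] at ht
      simp only [Set.Finite.coe_toFinset]
      refine hST s hs.1 t ht.1 ?_
      have h1 : (x⁻¹ * g s)⁻¹ ∈ A := by
        rw [← hA.inv_eq_self]
        simpa [hs.2] using hfA s hs.1
      have h2 := hfA t ht.1
      rw [ht.2] at h2
      rw [sq]
      refine ⟨_, h1, _, h2, ?_⟩
      group
  rw [Set.ncard_eq_toFinset_card S hS, Set.ncard_eq_toFinset_card T hT]
  calc (hS.toFinset.card : ℝ) ≤ hT.toFinset.card * F.card := mod_cast hcard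
    _ ≤ hT.toFinset.card * K ^ n := by gcongr
    _ = _ := mul_comm _ _

lemma NormalPair.ncard_inter_centralizerMod (p : NormalPair A) (hA : IsApproximateSubgroup K A)
    (hfin : A.Finite) {D W : Subgroup G} (hD : Normalizes p.C D) {γ : G} (hγ : γ ∈ A ^ 6)
    (hW : ∀ c ∈ p.C, γ⁻¹ * c⁻¹ * γ * c ∈ W) (hWD : ∀ x ∈ A ^ 6, x ∈ W → x ∈ D) :
    ((A ^ 2 ∩ (p.C : Set G)).ncard : ℝ) ≤
      K ^ 35 * (A ^ 2 ∩ (centralizerMod p.C D hD γ : Set G)).ncard := by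
  set Z := centralizerMod p.C D hD γ
  have hf : ∀ (n : ℕ) (B : Subgroup G), (A ^ n ∩ (B : Set G)).Finite :=
    fun n B => (finite_pow hfin n).subset Set.inter_subset_left
  have h1 : ((A ^ 2 ∩ (p.C : Set G)).ncard : ℝ) ≤ K ^ 9 * (A ^ 4 ∩ (Z : Set G)).ncard := by
    refine ncard_le_of_maps_pow hA (hf 2 _) (hf 4 _) (fun b => b * γ * b⁻¹) ?_ ?_
    · rintro b ⟨hb, -⟩
      have := mul_mem_pow (mul_mem_pow hb hγ) (inv_mem_pow hA.inv_eq_self hb)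
      exact this
    · rintro b ⟨hb, hbC⟩ c ⟨hc, hcC⟩ hbc
      refine ⟨mul_mem_pow (inv_mem_pow hA.inv_eq_self hb) hc,
        mul_mem (inv_mem hbC) hcC, ?_⟩
      have hW' : (b * γ * b⁻¹)⁻¹ * (c * γ * c⁻¹) ∈ W := by
        convert mul_mem (inv_mem (hW b⁻¹ (inv_mem hbC))) (hW c⁻¹ (inv_mem hcC)) using 1
        group
      have h := hWD _ (Set.pow_subset_pow_right hA.one_mem (by norm_num) hbc) hW'
      have h' := hD.conj_inv hcC (inv_mem h)
      have h'' : γ⁻¹ * (c⁻¹ * b * γ * b⁻¹ * c) ∈ D := by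
        convert h' using 1
        group
      convert h'' using 1
      group
  have h2 : ((A ^ 4 ∩ (Z : Set G)).ncard : ℝ) ≤ K ^ 3 * (A ^ 2 ∩ (Z : Set G)).ncard :=
    ncard_le_of_maps_pow hA (hf 4 _) (hf 2 _) id (fun b hb => hb.1)
      fun b hb c hc hbc => ⟨hbc, mul_mem (inv_mem hb.2) hc.2⟩
  have hK := hA.one_le
  calc ((A ^ 2 ∩ (p.C : Set G)).ncard : ℝ)
      ≤ K ^ 9 * (K ^ 3 * (A ^ 2 ∩ (Z : Set G)).ncard) := h1.trans (by gcongr)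
    _ = K ^ 12 * (A ^ 2 ∩ (Z : Set G)).ncard := by ring
    _ ≤ K ^ 35 * (A ^ 2 ∩ (Z : Set G)).ncard := by
      gcongr
      norm_num

variable (K) in
/-- The pair `q` arises from `p` by adjoining to the small subgroup `D` an element `γ` that is
central modulo `D`, and passing to a large subgroup commuting with `γ` modulo `D`. -/
structure NormalPair.IsStep (p : NormalPair A) (D : Subgroup G) (γ : G) (q : NormalPair A) :
    Prop where
  mem : γ ∈ A ^ 6
  notMem : γ ∉ A ^ 2 * (p.H : Set G)
  C_le : q.C ≤ p.C
  H_eq : q.H = Subgroup.closure {γ} ⊔ D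
  mem_C : γ ∈ q.C
  central : ∀ c ∈ q.C, γ⁻¹ * c⁻¹ * γ * c ∈ D
  card_le : ((A ^ 2 ∩ (p.C : Set G)).ncard : ℝ) ≤ K ^ 35 * (A ^ 2 ∩ (q.C : Set G)).ncard

lemma NormalPair.exists_step (p : NormalPair A) (hG : Group.IsNilpotent G)
    (hA : IsApproximateSubgroup K A) (hfin : A.Finite) :
    ∃ (D : Subgroup G) (γ : G) (q : NormalPair A),
      p.IsSmall D ∧ (D ≠ p.C → p.IsStep K D γ q) := by
  obtain ⟨D, hD⟩ := p.exists_maximal hfin hA.one_mem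
  obtain h | ⟨γ, hγ, hγC, hγn, W, hW, hWD⟩ := p.eq_or_exists hG hA.inv_eq_self hA.one_mem hD
  · exact ⟨D, 1, p, hD.prop, fun h' => (h' h).elim⟩
  have hDC := hD.prop.normalizes
  set Z := centralizerMod p.C D hDC γ with hZ
  set H := Subgroup.closure {γ} ⊔ D with hH
  set C := Subgroup.closure (A ^ 2 ∩ (Z : Set G)) ⊔ H with hC
  have hγZ : γ ∈ Z := ⟨hγC, by simp [one_mem]⟩
  have hDZ : D ≤ Z := fun d hd => ⟨hD.prop.le_C hd, by
    simpa [mul_assoc] using mul_mem (hDC.conj_inv hγC (inv_mem hd)) hd⟩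
  have hHZ : H ≤ Z := sup_le ((Subgroup.closure_le Z).2 (by simpa using hγZ)) hDZ
  have hCZ : C ≤ Z := sup_le ((Subgroup.closure_le Z).2 Set.inter_subset_right) hHZ
  have hinter : A ^ 2 ∩ (C : Set G) = A ^ 2 ∩ (Z : Set G) :=
    Set.Subset.antisymm (fun x hx => ⟨hx.1, hCZ hx.2⟩)
      fun x hx => ⟨hx.1, Subgroup.mem_sup_left (Subgroup.subset_closure hx)⟩
  have hZC : Z ≤ p.C := fun x hx => hx.1
  have hγH : γ ∈ H := Subgroup.mem_sup_left (Subgroup.mem_closure_singleton_self γ)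
  have hZH : Normalizes Z H := by
    intro c hc
    suffices H ≤ H.comap (MulAut.conj c).toMonoidHom from fun h hh => this hh
    refine sup_le ((Subgroup.closure_le _).2 ?_) fun d hd =>
      Subgroup.mem_sup_right (hDC c (hZC hc) d hd)
    rw [Set.singleton_subset_iff]
    have := mul_mem hγH (Subgroup.mem_sup_right (inv_mem hc : c⁻¹ ∈ Z).2 : _ ∈ H)
    change c * γ * c⁻¹ ∈ H
    convert this using 1
    group
  refine ⟨D, γ, ⟨C, H, le_sup_right, hZH.mono hCZ, ?_⟩, hD.prop, fun _ =>
    ⟨hγ, hγn, hCZ.trans hZC, rfl, Subgroup.mem_sup_right hγH, fun c hc => (hCZ hc).2, ?_⟩⟩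
  · rw [hinter]
  · change _ ≤ K ^ 35 * ((A ^ 2 ∩ (C : Set G)).ncard : ℝ)
    rw [hinter]
    exact p.ncard_inter_centralizerMod hA hfin hDC hγ hW hWD

/-- Elements of `A ^ 6` each avoiding `A ^ 2` times a subgroup containing the earlier ones:
there are at most `K ^ 6` of them. -/
lemma length_le (hA : IsApproximateSubgroup K A) (hfin : A.Finite) {n : ℕ} (γ : ℕ → G)
    (h6 : ∀ i < n, γ i ∈ A ^ 6) (hsep : ∀ i j, i < j → j < n → γ j * (γ i)⁻¹ ∉ A ^ 2) :
    (n : ℝ) ≤ K ^ 6 := by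
  classical
  lift A to Finset G using hfin
  have hsep' : ∀ i < n, ∀ j < n, ∀ a ∈ A, ∀ b ∈ A, a * γ i = b * γ j → ¬ i < j := by
    intro i _ j hj a ha b hb hab hij
    refine hsep i j hij hj ?_
    have hb' : b⁻¹ ∈ (A : Set G) := by
      rw [← hA.inv_eq_self]
      simpa using hb
    rw [sq]
    refine ⟨b⁻¹, hb', a, ha, ?_⟩
    change b⁻¹ * a = _
    rw [inv_mul_eq_iff_eq_mul, ← mul_assoc, ← hab, mul_inv_cancel_right]
  have hcard : (Finset.range n ×ˢ A).card ≤ (A ^ 7).card := by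
    refine Finset.card_le_card_of_injOn (fun x => x.2 * γ x.1) ?_ ?_
    · rintro ⟨i, a⟩ hx
      simp only [Finset.coe_product, Set.mem_prod, Finset.coe_range, Set.mem_Iio,
        Finset.mem_coe] at hx
      rw [Finset.coe_pow, show 7 = 1 + 6 from rfl]
      exact mul_mem_pow (by simpa using hx.2) (h6 i hx.1)
    · rintro ⟨i, a⟩ hx ⟨j, b⟩ hy hxy
      simp only [Finset.coe_product, Set.mem_prod, Finset.coe_range, Set.mem_Iio,
        Finset.mem_coe] at hx hy hxy
      have h1 := hsep' i hx.1 j hy.1 a hx.2 b hy.2 hxy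
      have h2 := hsep' j hy.1 i hx.1 b hy.2 a hx.2 hxy.symm
      obtain rfl : i = j := by omega
      rw [mul_right_cancel hxy]
  rw [Finset.card_product, Finset.card_range] at hcard
  have hpos : (0 : ℝ) < A.card := by
    exact_mod_cast Finset.card_pos.2 ⟨1, by simpa using hA.one_mem⟩
  have h7 := hA.card_pow_le (n := 7)
  refine le_of_mul_le_mul_right ?_ hpos
  calc (n : ℝ) * A.card ≤ (A ^ 7).card := mod_cast hcard
    _ ≤ K ^ 6 * A.card := h7

/-- A sequence of normal pairs starting at `(⟨A⟩, 1)`, each obtained from the previous one by a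
step, and stopping after `k ≤ K ^ 6` steps at a pair for which `p.C` itself is small. -/
theorem exists_sequence (hG : Group.IsNilpotent G) (hA : IsApproximateSubgroup K A)
    (hfin : A.Finite) :
    ∃ (k : ℕ) (p : ℕ → NormalPair A) (D : ℕ → Subgroup G) (γ : ℕ → G),
      (k : ℝ) ≤ K ^ 6 ∧ (p 0).C = Subgroup.closure A ∧ (p 0).H = ⊥ ∧
      (∀ i, (p i).IsSmall (D i)) ∧
      (∀ i < k, (p i).IsStep K (D i) (γ i) (p (i + 1))) ∧ D k = (p k).C := by
  have hAA : Subgroup.closure A =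
      Subgroup.closure (A ^ 2 ∩ (Subgroup.closure A : Set G)) ⊔ (⊥ : Subgroup G) := by
    rw [sup_bot_eq]
    refine le_antisymm (Subgroup.closure_mono fun a ha => ⟨?_, Subgroup.subset_closure ha⟩)
      ((Subgroup.closure_le _).2 Set.inter_subset_right)
    exact Set.pow_subset_pow_right hA.one_mem one_le_two (by simpa using ha)
  choose D γ q hD hq using fun p : NormalPair A => p.exists_step hG hA hfin
  let p : ℕ → NormalPair A := fun n => q^[n] ⟨Subgroup.closure A, ⊥, bot_le,
    fun c _ d hd => by simp [Subgroup.mem_bot.1 hd], hAA⟩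
  have hp : ∀ i, p (i + 1) = q (p i) := fun i => Function.iterate_succ_apply' q i _
  have hlen : ∀ n, (∀ i < n, D (p i) ≠ (p i).C) → (n : ℝ) ≤ K ^ 6 := by
    intro n hn
    have hstep : ∀ i < n, (p i).IsStep K (D (p i)) (γ (p i)) (p (i + 1)) :=
      fun i hi => hp i ▸ hq (p i) (hn i hi)
    have hmono : ∀ i j, i ≤ j → j ≤ n → (p i).H ≤ (p j).H := by
      intro i j hij
      induction j, hij using Nat.le_induction with
      | base => exact fun _ => le_rfl
      | succ j hij ih =>
        intro hj
        rw [(hstep j (by omega)).H_eq]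
        exact ((ih (by omega)).trans (hD (p j)).H_le).trans le_sup_right
    refine length_le hA hfin (fun i => γ (p i)) (fun i hi => (hstep i hi).mem) ?_
    intro i j hij hj hmem
    refine (hstep j hj).notMem ⟨_, hmem, γ (p i), hmono (i + 1) j hij hj.le ?_, ?_⟩
    · rw [(hstep i (by omega)).H_eq]
      exact Subgroup.mem_sup_left (Subgroup.mem_closure_singleton_self _)
    · simp
  have hex : ∃ k, D (p k) = (p k).C := by
    by_contra! hne
    obtain ⟨n, hn⟩ := exists_nat_gt (K ^ 6)
    exact (hlen n fun i _ => hne i).not_gt hn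
  classical
  refine ⟨Nat.find hex, p, fun i => D (p i), fun i => γ (p i),
    hlen _ fun i hi => Nat.find_min hex hi, rfl, rfl, fun i => hD (p i), fun i hi => ?_,
    Nat.find_spec hex⟩
  exact hp i ▸ hq (p i) (Nat.find_min hex hi)

end Counting

end NilpotentApproximateSubgroup

theorem statement_11 {G : Type*} [Group G] (hG : Group.IsNilpotent G)
    (K : ℝ) (hK : 1 ≤ K) (A : Set G) (hA : IsKApproximateSubgroup K A) :
    ∃ (k : ℕ) (D C : ℕ → Subgroup G) (γ : ℕ → G),
      (k : ℝ) ≤ K ^ 6 ∧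
      -- the D_i are nested, the C_i are nested, C_0 = ⟨A⟩
      (∀ i, 1 ≤ i → i ≤ k → D i ≤ D (i + 1)) ∧
      (∀ i, 1 ≤ i → i ≤ k → C i ≤ C (i - 1)) ∧
      C 0 = Subgroup.closure A ∧
      -- γ_i normalises D_i
      (∀ i, 1 ≤ i → i ≤ k → ∀ d ∈ D i, γ i * d * (γ i)⁻¹ ∈ D i) ∧
      -- writing H_0 = {1} and H_i = ⟨γ_i⟩·D_i, the eight conditions hold:
      ∀ H : ℕ → Set G,
        H 0 = {1} →
        (∀ i, 1 ≤ i → i ≤ k →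
          H i = (Subgroup.closure {γ i} : Set G) * (D i : Set G)) →
        -- (1) D_i is normal in C_{i-1}
        (∀ i, 1 ≤ i → i ≤ k → D i ≤ C (i - 1) ∧
          ∀ c ∈ C (i - 1), ∀ d ∈ D i, c * d * c⁻¹ ∈ D i) ∧
        -- (2) γ_i is central in C_i/D_i; in particular H_i is normal in C_i
        (∀ i, 1 ≤ i → i ≤ k → γ i ∈ C i ∧
          (∀ c ∈ C i, (γ i)⁻¹ * c⁻¹ * γ i * c ∈ D i) ∧
          (∀ c ∈ C i, ∀ h ∈ H i, c * h * c⁻¹ ∈ H i)) ∧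
        -- (3) H_{i-1} ⊆ D_i
        (∀ i, 1 ≤ i → i ≤ k → H (i - 1) ⊆ (D i : Set G)) ∧
        -- (4) D_i ⊆ A²·H_{i-1}
        (∀ i, 1 ≤ i → i ≤ k → (D i : Set G) ⊆ A ^ 2 * H (i - 1)) ∧
        -- (5) C_i = ⟨A² ∩ C_i⟩·H_i
        (∀ i, 1 ≤ i → i ≤ k →
          (C i : Set G) = (Subgroup.closure (A ^ 2 ∩ (C i : Set G)) : Set G) * H i) ∧
        -- (6) γ_i ∈ A⁶ \ A²·H_{i-1}
        (∀ i, 1 ≤ i → i ≤ k → γ i ∈ A ^ 6 ∧ γ i ∉ A ^ 2 * H (i - 1)) ∧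
        -- (7) |A² ∩ C_i| ≥ K^{-35i}·|A|
        (∀ i, 1 ≤ i → i ≤ k →
          (A.ncard : ℝ) / K ^ (35 * i) ≤ ((A ^ 2 ∩ (C i : Set G)).ncard : ℝ)) ∧
        -- (8) C_k = D_{k+1}
        C k = D (k + 1) := by
  have hA' := NilpotentApproximateSubgroup.isApproximateSubgroup hA
  obtain ⟨k, p, D, γ, hk, hC0, hH0, hD, hstep, hlast⟩ :=
    NilpotentApproximateSubgroup.exists_sequence hG hA' hA.1
  have hcard : ∀ i ≤ k,
      (A.ncard : ℝ) ≤ K ^ (35 * i) * (A ^ 2 ∩ ((p i).C : Set G)).ncard := by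
    intro i
    induction i with
    | zero =>
      intro _
      rw [hC0]
      simp only [mul_zero, pow_zero, one_mul, Nat.cast_le]
      refine Set.ncard_le_ncard (fun a ha => ⟨?_, Subgroup.subset_closure ha⟩)
        ((NilpotentApproximateSubgroup.finite_pow hA.1 2).subset Set.inter_subset_left)
      exact Set.pow_subset_pow_right hA'.one_mem one_le_two (by simpa using ha)
    | succ i ih =>
      intro hi
      calc (A.ncard : ℝ) ≤ K ^ (35 * i) * (A ^ 2 ∩ ((p i).C : Set G)).ncard := ih (by omega)
        _ ≤ K ^ (35 * i) * (K ^ 35 * (A ^ 2 ∩ ((p (i + 1)).C : Set G)).ncard) := by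
          gcongr
          exact (hstep i hi).card_le
        _ = _ := by ring
  have hγC : ∀ i < k, γ i ∈ (p i).C := fun i hi => (hstep i hi).C_le (hstep i hi).mem_C
  have hHD : ∀ i < k, ((p (i + 1)).H : Set G) =
      (Subgroup.closure {γ i} : Set G) * (D i : Set G) := by
    intro i hi
    rw [(hstep i hi).H_eq]
    refine ((hD i).normalizes.mono ?_).coe_sup
    exact (Subgroup.closure_le _).2 (by simpa using hγC i hi)
  refine ⟨k, fun i => D (i - 1), fun i => (p i).C, fun i => γ (i - 1), hk, ?_, ?_, hC0, ?_, ?_⟩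
  · rintro (_ | i) h1 hi
    · omega
    refine le_trans ?_ (hD (i + 1)).H_le
    rw [(hstep i hi).H_eq]
    exact le_sup_right
  · rintro (_ | i) h1 hi
    · omega
    exact (hstep i hi).C_le
  · rintro (_ | i) h1 hi
    · omega
    exact (hD i).normalizes _ (hγC i hi)
  · intro H hzero hsucc
    have hH : ∀ i ≤ k, H i = (p i).H := by
      rintro (_ | i) hi
      · rw [hzero, hH0, Subgroup.coe_bot]
      · rw [hsucc (i + 1) (by omega) hi, hHD i hi]
        rfl
    refine ⟨?_, ?_, ?_, ?_, ?_, ?_, ?_, hlast.symm⟩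
    all_goals
      rintro (_ | i) h1 hi
      · omega
      simp only [Nat.add_sub_cancel]
    · exact ⟨(hD i).le_C, (hD i).normalizes⟩
    · rw [hH _ hi]
      exact ⟨(hstep i hi).mem_C, (hstep i hi).central, (p (i + 1)).normalizes⟩
    · rw [hH i (by omega)]
      exact (hD i).H_le
    · rw [hH i (by omega)]
      exact (hD i).subset
    · rw [hH _ hi, ← NilpotentApproximateSubgroup.Normalizes.coe_sup, ← (p (i + 1)).C_eq]
      exact (p (i + 1)).normalizes.mono ((Subgroup.closure_le _).2 Set.inter_subset_right)
    · rw [hH i (by omega)]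
      exact ⟨(hstep i hi).mem, (hstep i hi).notMem⟩
    · rw [div_le_iff₀' (by positivity)]
      exact hcard (i + 1) hi
end
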